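/- Let d ≥ 3. There exist η₀ ∈ (0, 1/2) depending only on d and C ≥ 1 depending only on d such that: if v is a solution of the hodograph PDE on H₁ = {y : y_d ≥ 0, |y| ≥ 1} which is bounded from above or from below and satisfies |∇v(y)| ≤ η₀ on H₁, then there exist s, k ∈ ℝ such that for all y ∈ H₁, |v(y) − s − k|y|^{2−d}| ≤ C·|y|^{1−d}·m, with |k| ≤ C·m and |s| ≤ |⨍_{∂B₁ ∩ {y_d>0}} v dS| + C·m, where m := osc_K v and ⨍ denotes the average with respect to surface measure over the open upper half of the unit sphere. -/

import Mathlib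

open Real Set Filter MeasureTheory

noncomputable section

/-- The last index of `Fin d`. -/
def lastIdx (d : ℕ) (hd : 0 < d) : Fin d := ⟨d - 1, by omega⟩

/-- The `i`-th partial derivative of `v` at `y`. -/
def gradC (d : ℕ) (v : EuclideanSpace ℝ (Fin d) → ℝ)
    (y : EuclideanSpace ℝ (Fin d)) (i : Fin d) : ℝ :=
  fderiv ℝ v y (EuclideanSpace.single i 1)

/-- The `(i,j)` entry of the Hessian of `v` at `y`. -/
def hessC (d : ℕ) (v : EuclideanSpace ℝ (Fin d) → ℝ)
    (y : EuclideanSpace ℝ (Fin d)) (i j : Fin d) : ℝ :=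
  fderiv ℝ (fun z => fderiv ℝ v z (EuclideanSpace.single i 1)) y (EuclideanSpace.single j 1)

/-- The squared euclidean norm of the tangential part `p'` of `p`. -/
def tangSq (d : ℕ) (hd : 0 < d) (p : Fin d → ℝ) : ℝ :=
  ∑ m : Fin d, if m = lastIdx d hd then 0 else (p m) ^ 2

/-- The coefficient matrix `A(p)` of the hodograph PDE. -/
def hodA (d : ℕ) (hd : 0 < d) (p : Fin d → ℝ) (i j : Fin d) : ℝ :=
  if i = lastIdx d hd then
    (if j = lastIdx d hd then (1 + tangSq d hd p) / (1 + p (lastIdx d hd)) ^ 2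
     else p j / (1 + p (lastIdx d hd)))
  else
    (if j = lastIdx d hd then p i / (1 + p (lastIdx d hd))
     else if i = j then 1 else 0)

/-- The boundary nonlinearity `N(p') = √(1 + |p'|²) - 1`. -/
def hodN (d : ℕ) (hd : 0 < d) (p : Fin d → ℝ) : ℝ :=
  Real.sqrt (1 + tangSq d hd p) - 1

/-- The quantity `tr(A(∇v(y)) D²v(y))`. -/
def hodOp (d : ℕ) (hd : 0 < d) (v : EuclideanSpace ℝ (Fin d) → ℝ)
    (y : EuclideanSpace ℝ (Fin d)) : ℝ :=
  ∑ i : Fin d, ∑ j : Fin d, hodA d hd (fun m => gradC d v y m) i j * hessC d v y i j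

/-- `v` is `C^∞` on an open neighborhood of `U`. -/
def SmoothNear (d : ℕ) (v : EuclideanSpace ℝ (Fin d) → ℝ)
    (U : Set (EuclideanSpace ℝ (Fin d))) : Prop :=
  ∃ W : Set (EuclideanSpace ℝ (Fin d)), IsOpen W ∧ U ⊆ W ∧ ContDiffOn ℝ (⊤ : ℕ∞) v W

/-- `v` is a (classical) solution of the hodograph PDE on `U`. -/
def IsHodSol (d : ℕ) (hd : 0 < d) (v : EuclideanSpace ℝ (Fin d) → ℝ)
    (U : Set (EuclideanSpace ℝ (Fin d))) : Prop :=
  SmoothNear d v U ∧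
  (∀ y ∈ U, 0 < y (lastIdx d hd) → hodOp d hd v y = 0) ∧
  (∀ y ∈ U, y (lastIdx d hd) = 0 →
    gradC d v y (lastIdx d hd) = hodN d hd (fun m => gradC d v y m))

/-- `v` is a subsolution of the hodograph PDE on `U`. -/
def IsHodSubsol (d : ℕ) (hd : 0 < d) (v : EuclideanSpace ℝ (Fin d) → ℝ)
    (U : Set (EuclideanSpace ℝ (Fin d))) : Prop :=
  SmoothNear d v U ∧
  (∀ y ∈ U, 0 < y (lastIdx d hd) → 0 ≤ hodOp d hd v y) ∧
  (∀ y ∈ U, y (lastIdx d hd) = 0 →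
    hodN d hd (fun m => gradC d v y m) ≤ gradC d v y (lastIdx d hd))

/-- `v` is a supersolution of the hodograph PDE on `U`. -/
def IsHodSupersol (d : ℕ) (hd : 0 < d) (v : EuclideanSpace ℝ (Fin d) → ℝ)
    (U : Set (EuclideanSpace ℝ (Fin d))) : Prop :=
  SmoothNear d v U ∧
  (∀ y ∈ U, 0 < y (lastIdx d hd) → hodOp d hd v y ≤ 0) ∧
  (∀ y ∈ U, y (lastIdx d hd) = 0 →
    gradC d v y (lastIdx d hd) ≤ hodN d hd (fun m => gradC d v y m))

/-- The exterior half-space domain `H₁ = {y : y_d ≥ 0, |y| ≥ 1}`. -/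
def extDom (d : ℕ) (hd : 0 < d) : Set (EuclideanSpace ℝ (Fin d)) :=
  {y | 0 ≤ y (lastIdx d hd) ∧ 1 ≤ ‖y‖}

/-- The half annulus `A_r = {y : 1 ≤ |y| ≤ r, y_d ≥ 0}`. -/
def halfAnn (d : ℕ) (hd : 0 < d) (r : ℝ) : Set (EuclideanSpace ℝ (Fin d)) :=
  {y | 0 ≤ y (lastIdx d hd) ∧ 1 ≤ ‖y‖ ∧ ‖y‖ ≤ r}

/-- The upper half sphere `∂B_ρ⁺ = {y : y_d ≥ 0, |y| = ρ}`. -/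
def upSphere (d : ℕ) (hd : 0 < d) (ρ : ℝ) : Set (EuclideanSpace ℝ (Fin d)) :=
  {y | 0 ≤ y (lastIdx d hd) ∧ ‖y‖ = ρ}

/-- The filter of `|y| → ∞` within `H₁`. -/
def farFilter (d : ℕ) (hd : 0 < d) : Filter (EuclideanSpace ℝ (Fin d)) :=
  (Filter.comap (fun y : EuclideanSpace ℝ (Fin d) => ‖y‖) Filter.atTop) ⊓
    Filter.principal (extDom d hd)

open scoped Topology ContDiff

/-! ### Second-order jets of functions of one variable -/

/-- `f` has value `a`, first derivative `b` and second derivative `c` at `0`. -/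
def HasJet (f : ℝ → ℝ) (a b c : ℝ) : Prop :=
  f 0 = a ∧ ∃ f' : ℝ → ℝ, (∀ᶠ t in 𝓝 (0 : ℝ), HasDerivAt f (f' t) t) ∧ f' 0 = b ∧
    HasDerivAt f' c 0

namespace HasJet

variable {f g : ℝ → ℝ} {a b c a' b' c' : ℝ}

lemma congr_val (h : HasJet f a b c) (ha : a = a') (hb : b = b') (hc : c = c') :
    HasJet f a' b' c' := by
  subst ha hb hc; exact h

lemma const (r : ℝ) : HasJet (fun _ => r) r 0 0 :=
  ⟨rfl, fun _ => 0, Eventually.of_forall fun t => hasDerivAt_const t r, rfl,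
    hasDerivAt_const 0 (0 : ℝ)⟩

lemma add (hf : HasJet f a b c) (hg : HasJet g a' b' c') :
    HasJet (fun t => f t + g t) (a + a') (b + b') (c + c') := by
  obtain ⟨h0, f', h1, h2, h3⟩ := hf
  obtain ⟨k0, g', k1, k2, k3⟩ := hg
  refine ⟨by simp [h0, k0], fun t => f' t + g' t, ?_, by simp [h2, k2], h3.add k3⟩
  filter_upwards [h1, k1] with t ht kt using ht.add kt

lemma mul (hf : HasJet f a b c) (hg : HasJet g a' b' c') :
    HasJet (fun t => f t * g t) (a * a') (b * a' + a * b') (c * a' + 2 * (b * b') + a * c') := by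
  obtain ⟨h0, f', h1, h2, h3⟩ := hf
  obtain ⟨k0, g', k1, k2, k3⟩ := hg
  refine ⟨by simp [h0, k0], fun t => f' t * g t + f t * g' t, ?_, by simp [h0, k0, h2, k2], ?_⟩
  · filter_upwards [h1, k1] with t ht kt using ht.mul kt
  · have := (h3.mul k1.self_of_nhds).add (h1.self_of_nhds.mul k3)
    rw [h0, k0, h2, k2] at this
    exact this.congr_deriv (by ring)

lemma const_mul (hf : HasJet f a b c) (r : ℝ) :
    HasJet (fun t => r * f t) (r * a) (r * b) (r * c) :=
  ((const r).mul hf).congr_val rfl (by ring) (by ring)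

lemma neg (hf : HasJet f a b c) : HasJet (fun t => - f t) (-a) (-b) (-c) := by
  simpa using hf.const_mul (-1)

lemma sub (hf : HasJet f a b c) (hg : HasJet g a' b' c') :
    HasJet (fun t => f t - g t) (a - a') (b - b') (c - c') := by
  simpa [sub_eq_add_neg] using hf.add hg.neg

lemma sq (hf : HasJet f a b c) :
    HasJet (fun t => f t ^ 2) (a ^ 2) (2 * (a * b)) (2 * b ^ 2 + 2 * (a * c)) := by
  have := (hf.mul hf).congr_val (a' := a ^ 2) (b' := 2 * (a * b)) (c' := 2 * b ^ 2 + 2 * (a * c))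
    (by ring) (by ring) (by ring)
  simpa [_root_.pow_two] using this

lemma sum {ι : Type*} {s : Finset ι} {F : ι → ℝ → ℝ} {A B C : ι → ℝ}
    (h : ∀ i ∈ s, HasJet (F i) (A i) (B i) (C i)) :
    HasJet (fun t => ∑ i ∈ s, F i t) (∑ i ∈ s, A i) (∑ i ∈ s, B i) (∑ i ∈ s, C i) := by
  classical
  induction s using Finset.induction_on with
  | empty => simpa using const 0
  | insert i s hi ih =>
    have h1 := h i (Finset.mem_insert_self i s)
    have h2 := ih fun j hj => h j (Finset.mem_insert_of_mem hj)
    simpa [Finset.sum_insert hi] using h1.add h2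

lemma rpow (hf : HasJet f a b c) (ha : 0 < a) (p : ℝ) :
    HasJet (fun t => f t ^ p) (a ^ p) (p * a ^ (p - 1) * b)
      (p * (p - 1) * a ^ (p - 2) * b ^ 2 + p * a ^ (p - 1) * c) := by
  obtain ⟨h0, f', h1, h2, h3⟩ := hf
  have hd : HasDerivAt f b 0 := h2 ▸ h1.self_of_nhds
  have hpos : ∀ᶠ t in 𝓝 (0 : ℝ), 0 < f t :=
    hd.continuousAt.eventually (lt_mem_nhds (by simpa [h0] using ha))
  refine ⟨by simp [h0], fun t => p * f t ^ (p - 1) * f' t, ?_, by simp [h0, h2], ?_⟩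
  · filter_upwards [h1, hpos] with t ht kt
    exact (ht.rpow_const (Or.inl kt.ne')).congr_deriv (by ring)
  · have e := ((hd.rpow_const (p := p - 1) (Or.inl (by rw [h0]; exact ha.ne'))).const_mul p).mul h3
    refine e.congr_deriv ?_
    rw [h0, h2, show p - 1 - 1 = p - 2 by ring]
    ring

lemma affine (x y : ℝ) : HasJet (fun t => x + t * y) x y 0 :=
  ⟨by simp, fun _ => y, Eventually.of_forall fun t => by
    simpa using ((hasDerivAt_id t).mul_const y).const_add x, rfl, hasDerivAt_const 0 y⟩

lemma nonneg_of_isLocalMin (hf : HasJet f a b c) (h : IsLocalMin f 0) : 0 ≤ c := by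
  obtain ⟨h0, f', h1, h2, h3⟩ := hf
  by_contra! hc
  have hb : f' 0 = 0 := h.hasDerivAt_eq_zero h1.self_of_nhds
  have e1 : deriv f =ᶠ[𝓝 0] f' := h1.mono fun t ht => ht.deriv
  have e2 : deriv (deriv f) 0 = c := by rw [e1.deriv_eq, h3.deriv]
  have e3 : IsLocalMax f 0 := isLocalMax_of_deriv_deriv_neg (by rw [e2]; exact hc)
    (by rw [e1.self_of_nhds, hb]) h1.self_of_nhds.continuousAt
  have e4 : ∀ᶠ t in 𝓝 (0 : ℝ), f t = f 0 := by
    filter_upwards [h, e3] with t h1 h2 using le_antisymm h2 h1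
  have e5 : f' =ᶠ[𝓝 0] fun _ => 0 := by
    filter_upwards [h1, e4.eventually_nhds] with t ht kt
    have : f =ᶠ[𝓝 t] fun _ => f 0 := kt
    exact ht.unique ((hasDerivAt_const t (f 0)).congr_of_eventuallyEq this)
  have := h3.unique ((hasDerivAt_const (0 : ℝ) (0 : ℝ)).congr_of_eventuallyEq e5)
  exact hc.ne this

lemma nonpos_of_isLocalMax (hf : HasJet f a b c) (h : IsLocalMax f 0) : c ≤ 0 := by
  have := hf.neg.nonneg_of_isLocalMin h.neg
  linarith

lemma of_contDiffAt {E : Type*} [NormedAddCommGroup E] [NormedSpace ℝ E] {F : E → ℝ} {y : E}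
    (h : ContDiffAt ℝ 2 F y) (ξ : E) :
    HasJet (fun t : ℝ => F (y + t • ξ)) (F y) (fderiv ℝ F y ξ)
      (fderiv ℝ (fderiv ℝ F) y ξ ξ) := by
  have hl : ∀ t : ℝ, HasDerivAt (fun t : ℝ => y + t • ξ) ξ t := fun t => by
    simpa using ((hasDerivAt_id t).smul_const ξ).const_add y
  have hc : Tendsto (fun t : ℝ => y + t • ξ) (𝓝 0) (𝓝 y) := by
    simpa [ContinuousAt] using (hl 0).continuousAt
  refine ⟨by simp, fun t => fderiv ℝ F (y + t • ξ) ξ, ?_, by simp, ?_⟩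
  · have h1 : ∀ᶠ z in 𝓝 y, ContDiffAt ℝ 2 F z := h.eventually (by simp)
    filter_upwards [hc.eventually h1] with t ht
    exact (ht.differentiableAt (by norm_num)).hasFDerivAt.comp_hasDerivAt t (hl t)
  · have h1 : DifferentiableAt ℝ (fderiv ℝ F) y :=
      (h.fderiv_right (m := 1) (by norm_num)).differentiableAt (by norm_num)
    have h2 : HasFDerivAt (fderiv ℝ F) (fderiv ℝ (fderiv ℝ F) y) (y + (0 : ℝ) • ξ) := by
      simpa using h1.hasFDerivAt
    have h3 := h2.comp_hasDerivAt (0 : ℝ) (hl 0)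
    exact ((ContinuousLinearMap.apply ℝ ℝ ξ).hasFDerivAt.comp_hasDerivAt (0 : ℝ) h3)

end HasJet

/-! ### Partial derivatives -/

/-- The partial derivative of `f` along the `i`-th coordinate vector. -/
def pd {d : ℕ} (i : Fin d) (f : EuclideanSpace ℝ (Fin d) → ℝ) :
    EuclideanSpace ℝ (Fin d) → ℝ :=
  fun y => fderiv ℝ f y (EuclideanSpace.single i 1)

section PartialDerivatives

variable {d : ℕ} {f g : EuclideanSpace ℝ (Fin d) → ℝ} {y : EuclideanSpace ℝ (Fin d)}
  {W : Set (EuclideanSpace ℝ (Fin d))}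

lemma eq_sum_single (x : EuclideanSpace ℝ (Fin d)) :
    x = ∑ i, x i • EuclideanSpace.single i (1 : ℝ) := by
  ext j
  simp [Finset.sum_apply, Pi.single_apply]

lemma fderiv_apply_eq_sum (x : EuclideanSpace ℝ (Fin d)) :
    fderiv ℝ f y x = ∑ i, x i * pd i f y := by
  conv_lhs => rw [eq_sum_single x]
  simp [pd]

lemma abs_pd_le (i : Fin d) : |pd i f y| ≤ ‖fderiv ℝ f y‖ := by
  have := (fderiv ℝ f y).le_opNorm (EuclideanSpace.single i 1)
  simpa [pd] using this

lemma norm_fderiv_le_sum : ‖fderiv ℝ f y‖ ≤ ∑ i, |pd i f y| := by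
  refine ContinuousLinearMap.opNorm_le_bound _ (Finset.sum_nonneg fun i _ => abs_nonneg _) ?_
  intro x
  rw [fderiv_apply_eq_sum, Real.norm_eq_abs, Finset.sum_mul]
  refine (Finset.abs_sum_le_sum_abs _ _).trans (Finset.sum_le_sum fun i _ => ?_)
  rw [abs_mul, mul_comm]
  gcongr
  simpa using EuclideanSpace.norm_eq x ▸ PiLp.norm_apply_le x i

lemma pd_add {i : Fin d} (hf : DifferentiableAt ℝ f y) (hg : DifferentiableAt ℝ g y) :
    pd i (fun z => f z + g z) y = pd i f y + pd i g y := by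
  simp [pd, fderiv_fun_add hf hg]

lemma pd_sub {i : Fin d} (hf : DifferentiableAt ℝ f y) (hg : DifferentiableAt ℝ g y) :
    pd i (fun z => f z - g z) y = pd i f y - pd i g y := by
  simp [pd, fderiv_fun_sub hf hg]

lemma pd_mul {i : Fin d} (hf : DifferentiableAt ℝ f y) (hg : DifferentiableAt ℝ g y) :
    pd i (fun z => f z * g z) y = pd i f y * g y + f y * pd i g y := by
  simp [pd, fderiv_fun_mul hf hg]; ring

lemma pd_sq {i : Fin d} (hf : DifferentiableAt ℝ f y) :
    pd i (fun z => f z ^ 2) y = 2 * f y * pd i f y := by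
  simp only [_root_.pow_two]
  rw [pd_mul hf hf]; ring

lemma pd_const_mul {i : Fin d} (c : ℝ) (hf : DifferentiableAt ℝ f y) :
    pd i (fun z => c * f z) y = c * pd i f y := by
  rw [pd_mul (differentiableAt_const c) hf]; simp [pd]

lemma pd_sum {i : Fin d} {ι : Type*} {s : Finset ι} {F : ι → EuclideanSpace ℝ (Fin d) → ℝ}
    (h : ∀ j ∈ s, DifferentiableAt ℝ (F j) y) :
    pd i (fun z => ∑ j ∈ s, F j z) y = ∑ j ∈ s, pd i (F j) y := by
  simp [pd, fderiv_fun_sum h]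

lemma pd_congr {i : Fin d} (h : f =ᶠ[𝓝 y] g) : pd i f y = pd i g y := by
  simp [pd, h.fderiv_eq]

lemma contDiffOn_pd (hW : IsOpen W) (hf : ContDiffOn ℝ ∞ f W) (i : Fin d) :
    ContDiffOn ℝ ∞ (pd i f) W :=
  (hf.fderiv_of_isOpen hW (m := ∞) (by simp)).clm_apply contDiffOn_const

lemma fderiv_fderiv_single {i j : Fin d} (h : ContDiffAt ℝ 2 f y) :
    fderiv ℝ (fderiv ℝ f) y (EuclideanSpace.single j 1) (EuclideanSpace.single i 1) =
      pd j (pd i f) y := by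
  have h1 : DifferentiableAt ℝ (fderiv ℝ f) y :=
    (h.fderiv_right (m := 1) (by norm_num)).differentiableAt (by norm_num)
  unfold pd
  rw [fderiv_clm_apply h1 (differentiableAt_const _)]
  simp

lemma pd_comm {i j : Fin d} (h : ContDiffAt ℝ 2 f y) : pd i (pd j f) y = pd j (pd i f) y := by
  rw [← fderiv_fderiv_single h, ← fderiv_fderiv_single h]
  exact h.isSymmSndFDerivAt (by simp) _ _

end PartialDerivatives

/-! ### Solutions with small gradient -/

/-- The half-space `{y_ℓ ≥ 0}`. -/
def upHalf {d : ℕ} (ℓ : Fin d) : Set (EuclideanSpace ℝ (Fin d)) := {y | 0 ≤ y ℓ}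

/-- The `k`-th vector `e_k + c_k e_ℓ` of a decomposition `A(∇v) = ∑ k, ξ_k ξ_kᵀ` has
coefficient `dirCoef ℓ v k`. -/
def dirCoef {d : ℕ} (ℓ : Fin d) (v : EuclideanSpace ℝ (Fin d) → ℝ) (k : Fin d)
    (y : EuclideanSpace ℝ (Fin d)) : ℝ :=
  (if k = ℓ then - pd ℓ v y else pd k v y) / (1 + pd ℓ v y)

/-- Second derivative of `F` in the direction `e_k + c e_ℓ`. -/
def secDir {d : ℕ} (ℓ : Fin d) (c : ℝ) (k : Fin d) (F : EuclideanSpace ℝ (Fin d) → ℝ)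
    (y : EuclideanSpace ℝ (Fin d)) : ℝ :=
  pd k (pd k F) y + 2 * c * pd k (pd ℓ F) y + c ^ 2 * pd ℓ (pd ℓ F) y

/-- The defining function `v_ℓ + v_ℓ² - |∇v|²/2` of the boundary condition. -/
def bdryFun {d : ℕ} (ℓ : Fin d) (v : EuclideanSpace ℝ (Fin d) → ℝ)
    (y : EuclideanSpace ℝ (Fin d)) : ℝ :=
  pd ℓ v y + pd ℓ v y ^ 2 - (1 / 2) * ∑ j, pd j v y ^ 2

/-- A solution of the hodograph problem in the exterior half-space with gradient at most `η`. -/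
structure SmallSol {d : ℕ} (ℓ : Fin d) (η : ℝ) (v : EuclideanSpace ℝ (Fin d) → ℝ) : Prop where
  smooth : ∃ W : Set (EuclideanSpace ℝ (Fin d)), IsOpen W ∧ (∀ y, 0 ≤ y ℓ → 1 ≤ ‖y‖ → y ∈ W) ∧
    ContDiffOn ℝ ∞ v W
  pde : ∀ y, 0 ≤ y ℓ → 1 ≤ ‖y‖ → ∑ k, secDir ℓ (dirCoef ℓ v k y) k v y = 0
  bdry : ∀ y, y ℓ = 0 → 1 ≤ ‖y‖ → bdryFun ℓ v y = 0
  bdry_nonneg : ∀ y, y ℓ = 0 → 1 ≤ ‖y‖ → 0 ≤ pd ℓ v y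
  small : ∀ y, 0 ≤ y ℓ → 1 ≤ ‖y‖ → ‖fderiv ℝ v y‖ ≤ η

section Bridge

variable {d : ℕ}

lemma sum_eq_add_ne {ι : Type*} [Fintype ι] [DecidableEq ι] (ℓ : ι) (f : ι → ℝ) :
    ∑ i, f i = f ℓ + ∑ i, if i = ℓ then 0 else f i := by
  rw [← Finset.add_sum_erase _ f (Finset.mem_univ ℓ), Finset.sum_ite, Finset.sum_const_zero,
    zero_add]
  congr 2
  ext i; simp

lemma hodOp_eq (hd : 0 < d) (v : EuclideanSpace ℝ (Fin d) → ℝ) (y : EuclideanSpace ℝ (Fin d))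
    (hv : ContDiffAt ℝ 2 v y) (hq : 1 + pd (lastIdx d hd) v y ≠ 0) :
    hodOp d hd v y =
      ∑ k, secDir (lastIdx d hd) (dirCoef (lastIdx d hd) v k y) k v y := by
  set ℓ := lastIdx d hd with hℓ
  have hH : ∀ i j, hessC d v y i j = pd j (pd i v) y := fun i j => rfl
  have hP : ∀ i, gradC d v y i = pd i v y := fun i => rfl
  have hT : tangSq d hd (fun m => gradC d v y m) = ∑ m, if m = ℓ then 0 else pd m v y ^ 2 := rfl
  unfold hodOp
  rw [sum_eq_add_ne ℓ, sum_eq_add_ne ℓ (fun k => secDir ℓ _ k v y)]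
  have h1 : ∑ j, hodA d hd (fun m => gradC d v y m) ℓ j * hessC d v y ℓ j =
      (1 + ∑ m, if m = ℓ then 0 else pd m v y ^ 2) / (1 + pd ℓ v y) ^ 2 * pd ℓ (pd ℓ v) y +
      ∑ j, if j = ℓ then 0 else pd j v y / (1 + pd ℓ v y) * pd j (pd ℓ v) y := by
    rw [sum_eq_add_ne ℓ]
    congr 1
    · rw [hH, hodA, if_pos hℓ, if_pos hℓ, hT, ← hℓ, hP]
    · refine Finset.sum_congr rfl fun j _ => ?_
      by_cases hj : j = ℓ
      · simp [hj]
      · simp [hodA, ← hℓ, hj, hH, hP]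
  have h2 : ∀ i, i ≠ ℓ → ∑ j, hodA d hd (fun m => gradC d v y m) i j * hessC d v y i j =
      pd i v y / (1 + pd ℓ v y) * pd i (pd ℓ v) y + pd i (pd i v) y := by
    intro i hi
    rw [sum_eq_add_ne ℓ]
    congr 1
    · simp [hodA, ← hℓ, hi, hH, hP, pd_comm hv]
    · rw [Finset.sum_eq_single i]
      · simp [hodA, ← hℓ, hi, hH]
      · intro j _ hj
        by_cases hjl : j = ℓ
        · simp [hjl]
        · simp [hodA, ← hℓ, hi, hjl, hj.symm]
      · simp
  have h3 : (∑ i, if i = ℓ then 0 else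
        ∑ j, hodA d hd (fun m => gradC d v y m) i j * hessC d v y i j) =
      ∑ i, if i = ℓ then 0 else
        (pd i v y / (1 + pd ℓ v y) * pd i (pd ℓ v) y + pd i (pd i v) y) := by
    refine Finset.sum_congr rfl fun i _ => ?_
    split_ifs with h
    · rfl
    · exact h2 i h
  rw [h1, h3, add_div, add_mul, add_assoc, add_assoc, Finset.sum_div, Finset.sum_mul,
    ← Finset.sum_add_distrib, ← Finset.sum_add_distrib]
  congr 1
  · simp only [secDir, dirCoef, if_true]
    field_simp
    ring
  · refine Finset.sum_congr rfl fun i _ => ?_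
    split_ifs with h
    · simp
    · simp only [secDir, dirCoef, h, if_false]
      field_simp
      ring

lemma abs_dirCoef_le {ℓ : Fin d} {η : ℝ} (hη : η ≤ 1 / 2) {v : EuclideanSpace ℝ (Fin d) → ℝ}
    {y : EuclideanSpace ℝ (Fin d)} (h : ‖fderiv ℝ v y‖ ≤ η) (k : Fin d) :
    |dirCoef ℓ v k y| ≤ 2 * ‖fderiv ℝ v y‖ := by
  have h1 := (abs_le.1 (abs_pd_le (f := v) (y := y) ℓ)).1
  have hq : 1 / 2 ≤ 1 + pd ℓ v y := by linarith
  have hk : |if k = ℓ then - pd ℓ v y else pd k v y| ≤ ‖fderiv ℝ v y‖ := by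
    split_ifs
    · rw [abs_neg]; exact abs_pd_le ℓ
    · exact abs_pd_le k
  rw [dirCoef, abs_div, abs_of_pos (by linarith : 0 < 1 + pd ℓ v y), div_le_iff₀ (by linarith)]
  nlinarith [norm_nonneg (fderiv ℝ v y)]

lemma contDiffOn_bdryFun {ℓ : Fin d} {v : EuclideanSpace ℝ (Fin d) → ℝ}
    {W : Set (EuclideanSpace ℝ (Fin d))} (hW : IsOpen W) (hv : ContDiffOn ℝ ∞ v W) :
    ContDiffOn ℝ ∞ (bdryFun ℓ v) W := by
  have h := fun i => contDiffOn_pd hW hv i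
  exact ((h ℓ).add ((h ℓ).pow 2)).sub (contDiffOn_const.mul (ContDiffOn.sum fun j _ => (h j).pow 2))

lemma norm_le_norm_add_single {ℓ : Fin d} {y : EuclideanSpace ℝ (Fin d)} (hy : 0 ≤ y ℓ) {t : ℝ}
    (ht : 0 ≤ t) : ‖y‖ ≤ ‖y + t • EuclideanSpace.single ℓ (1 : ℝ)‖ := by
  have h : ‖y‖ ^ 2 ≤ ‖y + t • EuclideanSpace.single ℓ (1 : ℝ)‖ ^ 2 := by
    rw [norm_add_sq_real, inner_smul_right, EuclideanSpace.inner_single_right]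
    simp only [one_mul, conj_trivial]
    nlinarith [mul_nonneg ht hy, sq_nonneg ‖t • EuclideanSpace.single ℓ (1 : ℝ)‖]
  nlinarith [norm_nonneg y, norm_nonneg (y + t • EuclideanSpace.single ℓ (1 : ℝ))]

lemma IsHodSol.smallSol (hd : 0 < d) {v : EuclideanSpace ℝ (Fin d) → ℝ} {η : ℝ} (hη : η ≤ 1 / 2)
    (hv : IsHodSol d hd v (extDom d hd)) (hs : ∀ y ∈ extDom d hd, ‖fderiv ℝ v y‖ ≤ η) :
    SmallSol (lastIdx d hd) η v := by
  obtain ⟨⟨W, hW, hsub, hvW⟩, hpde, hbd⟩ := hv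
  set ℓ := lastIdx d hd with hℓ
  have hq : ∀ y, 0 ≤ y ℓ → 1 ≤ ‖y‖ → 1 / 2 ≤ 1 + pd ℓ v y := fun y h1 h2 => by
    have := (abs_le.1 (abs_pd_le (f := v) (y := y) ℓ)).1
    linarith [hs y ⟨h1, h2⟩]
  have h_int : ∀ y, 0 < y ℓ → 1 ≤ ‖y‖ → ∑ k, secDir ℓ (dirCoef ℓ v k y) k v y = 0 := by
    intro y h1 h2
    rw [← hodOp_eq hd v y ((hvW.contDiffAt (hW.mem_nhds (hsub ⟨h1.le, h2⟩))).of_le (by norm_cast))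
      (by have := hq y h1.le h2; exact ne_of_gt (by linarith))]
    exact hpde y ⟨h1.le, h2⟩ h1
  have hpd := fun i => contDiffOn_pd hW hvW i
  have hpd2 := fun i j => contDiffOn_pd hW (hpd i) j
  have htan : ∀ y, tangSq d hd (fun m => gradC d v y m) = (∑ j, pd j v y ^ 2) - pd ℓ v y ^ 2 := by
    intro y
    rw [sum_eq_add_ne ℓ]
    simp only [tangSq, gradC, pd, ← hℓ]
    ring
  have htn : ∀ y, 0 ≤ tangSq d hd (fun m => gradC d v y m) := fun y =>
    Finset.sum_nonneg fun i _ => by split_ifs <;> positivity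
  refine ⟨⟨W, hW, fun y h1 h2 => hsub ⟨h1, h2⟩, hvW⟩, ?_, ?_, ?_, fun y h1 h2 => hs y ⟨h1, h2⟩⟩
  · intro y h1 h2
    have hyW : y ∈ W := hsub ⟨h1, h2⟩
    have hc : ContinuousAt (fun z => ∑ k, secDir ℓ (dirCoef ℓ v k z) k v z) y := by
      have c1 : ∀ i, ContinuousAt (pd i v) y := fun i => ((hpd i).contDiffAt (hW.mem_nhds hyW)).continuousAt
      have c2 : ∀ i j, ContinuousAt (pd j (pd i v)) y := fun i j =>
        ((hpd2 i j).contDiffAt (hW.mem_nhds hyW)).continuousAt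
      have c3 : ∀ k, ContinuousAt (fun z => dirCoef ℓ v k z) y := by
        intro k
        unfold dirCoef
        refine ContinuousAt.div ?_ (continuousAt_const.add (c1 ℓ)) ?_
        · split_ifs
          · exact (c1 ℓ).neg
          · exact c1 k
        · have := hq y h1 h2; exact ne_of_gt (by linarith)
      refine tendsto_finsetSum _ fun k _ => ?_
      exact ((c2 k k).add ((continuousAt_const.mul (c3 k)).mul (c2 ℓ k))).add
        (((c3 k).pow 2).mul (c2 ℓ ℓ))
    have hl : Tendsto (fun t : ℝ => y + t • EuclideanSpace.single ℓ (1 : ℝ)) (𝓝[>] 0) (𝓝 y) := by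
      have : ContinuousAt (fun t : ℝ => y + t • EuclideanSpace.single ℓ (1 : ℝ)) 0 := by fun_prop
      have h := this.tendsto
      simp only [zero_smul, add_zero] at h
      exact h.mono_left nhdsWithin_le_nhds
    have h3 := hc.tendsto.comp hl
    refine tendsto_nhds_unique h3 (Tendsto.congr' ?_ tendsto_const_nhds)
    filter_upwards [self_mem_nhdsWithin] with t ht
    refine (h_int _ ?_ (h2.trans (norm_le_norm_add_single h1 (le_of_lt ht)))).symm
    simp; exact add_pos_of_nonneg_of_pos h1 ht
  · intro y h1 h2
    have h3 := hbd y ⟨h1.ge, h2⟩ h1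
    have h4 : gradC d v y ℓ = pd ℓ v y := rfl
    rw [hodN, h4] at h3
    have h5 := Real.sq_sqrt (by linarith [htn y] : 0 ≤ 1 + tangSq d hd (fun m => gradC d v y m))
    rw [show √(1 + tangSq d hd (fun m => gradC d v y m)) = pd ℓ v y + 1 by linarith, htan] at h5
    rw [bdryFun]; linarith
  · intro y h1 h2
    have h3 := hbd y ⟨h1.ge, h2⟩ h1
    have h4 : gradC d v y ℓ = pd ℓ v y := rfl
    rw [hodN, h4] at h3
    rw [h3, sub_nonneg]
    exact Real.one_le_sqrt.2 (by linarith [htn y])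

end Bridge

/-! ### Interior gradient estimate (Bernstein's method) -/

section Bernstein

variable {d : ℕ} {ℓ : Fin d} {y : EuclideanSpace ℝ (Fin d)}

/-- The vector `e_k + c e_ℓ`. -/
def dirVec (ℓ : Fin d) (c : ℝ) (k : Fin d) : EuclideanSpace ℝ (Fin d) :=
  EuclideanSpace.single k 1 + c • EuclideanSpace.single ℓ 1

lemma fderiv_dirVec (F : EuclideanSpace ℝ (Fin d) → ℝ) (c : ℝ) (k : Fin d) :
    fderiv ℝ F y (dirVec ℓ c k) = pd k F y + c * pd ℓ F y := by
  simp [dirVec, pd]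

lemma jet_dirVec {F : EuclideanSpace ℝ (Fin d) → ℝ} (h : ContDiffAt ℝ 2 F y) (c : ℝ) (k : Fin d) :
    HasJet (fun t : ℝ => F (y + t • dirVec ℓ c k)) (F y) (pd k F y + c * pd ℓ F y)
      (secDir ℓ c k F y) := by
  refine (HasJet.of_contDiffAt h (dirVec ℓ c k)).congr_val rfl (fderiv_dirVec F c k) ?_
  have e1 := fderiv_fderiv_single (i := k) (j := k) h
  have e2 := fderiv_fderiv_single (i := ℓ) (j := k) h
  have e3 := fderiv_fderiv_single (i := k) (j := ℓ) h
  have e4 := fderiv_fderiv_single (i := ℓ) (j := ℓ) h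
  have e5 := pd_comm (i := k) (j := ℓ) h
  simp only [dirVec, map_add, map_smul, _root_.add_apply, _root_.smul_apply, e1, e2,
    e3, e4, smul_eq_mul, secDir, ← e5]
  ring

lemma norm_dirVec_sub (c : ℝ) (k : Fin d) :
    ‖dirVec ℓ c k - EuclideanSpace.single k 1‖ = |c| := by
  simp [dirVec, norm_smul]

lemma jet_sq_dist (x z ξ : EuclideanSpace ℝ (Fin d)) :
    HasJet (fun t : ℝ => ‖x + t • ξ - z‖ ^ 2) (‖x - z‖ ^ 2) (2 * inner ℝ (x - z) ξ)
      (2 * ‖ξ‖ ^ 2) := by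
  have h : (fun t : ℝ => ‖x + t • ξ - z‖ ^ 2) = fun t : ℝ =>
      (‖x - z‖ ^ 2 + t * (2 * inner ℝ (x - z) ξ)) + ‖ξ‖ ^ 2 * (0 + t * 1) ^ 2 := by
    ext t
    rw [show x + t • ξ - z = (x - z) + t • ξ by abel, norm_add_sq_real, inner_smul_right, norm_smul,
      mul_pow, Real.norm_eq_abs, sq_abs]
    ring
  rw [h]
  exact ((HasJet.affine _ _).add ((HasJet.affine 0 1).sq.const_mul _)).congr_val
    (by ring) (by ring) (by ring)

lemma SmallSol.contDiffAt {η : ℝ} {v : EuclideanSpace ℝ (Fin d) → ℝ} (hv : SmallSol ℓ η v)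
    (h1 : 0 ≤ y ℓ) (h2 : 1 ≤ ‖y‖) : ContDiffAt ℝ ∞ v y := by
  obtain ⟨W, hW, hs, hc⟩ := hv.smooth
  exact hc.contDiffAt (hW.mem_nhds (hs y h1 h2))

lemma SmallSol.contDiffAt_pd {η : ℝ} {v : EuclideanSpace ℝ (Fin d) → ℝ} (hv : SmallSol ℓ η v)
    (h1 : 0 ≤ y ℓ) (h2 : 1 ≤ ‖y‖) (i : Fin d) : ContDiffAt ℝ ∞ (pd i v) y := by
  obtain ⟨W, hW, hs, hc⟩ := hv.smooth
  exact (contDiffOn_pd hW hc i).contDiffAt (hW.mem_nhds (hs y h1 h2))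

lemma SmallSol.contDiffAt_pd_pd {η : ℝ} {v : EuclideanSpace ℝ (Fin d) → ℝ} (hv : SmallSol ℓ η v)
    (h1 : 0 ≤ y ℓ) (h2 : 1 ≤ ‖y‖) (i j : Fin d) : ContDiffAt ℝ ∞ (pd j (pd i v)) y := by
  obtain ⟨W, hW, hs, hc⟩ := hv.smooth
  exact (contDiffOn_pd hW (contDiffOn_pd hW hc i) j).contDiffAt (hW.mem_nhds (hs y h1 h2))

lemma SmallSol.contDiffAt_bdryFun {η : ℝ} {v : EuclideanSpace ℝ (Fin d) → ℝ}
    (hv : SmallSol ℓ η v) (h1 : 0 ≤ y ℓ) (h2 : 1 ≤ ‖y‖) : ContDiffAt ℝ ∞ (bdryFun ℓ v) y := by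
  obtain ⟨W, hW, hs, hc⟩ := hv.smooth
  exact (contDiffOn_bdryFun hW hc).contDiffAt (hW.mem_nhds (hs y h1 h2))

/-- The Frobenius norm of the Hessian. -/
def hessNorm (v : EuclideanSpace ℝ (Fin d) → ℝ) (y : EuclideanSpace ℝ (Fin d)) : ℝ :=
  √(∑ a, ∑ b, pd a (pd b v) y ^ 2)

lemma hessNorm_nonneg (v : EuclideanSpace ℝ (Fin d) → ℝ) : 0 ≤ hessNorm v y := Real.sqrt_nonneg _

lemma hessNorm_sq (v : EuclideanSpace ℝ (Fin d) → ℝ) :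
    hessNorm v y ^ 2 = ∑ a, ∑ b, pd a (pd b v) y ^ 2 :=
  Real.sq_sqrt (Finset.sum_nonneg fun _ _ => Finset.sum_nonneg fun _ _ => sq_nonneg _)

lemma abs_pd_pd_le (v : EuclideanSpace ℝ (Fin d) → ℝ) (a b : Fin d) :
    |pd a (pd b v) y| ≤ hessNorm v y := by
  refine Real.abs_le_sqrt ?_
  exact (Finset.single_le_sum (f := fun b => pd a (pd b v) y ^ 2) (fun _ _ => sq_nonneg _)
    (Finset.mem_univ b)).trans (Finset.single_le_sum (f := fun a => ∑ b, pd a (pd b v) y ^ 2)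
      (fun _ _ => Finset.sum_nonneg fun _ _ => sq_nonneg _) (Finset.mem_univ a))

lemma pd_dirCoef_le {η : ℝ} (hη : η ≤ 1 / 4) {v : EuclideanSpace ℝ (Fin d) → ℝ}
    (hv : SmallSol ℓ η v) (h1 : 0 ≤ y ℓ) (h2 : 1 ≤ ‖y‖) (j k : Fin d) :
    DifferentiableAt ℝ (dirCoef ℓ v k) y ∧ |pd j (dirCoef ℓ v k) y| ≤ 3 * hessNorm v y := by
  have hs := hv.small y h1 h2
  have hP := (abs_le.1 (abs_pd_le (f := v) (y := y) ℓ)).1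
  have hq : 3 / 4 ≤ 1 + pd ℓ v y := by linarith
  have hq0 : 1 + pd ℓ v y ≠ 0 := ne_of_gt (by linarith)
  have hd : ∀ i, DifferentiableAt ℝ (pd i v) y := fun i =>
    (hv.contDiffAt_pd h1 h2 i).differentiableAt (by simp)
  set F : EuclideanSpace ℝ (Fin d) → ℝ := fun z => if k = ℓ then - pd ℓ v z else pd k v z with hF
  have hFd : DifferentiableAt ℝ F y := by
    simp only [hF]; split_ifs
    · exact (hd ℓ).neg
    · exact hd k
  have hFp : |pd j F y| ≤ hessNorm v y := by
    simp only [hF]; split_ifs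
    · have : pd j (fun z => - pd ℓ v z) y = - pd j (pd ℓ v) y := by
        unfold pd; rw [fderiv_fun_neg]; simp
      rw [this, abs_neg]; exact abs_pd_pd_le v j ℓ
    · exact abs_pd_pd_le v j k
  have hqd : DifferentiableAt ℝ (fun z => 1 + pd ℓ v z) y := (hd ℓ).const_add 1
  have hcd : DifferentiableAt ℝ (dirCoef ℓ v k) y :=
    (show DifferentiableAt ℝ (fun z => F z / (1 + pd ℓ v z)) y by
      simp only [div_eq_mul_inv]
      exact hFd.mul (hqd.fun_inv hq0))
  refine ⟨hcd, ?_⟩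
  have hne : ∀ᶠ z in 𝓝 y, 1 + pd ℓ v z ≠ 0 :=
    hqd.continuousAt.eventually_ne hq0
  have heq : (fun z => (1 + pd ℓ v z) * dirCoef ℓ v k z) =ᶠ[𝓝 y] F := by
    filter_upwards [hne] with z hz
    simp only [dirCoef, hF]; field_simp
  have h3 := pd_congr (i := j) heq
  rw [pd_mul hqd hcd] at h3
  have h4 : pd j (fun z => 1 + pd ℓ v z) y = pd j (pd ℓ v) y := by
    unfold pd; rw [fderiv_const_add]
  rw [h4] at h3
  have h5 := abs_dirCoef_le (ℓ := ℓ) (by linarith : η ≤ 1 / 2) hs k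
  have h6 := abs_pd_pd_le (y := y) v j ℓ
  have h7 : |(1 + pd ℓ v y) * pd j (dirCoef ℓ v k) y| ≤ hessNorm v y + hessNorm v y * (2 * η) := by
    rw [show (1 + pd ℓ v y) * pd j (dirCoef ℓ v k) y = pd j F y - pd j (pd ℓ v) y * dirCoef ℓ v k y by
      linarith]
    refine (abs_sub _ _).trans (add_le_add hFp ?_)
    rw [abs_mul]
    exact mul_le_mul h6 (by linarith) (abs_nonneg _) (hessNorm_nonneg v)
  rw [abs_mul, abs_of_pos (by linarith)] at h7
  nlinarith [hessNorm_nonneg (y := y) v, abs_nonneg (pd j (dirCoef ℓ v k) y)]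

/-- The differentiated equation. -/
lemma sum_secDir_pd_le {η : ℝ} (hη : η ≤ 1 / 4) {v : EuclideanSpace ℝ (Fin d) → ℝ}
    (hv : SmallSol ℓ η v) (h1 : 0 < y ℓ) (h2 : 1 < ‖y‖) (j : Fin d) :
    |∑ k, secDir ℓ (dirCoef ℓ v k y) k (pd j v) y| ≤ 12 * d * hessNorm v y ^ 2 := by
  have hs := hv.small y h1.le h2.le
  have hd2 : ∀ a b, DifferentiableAt ℝ (pd a (pd b v)) y := fun a b =>
    (hv.contDiffAt_pd_pd h1.le h2.le b a).differentiableAt (by simp)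
  have hcd := fun k => pd_dirCoef_le hη hv h1.le h2.le j k
  have hc2 : ∀ᶠ z in 𝓝 y, ContDiffAt ℝ ∞ v z := by
    obtain ⟨W, hW, hs, hc⟩ := hv.smooth
    filter_upwards [hW.mem_nhds (hs y h1.le h2.le)] with z hz using hc.contDiffAt (hW.mem_nhds hz)
  have hthird : ∀ a b, pd a (pd b (pd j v)) y = pd j (pd a (pd b v)) y := by
    intro a b
    have e1 : pd b (pd j v) =ᶠ[𝓝 y] pd j (pd b v) := by
      filter_upwards [hc2] with z hz using pd_comm (hz.of_le (by norm_cast))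
    rw [pd_congr e1]
    exact pd_comm ((hv.contDiffAt_pd h1.le h2.le b).of_le (by norm_cast))
  have hev : (fun z => ∑ k, secDir ℓ (dirCoef ℓ v k z) k v z) =ᶠ[𝓝 y] fun _ => 0 := by
    have c1 : ∀ᶠ z in 𝓝 y, 0 < z ℓ := by
      have : Continuous fun z : EuclideanSpace ℝ (Fin d) => z ℓ := by fun_prop
      exact this.continuousAt.eventually (lt_mem_nhds h1)
    have c2 : ∀ᶠ z in 𝓝 y, 1 < ‖z‖ := continuous_norm.continuousAt.eventually (lt_mem_nhds h2)
    filter_upwards [c1, c2] with z z1 z2 using hv.pde z z1.le z2.le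
  have h0 : pd j (fun z => ∑ k, secDir ℓ (dirCoef ℓ v k z) k v z) y = 0 := by
    rw [pd_congr hev]; simp [pd]
  have hterm : ∀ k, DifferentiableAt ℝ (fun z => secDir ℓ (dirCoef ℓ v k z) k v z) y ∧
      pd j (fun z => secDir ℓ (dirCoef ℓ v k z) k v z) y =
        secDir ℓ (dirCoef ℓ v k y) k (pd j v) y + 2 * pd j (dirCoef ℓ v k) y *
          (pd k (pd ℓ v) y + dirCoef ℓ v k y * pd ℓ (pd ℓ v) y) := by
    intro k
    have d0 := (hcd k).1
    have d1 : DifferentiableAt ℝ (fun z => 2 * dirCoef ℓ v k z) y := d0.const_mul 2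
    have d2 : DifferentiableAt ℝ (fun z => 2 * dirCoef ℓ v k z * pd k (pd ℓ v) z) y :=
      d1.mul (hd2 k ℓ)
    have d3 : DifferentiableAt ℝ (fun z => dirCoef ℓ v k z ^ 2) y := d0.pow 2
    have d4 : DifferentiableAt ℝ (fun z => dirCoef ℓ v k z ^ 2 * pd ℓ (pd ℓ v) z) y :=
      d3.mul (hd2 ℓ ℓ)
    have d5 : DifferentiableAt ℝ (fun z => pd k (pd k v) z + 2 * dirCoef ℓ v k z * pd k (pd ℓ v) z) y :=
      (hd2 k k).add d2
    refine ⟨d5.add d4, ?_⟩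
    unfold secDir
    rw [pd_add d5 d4, pd_add (hd2 k k) d2, pd_mul d1 (hd2 k ℓ), pd_const_mul 2 d0,
      pd_mul d3 (hd2 ℓ ℓ), pd_sq d0, hthird, hthird, hthird]
    ring
  rw [pd_sum fun k _ => (hterm k).1, Finset.sum_congr rfl fun k _ => (hterm k).2,
    Finset.sum_add_distrib] at h0
  rw [eq_neg_of_add_eq_zero_left h0, abs_neg]
  refine (Finset.abs_sum_le_sum_abs _ _).trans ?_
  have hb : ∀ k ∈ Finset.univ, |2 * pd j (dirCoef ℓ v k) y *
      (pd k (pd ℓ v) y + dirCoef ℓ v k y * pd ℓ (pd ℓ v) y)| ≤ 12 * hessNorm v y ^ 2 := by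
    intro k _
    have a1 := (hcd k).2
    have a2 := abs_dirCoef_le (ℓ := ℓ) (by linarith : η ≤ 1 / 2) hs k
    have a3 : |pd k (pd ℓ v) y + dirCoef ℓ v k y * pd ℓ (pd ℓ v) y| ≤ 2 * hessNorm v y := by
      refine (abs_add_le _ _).trans ?_
      rw [abs_mul]
      have := mul_le_mul (by linarith : |dirCoef ℓ v k y| ≤ 1) (abs_pd_pd_le (y := y) v ℓ ℓ) (abs_nonneg _) one_pos.le
      linarith [abs_pd_pd_le (y := y) v k ℓ]
    rw [abs_mul, abs_mul, abs_two]
    have := mul_le_mul a1 a3 (abs_nonneg _) (by linarith [hessNorm_nonneg (y := y) v])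
    nlinarith
  refine (Finset.sum_le_sum hb).trans (le_of_eq ?_)
  simp; ring

end Bernstein

section BernsteinInterior

variable {d : ℕ} {ℓ : Fin d} {y : EuclideanSpace ℝ (Fin d)} {η : ℝ}
  {v : EuclideanSpace ℝ (Fin d) → ℝ}

/-- Components of the auxiliary vector field `(∇'v, b)`, with `b` the boundary defining function. -/
def bernG (ℓ : Fin d) (v : EuclideanSpace ℝ (Fin d) → ℝ) (i : Fin d) :
    EuclideanSpace ℝ (Fin d) → ℝ := if i = ℓ then bdryFun ℓ v else pd i v

/-- The auxiliary function for the gradient estimate. -/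
def bernW (ℓ : Fin d) (v : EuclideanSpace ℝ (Fin d) → ℝ) (z : EuclideanSpace ℝ (Fin d))
    (ρ c : ℝ) (x : EuclideanSpace ℝ (Fin d)) : ℝ :=
  (ρ ^ 2 - ‖x - z‖ ^ 2) ^ 2 * ∑ i, bernG ℓ v i x ^ 2 + 2000 * d * ρ ^ 2 * (v x - c) ^ 2

lemma smallness (hd : 3 ≤ d) (h0 : 0 ≤ η) (hη : 10000 * (d : ℝ) ^ 4 * η ≤ 1) :
    (3 : ℝ) ≤ d ∧ 10000 * (d : ℝ) ^ 3 * η ≤ 1 ∧ 10000 * (d : ℝ) ^ 2 * η ≤ 1 ∧ 10000 * d * η ≤ 1 ∧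
      η ≤ 1 / 10000 := by
  have hd' : (3 : ℝ) ≤ d := by exact_mod_cast hd
  have e1 : (d : ℝ) ^ 3 ≤ (d : ℝ) ^ 4 := pow_le_pow_right₀ (by linarith) (by norm_num)
  have e2 : (d : ℝ) ^ 2 ≤ (d : ℝ) ^ 3 := pow_le_pow_right₀ (by linarith) (by norm_num)
  have e3 : (d : ℝ) ≤ (d : ℝ) ^ 2 := by nlinarith
  have f1 := mul_le_mul_of_nonneg_right e1 h0
  have f2 := mul_le_mul_of_nonneg_right e2 h0
  have f3 := mul_le_mul_of_nonneg_right e3 h0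
  have f4 := mul_le_mul_of_nonneg_right hd' h0
  refine ⟨hd', ?_, ?_, ?_, ?_⟩ <;> linarith

lemma abs_sum_le_card_mul {f : Fin d → ℝ} {B : ℝ} (h : ∀ i, |f i| ≤ B) : |∑ i, f i| ≤ d * B := by
  refine (Finset.abs_sum_le_sum_abs _ _).trans ((Finset.sum_le_sum fun i _ => h i).trans ?_)
  simp

lemma sum_pd_sq_le : ∑ j, pd j v y ^ 2 ≤ d * ‖fderiv ℝ v y‖ ^ 2 := by
  refine (le_abs_self _).trans (abs_sum_le_card_mul fun i => ?_)
  rw [abs_of_nonneg (sq_nonneg _)]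
  exact sq_le_sq' (abs_le.1 (abs_pd_le i)).1 (abs_le.1 (abs_pd_le i)).2

lemma abs_bdryFun_le (hd : 3 ≤ d) (h0 : 0 ≤ η) (hη : 10000 * (d : ℝ) ^ 4 * η ≤ 1)
    (hs : ‖fderiv ℝ v y‖ ≤ η) : |bdryFun ℓ v y| ≤ 2 * ‖fderiv ℝ v y‖ := by
  obtain ⟨hd', s3, s2, s1, s0⟩ := smallness hd h0 hη
  have h1 := abs_pd_le (f := v) (y := y) ℓ
  have h2 := sum_pd_sq_le (v := v) (y := y)
  have h3 : 0 ≤ ∑ j, pd j v y ^ 2 := Finset.sum_nonneg fun _ _ => sq_nonneg _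
  set g := ‖fderiv ℝ v y‖
  have hg : 0 ≤ g := norm_nonneg _
  have h4 : pd ℓ v y ^ 2 ≤ g ^ 2 := sq_le_sq' (abs_le.1 h1).1 (abs_le.1 h1).2
  have h5 : g ^ 2 ≤ g * η := by nlinarith
  have h6 : d * g ^ 2 ≤ g := by nlinarith [mul_nonneg hg (by linarith : 0 ≤ 1 - d * η)]
  rw [bdryFun, abs_le]
  constructor <;> nlinarith [abs_le.1 h1]

/-- Lower bound for the cutoff part of the second derivative. -/
lemma cutoff_alg {ζ ρ : ℝ} {z1 z2 : Fin d → ℝ} {G : Fin d → ℝ} {g s : Fin d → Fin d → ℝ}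
    (hζ0 : 0 ≤ ζ) (hζ : ζ ≤ ρ ^ 2) (h1 : ∀ k, |z1 k| ≤ 4 * ρ) (h2 : ∀ k, |z2 k| ≤ 8)
    (hs : - ∑ k, ∑ i, g k i ^ 2 ≤ 2 * ∑ k, ∑ i, G i * s k i) :
    - (272 * d * ρ ^ 2 * ∑ i, G i ^ 2) ≤
      ∑ k, ((2 * z1 k ^ 2 + 2 * (ζ * z2 k)) * (∑ i, G i ^ 2) +
        2 * (2 * (ζ * z1 k) * ∑ i, 2 * (G i * g k i)) +
        ζ ^ 2 * ∑ i, (2 * g k i ^ 2 + 2 * (G i * s k i))) := by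
  have key : ∀ k, - (272 * ρ ^ 2 * ∑ i, G i ^ 2) + ζ ^ 2 * ((∑ i, g k i ^ 2) + 2 * ∑ i, G i * s k i)
      ≤ (2 * z1 k ^ 2 + 2 * (ζ * z2 k)) * (∑ i, G i ^ 2) +
        2 * (2 * (ζ * z1 k) * ∑ i, 2 * (G i * g k i)) +
        ζ ^ 2 * ∑ i, (2 * g k i ^ 2 + 2 * (G i * s k i)) := by
    intro k
    have hk1 := abs_le.1 (h1 k)
    have hk2 := abs_le.1 (h2 k)
    have hi : ∀ i, - (272 * ρ ^ 2 * G i ^ 2) + ζ ^ 2 * (g k i ^ 2 + 2 * (G i * s k i)) ≤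
        (2 * z1 k ^ 2 + 2 * (ζ * z2 k)) * G i ^ 2 + 2 * (2 * (ζ * z1 k) * (2 * (G i * g k i))) +
        ζ ^ 2 * (2 * g k i ^ 2 + 2 * (G i * s k i)) := by
      intro i
      have a1 : - (16 * ρ ^ 2) ≤ 2 * z1 k ^ 2 + 2 * (ζ * z2 k) := by nlinarith [sq_nonneg (z1 k)]
      have a2 := mul_le_mul_of_nonneg_right a1 (sq_nonneg (G i))
      have a3 : z1 k ^ 2 ≤ 16 * ρ ^ 2 := by nlinarith
      have a4 := mul_le_mul_of_nonneg_right a3 (sq_nonneg (G i))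
      nlinarith [sq_nonneg (ζ * g k i + 4 * (z1 k * G i))]
    have := Finset.sum_le_sum fun i (_ : i ∈ Finset.univ) => hi i
    simp only [Finset.sum_add_distrib, ← Finset.mul_sum, Finset.sum_neg_distrib] at this
    simp only [Finset.sum_add_distrib, ← Finset.mul_sum]
    linarith
  have := Finset.sum_le_sum fun k (_ : k ∈ Finset.univ) => key k
  refine le_trans ?_ this
  rw [Finset.sum_add_distrib, ← Finset.mul_sum, Finset.sum_add_distrib, ← Finset.mul_sum]
  simp only [Finset.sum_const, Finset.card_univ, Fintype.card_fin, nsmul_eq_mul]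
  nlinarith [mul_nonneg (sq_nonneg ζ) (by linarith : 0 ≤ (∑ k, ∑ i, g k i ^ 2) + 2 * ∑ k, ∑ i, G i * s k i)]

lemma half_sq_le (a e : ℝ) : (1 / 2) * a ^ 2 - e ^ 2 ≤ (a + e) ^ 2 := by nlinarith [sq_nonneg (a + 2 * e)]

/-- First derivative of `bdryFun` along a direction with derivatives `X j` of `v_j`. -/
def bdryD1 (ℓ : Fin d) (p X : Fin d → ℝ) : ℝ :=
  X ℓ + 2 * (p ℓ * X ℓ) - (1 / 2) * ∑ j, 2 * (p j * X j)

/-- Second derivative of `bdryFun` along a direction. -/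
def bdryD2 (ℓ : Fin d) (p X s : Fin d → ℝ) : ℝ :=
  s ℓ + (2 * X ℓ ^ 2 + 2 * (p ℓ * s ℓ)) - (1 / 2) * ∑ j, (2 * X j ^ 2 + 2 * (p j * s j))

lemma jet_bernG (hv : SmallSol ℓ η v) (h1 : 0 ≤ y ℓ) (h2 : 1 ≤ ‖y‖) (c : ℝ) (k i : Fin d) :
    HasJet (fun t : ℝ => bernG ℓ v i (y + t • dirVec ℓ c k)) (bernG ℓ v i y)
      (if i = ℓ then bdryD1 ℓ (fun j => pd j v y) (fun j => pd k (pd j v) y + c * pd ℓ (pd j v) y)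
        else pd k (pd i v) y + c * pd ℓ (pd i v) y)
      (if i = ℓ then bdryD2 ℓ (fun j => pd j v y) (fun j => pd k (pd j v) y + c * pd ℓ (pd j v) y)
        (fun j => secDir ℓ c k (pd j v) y) else secDir ℓ c k (pd i v) y) := by
  have hj : ∀ j, HasJet (fun t : ℝ => pd j v (y + t • dirVec ℓ c k)) (pd j v y)
      (pd k (pd j v) y + c * pd ℓ (pd j v) y) (secDir ℓ c k (pd j v) y) := fun j =>
    jet_dirVec ((hv.contDiffAt_pd h1 h2 j).of_le (by norm_cast)) c k
  unfold bernG
  split_ifs with h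
  · exact ((hj ℓ).add (hj ℓ).sq).sub ((HasJet.sum fun j _ => (hj j).sq).const_mul (1 / 2))
  · exact hj i

lemma sum_bernG_sq_le (hd : 3 ≤ d) (h0 : 0 ≤ η) (hη : 10000 * (d : ℝ) ^ 4 * η ≤ 1)
    (hs : ‖fderiv ℝ v y‖ ≤ η) : ∑ i, bernG ℓ v i y ^ 2 ≤ 4 * ∑ i, pd i v y ^ 2 := by
  obtain ⟨hd', s3, s2, s1, s0⟩ := smallness hd h0 hη
  set Q := ∑ i, pd i v y ^ 2 with hQ
  have hQ0 : 0 ≤ Q := Finset.sum_nonneg fun _ _ => sq_nonneg _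
  have h2 := sum_pd_sq_le (v := v) (y := y)
  have hg : ‖fderiv ℝ v y‖ ^ 2 ≤ η := by nlinarith [norm_nonneg (fderiv ℝ v y)]
  have hQ1 : Q ≤ 1 := by
    have := mul_le_mul_of_nonneg_left hg (by linarith : (0 : ℝ) ≤ d)
    linarith
  have e1 := sum_eq_add_ne ℓ fun i => pd i v y ^ 2
  rw [← hQ] at e1
  rw [sum_eq_add_ne ℓ]
  have e2 : (∑ i, if i = ℓ then 0 else bernG ℓ v i y ^ 2) = ∑ i, if i = ℓ then 0 else pd i v y ^ 2 := by
    refine Finset.sum_congr rfl fun i _ => ?_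
    by_cases h : i = ℓ <;> simp [bernG, h]
  have e3 : 0 ≤ ∑ i, if i = ℓ then 0 else pd i v y ^ 2 :=
    Finset.sum_nonneg fun _ _ => by split_ifs <;> positivity
  have h1 := abs_le.1 (abs_pd_le (f := v) (y := y) ℓ)
  rw [e2]
  have e4 : bernG ℓ v ℓ y = pd ℓ v y * (1 + pd ℓ v y) - (1 / 2) * Q := by
    simp only [bernG, if_true, bdryFun]; ring
  rw [e4]
  have e5 : (1 + pd ℓ v y) ^ 2 ≤ 1.1 := by nlinarith
  have e6 : (pd ℓ v y * (1 + pd ℓ v y)) ^ 2 ≤ 1.1 * pd ℓ v y ^ 2 := by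
    rw [mul_pow]; nlinarith [sq_nonneg (pd ℓ v y)]
  nlinarith [sq_nonneg (pd ℓ v y * (1 + pd ℓ v y) + (1 / 2) * Q)]

end BernsteinInterior

section BernsteinMax

variable {d : ℕ} {ℓ : Fin d} {y : EuclideanSpace ℝ (Fin d)} {η : ℝ}
  {v : EuclideanSpace ℝ (Fin d) → ℝ}

/-- The error terms of the Bernstein quantity are absorbed by the squared Hessian. -/
lemma bernstein_absorb (hd : 3 ≤ d) (h0 : 0 ≤ η) (hη : 10000 * (d : ℝ) ^ 4 * η ≤ 1) {h b : ℝ}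
    {H X s : Fin d → Fin d → ℝ} {p c : Fin d → ℝ} (hh : h ^ 2 = ∑ a, ∑ b, H a b ^ 2) (hh0 : 0 ≤ h)
    (hH : ∀ a b, |H a b| ≤ h) (hX : ∀ k j, X k j = H k j + c k * H ℓ j) (hc : ∀ k, |c k| ≤ 2 * η)
    (hp : ∀ k, |p k| ≤ η) (hb : |b| ≤ 2 * η) (hs : ∀ j, |∑ k, s k j| ≤ 12 * d * h ^ 2) :
    - ∑ k, ∑ i, (if i = ℓ then bdryD1 ℓ p (X k) else X k i) ^ 2 ≤
      2 * ∑ k, ∑ i, (if i = ℓ then b else p i) *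
        (if i = ℓ then bdryD2 ℓ p (X k) (s k) else s k i) := by
  obtain ⟨hd', s3, s2, s1, s0⟩ := smallness hd h0 hη
  have hηh : 0 ≤ η * h := mul_nonneg h0 hh0
  have hX1 : ∀ k j, |X k j - H k j| ≤ 2 * (η * h) := by
    intro k j
    rw [hX, add_sub_cancel_left, abs_mul]
    have := mul_le_mul (hc k) (hH ℓ j) (abs_nonneg _) (by linarith)
    linarith
  have hX2 : ∀ k j, |X k j| ≤ 2 * h := by
    intro k j
    have e1 := abs_le.1 (hX1 k j)
    have e2 := abs_le.1 (hH k j)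
    rw [abs_le]; constructor <;> nlinarith
  have hpX : ∀ k j, |p j * X k j| ≤ 2 * (η * h) := by
    intro k j
    rw [abs_mul]
    have := mul_le_mul (hp j) (hX2 k j) (abs_nonneg _) h0
    linarith
  have lower : (1 / 4) * h ^ 2 ≤ ∑ k, ∑ i, (if i = ℓ then bdryD1 ℓ p (X k) else X k i) ^ 2 := by
    have e : ∀ k i, |(if i = ℓ then bdryD1 ℓ p (X k) else X k i) - H k i| ≤ 4 * d * (η * h) := by
      intro k i
      split_ifs with hi
      · subst hi
        have a1 : |∑ j, 2 * (p j * X k j)| ≤ d * (4 * (η * h)) := abs_sum_le_card_mul fun j => by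
          rw [abs_mul, abs_two]; linarith [hpX k j]
        have a2 := abs_le.1 a1
        have a3 := abs_le.1 (hX1 k i)
        have a4 := abs_le.1 (hpX k i)
        have a5 : 3 * (η * h) ≤ d * (η * h) := mul_le_mul_of_nonneg_right hd' hηh
        rw [bdryD1, abs_le]; constructor <;> linarith
      · have a5 : 3 * (η * h) ≤ d * (η * h) := mul_le_mul_of_nonneg_right hd' hηh
        linarith [hX1 k i]
    have e2 : ∀ k i, (1 / 2) * H k i ^ 2 - 16 * d ^ 2 * (η * h) ^ 2 ≤
        (if i = ℓ then bdryD1 ℓ p (X k) else X k i) ^ 2 := by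
      intro k i
      have a1 := half_sq_le (H k i) ((if i = ℓ then bdryD1 ℓ p (X k) else X k i) - H k i)
      rw [add_sub_cancel] at a1
      have a2 := sq_le_sq' (abs_le.1 (e k i)).1 (abs_le.1 (e k i)).2
      have a3 : (4 * d * (η * h)) ^ 2 = 16 * d ^ 2 * (η * h) ^ 2 := by ring
      linarith
    have e3 := Finset.sum_le_sum fun k (_ : k ∈ Finset.univ) =>
      Finset.sum_le_sum fun i (_ : i ∈ Finset.univ) => e2 k i
    simp only [Finset.sum_sub_distrib, ← Finset.mul_sum, ← hh, Finset.sum_const, Finset.card_univ,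
      Fintype.card_fin, nsmul_eq_mul] at e3
    refine le_trans ?_ e3
    have e4 : (d : ℝ) * (d * (16 * d ^ 2 * (η * h) ^ 2)) = 16 * ((d ^ 2 * η) ^ 2) * h ^ 2 := by ring
    have e5 : ((d : ℝ) ^ 2 * η) ^ 2 ≤ 1 / 64 := by
      have : 0 ≤ (d : ℝ) ^ 2 * η := by positivity
      nlinarith
    have e6 := mul_le_mul_of_nonneg_right e5 (sq_nonneg h)
    linarith
  have hsum : ∀ i, |∑ k, (if i = ℓ then bdryD2 ℓ p (X k) (s k) else s k i)| ≤ 40 * d ^ 2 * h ^ 2 := by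
    intro i
    have hdd : 3 * (d * h ^ 2) ≤ d ^ 2 * h ^ 2 := by
      have := mul_le_mul_of_nonneg_right hd' (by positivity : 0 ≤ d * h ^ 2)
      nlinarith
    by_cases hi : i = ℓ
    · simp only [hi, if_true, bdryD2]
      have r : ∑ k, (s k ℓ + (2 * X k ℓ ^ 2 + 2 * (p ℓ * s k ℓ)) -
          (1 / 2) * ∑ j, (2 * X k j ^ 2 + 2 * (p j * s k j))) =
          (1 + 2 * p ℓ) * (∑ k, s k ℓ) + 2 * (∑ k, X k ℓ ^ 2) - (∑ k, ∑ j, X k j ^ 2) -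
            ∑ j, p j * ∑ k, s k j := by
        have c1 : ∑ j, p j * ∑ k, s k j = ∑ k, ∑ j, p j * s k j := by
          simp only [Finset.mul_sum]; exact Finset.sum_comm
        rw [c1, Finset.mul_sum, Finset.mul_sum, ← Finset.sum_add_distrib, ← Finset.sum_sub_distrib,
          ← Finset.sum_sub_distrib]
        refine Finset.sum_congr rfl fun k _ => ?_
        rw [Finset.sum_add_distrib, ← Finset.mul_sum, ← Finset.mul_sum]; ring
      rw [r]
      have q1 : ∀ k j, |X k j ^ 2| ≤ 4 * h ^ 2 := fun k j => by
        rw [abs_of_nonneg (sq_nonneg _)]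
        have := sq_le_sq' (abs_le.1 (hX2 k j)).1 (abs_le.1 (hX2 k j)).2
        linarith
      have t1 := abs_le.1 (abs_sum_le_card_mul fun k => q1 k ℓ)
      have t2 := abs_le.1 (abs_sum_le_card_mul fun k => abs_sum_le_card_mul fun j => q1 k j)
      have t3 : |∑ j, p j * ∑ k, s k j| ≤ d * (1 * (12 * d * h ^ 2)) := abs_sum_le_card_mul fun j => by
        rw [abs_mul]
        exact mul_le_mul ((hp j).trans (by linarith)) (hs j) (abs_nonneg _) one_pos.le
      have t4 : |(1 + 2 * p ℓ) * (∑ k, s k ℓ)| ≤ (3 / 2) * (12 * d * h ^ 2) := by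
        rw [abs_mul]
        refine mul_le_mul ?_ (hs ℓ) (abs_nonneg _) (by norm_num)
        have := abs_le.1 (hp ℓ)
        rw [abs_le]; constructor <;> linarith
      have t3 := abs_le.1 t3
      have t4 := abs_le.1 t4
      rw [abs_le]; constructor <;> nlinarith
    · simp only [hi, if_false]
      nlinarith [hs i]
  have hG : ∀ i, |if i = ℓ then b else p i| ≤ 2 * η := fun i => by
    split_ifs
    · exact hb
    · linarith [hp i]
  rw [Finset.sum_comm (f := fun k i => (if i = ℓ then b else p i) *
        (if i = ℓ then bdryD2 ℓ p (X k) (s k) else s k i))]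
  simp only [← Finset.mul_sum]
  have fin : |∑ i, (if i = ℓ then b else p i) *
      ∑ k, (if i = ℓ then bdryD2 ℓ p (X k) (s k) else s k i)| ≤ d * (2 * η * (40 * d ^ 2 * h ^ 2)) :=
    abs_sum_le_card_mul fun i => by
      rw [abs_mul]; exact mul_le_mul (hG i) (hsum i) (abs_nonneg _) (by linarith)
  have fin2 : d * (2 * η * (40 * d ^ 2 * h ^ 2)) = 80 * (d ^ 3 * η) * h ^ 2 := by ring
  have fin3 := mul_le_mul_of_nonneg_right s3 (sq_nonneg h)
  have fin4 := (abs_le.1 fin).1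
  nlinarith

lemma bernstein_interior (hd : 3 ≤ d) (h0 : 0 ≤ η) (hη : 10000 * (d : ℝ) ^ 4 * η ≤ 1)
    (hv : SmallSol ℓ η v) (h1 : 0 < y ℓ) (h2 : 1 < ‖y‖) {z : EuclideanSpace ℝ (Fin d)} {ρ c : ℝ}
    (hρ : 0 < ρ) (hz : ‖y - z‖ ≤ ρ) (hmax : IsLocalMax (bernW ℓ v z ρ c) y) :
    ∑ i, bernG ℓ v i y ^ 2 = 0 := by
  obtain ⟨hd', s3, s2, s1, s0⟩ := smallness hd h0 hη
  have hsm := hv.small y h1.le h2.le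
  have hη4 : η ≤ 1 / 4 := by linarith
  set c' : Fin d → ℝ := fun k => dirCoef ℓ v k y with hc'
  have hc : ∀ k, |c' k| ≤ 2 * η := fun k =>
    (abs_dirCoef_le (by linarith) hsm k).trans (by linarith)
  set ζ := ρ ^ 2 - ‖y - z‖ ^ 2 with hζ
  have hζ0 : 0 ≤ ζ := by rw [hζ]; nlinarith [norm_nonneg (y - z)]
  set z1 : Fin d → ℝ := fun k => 0 - 2 * inner ℝ (y - z) (dirVec ℓ (c' k) k) with hz1
  set z2 : Fin d → ℝ := fun k => 0 - 2 * ‖dirVec ℓ (c' k) k‖ ^ 2 with hz2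
  set X : Fin d → Fin d → ℝ := fun k j => pd k (pd j v) y + c' k * pd ℓ (pd j v) y with hX
  set s : Fin d → Fin d → ℝ := fun k j => secDir ℓ (c' k) k (pd j v) y with hs
  set p : Fin d → ℝ := fun j => pd j v y with hp
  set G : Fin d → ℝ := fun i => bernG ℓ v i y with hG
  set g : Fin d → Fin d → ℝ := fun k i => if i = ℓ then bdryD1 ℓ p (X k) else X k i with hg
  set t : Fin d → Fin d → ℝ := fun k i => if i = ℓ then bdryD2 ℓ p (X k) (s k) else s k i with ht
  have hnorm : ∀ k, ‖dirVec ℓ (c' k) k‖ ≤ 2 := by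
    intro k
    have e := norm_dirVec_sub (ℓ := ℓ) (c' k) k
    have := norm_le_norm_add_norm_sub' (dirVec ℓ (c' k) k) (EuclideanSpace.single k (1 : ℝ))
    rw [e] at this
    simp only [PiLp.norm_single, norm_one] at this
    linarith [hc k]
  have hjet : ∀ k, HasJet (fun r : ℝ => bernW ℓ v z ρ c (y + r • dirVec ℓ (c' k) k)) _ _ _ :=
    fun k => (((((HasJet.const (ρ ^ 2)).sub (jet_sq_dist y z (dirVec ℓ (c' k) k))).sq).mul
      (HasJet.sum (s := Finset.univ) fun i _ => (jet_bernG hv h1.le h2.le (c' k) k i).sq)).add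
      (((jet_dirVec ((hv.contDiffAt h1.le h2.le).of_le (by norm_cast)) (c' k) k).sub
        (HasJet.const c)).sq.const_mul (2000 * d * ρ ^ 2)))
  have hle : ∀ k, ((2 * z1 k ^ 2 + 2 * (ζ * z2 k)) * (∑ i, G i ^ 2) +
        2 * (2 * (ζ * z1 k) * ∑ i, 2 * (G i * g k i)) +
        ζ ^ 2 * ∑ i, (2 * g k i ^ 2 + 2 * (G i * t k i))) +
      2000 * d * ρ ^ 2 * (2 * (p k + c' k * p ℓ) ^ 2 + 2 * ((v y - c) * secDir ℓ (c' k) k v y)) ≤ 0 := by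
    intro k
    have hl : Tendsto (fun r : ℝ => y + r • dirVec ℓ (c' k) k) (𝓝 0) (𝓝 y) := by
      have : ContinuousAt (fun r : ℝ => y + r • dirVec ℓ (c' k) k) 0 := by fun_prop
      simpa using this.tendsto
    have := (hjet k).nonpos_of_isLocalMax (by
      have e := hl.eventually hmax
      filter_upwards [e] with r hr
      simpa using hr)
    simpa only [sub_zero] using this
  have hsum := Finset.sum_le_sum fun k (_ : k ∈ Finset.univ) => hle k
  rw [Finset.sum_add_distrib, Finset.sum_const_zero] at hsum
  have hb : |bdryFun ℓ v y| ≤ 2 * η := (abs_bdryFun_le hd h0 hη hsm).trans (by linarith)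
  have habs := bernstein_absorb (ℓ := ℓ) hd h0 hη (h := hessNorm v y) (b := bdryFun ℓ v y)
    (H := fun a b => pd a (pd b v) y) (X := X) (s := s) (p := p) (c := c')
    (hessNorm_sq v) (hessNorm_nonneg v) (fun a b => abs_pd_pd_le v a b) (fun _ _ => rfl) hc
    (fun k => (abs_pd_le k).trans hsm) hb (fun j => sum_secDir_pd_le hη4 hv h1 h2 j)
  have hGe : ∀ i, (if i = ℓ then bdryFun ℓ v y else p i) = G i := fun i => by
    simp only [hG, bernG]; split_ifs <;> rfl
  simp only [hGe] at habs
  have hcut := cutoff_alg (ζ := ζ) (ρ := ρ) (z1 := z1) (z2 := z2) (G := G) (g := g) (s := t) hζ0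
    (by rw [hζ]; nlinarith [sq_nonneg ‖y - z‖])
    (fun k => by
      have := abs_real_inner_le_norm (y - z) (dirVec ℓ (c' k) k)
      have h3 := mul_le_mul hz (hnorm k) (norm_nonneg _) hρ.le
      simp only [hz1, zero_sub, abs_neg, abs_mul, abs_two]
      linarith)
    (fun k => by
      simp only [hz2, zero_sub, abs_neg]
      rw [abs_of_nonneg (by positivity)]
      nlinarith [hnorm k, norm_nonneg (dirVec ℓ (c' k) k)])
    habs
  have hQ : ∑ k, 2000 * d * ρ ^ 2 * (2 * (p k + c' k * p ℓ) ^ 2 +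
      2 * ((v y - c) * secDir ℓ (c' k) k v y)) =
      4000 * d * ρ ^ 2 * ∑ k, (p k + c' k * p ℓ) ^ 2 := by
    rw [← Finset.mul_sum, Finset.sum_add_distrib, ← Finset.mul_sum, ← Finset.mul_sum,
      ← Finset.mul_sum, hv.pde y h1.le h2.le]
    ring
  have hQ2 : (2 / 5) * ∑ k, p k ^ 2 ≤ ∑ k, (p k + c' k * p ℓ) ^ 2 := by
    have e1 : ∀ k, (1 / 2) * p k ^ 2 - 4 * η ^ 2 * p ℓ ^ 2 ≤ (p k + c' k * p ℓ) ^ 2 := fun k => by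
      have a1 := half_sq_le (p k) (c' k * p ℓ)
      have a2 := sq_le_sq' (abs_le.1 (hc k)).1 (abs_le.1 (hc k)).2
      have a3 := mul_le_mul_of_nonneg_right a2 (sq_nonneg (p ℓ))
      nlinarith
    have e2 := Finset.sum_le_sum fun k (_ : k ∈ Finset.univ) => e1 k
    simp only [Finset.sum_sub_distrib, ← Finset.mul_sum, Finset.sum_const, Finset.card_univ,
      Fintype.card_fin, nsmul_eq_mul] at e2
    have e3 : p ℓ ^ 2 ≤ ∑ k, p k ^ 2 :=
      Finset.single_le_sum (f := fun k => p k ^ 2) (fun _ _ => sq_nonneg _) (Finset.mem_univ ℓ)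
    have e4 : (d : ℝ) * (4 * η ^ 2) ≤ 1 / 10 := by nlinarith
    have e5 := mul_le_mul e4 e3 (sq_nonneg _) (by norm_num)
    linarith
  have hQ3 : ∑ i, G i ^ 2 ≤ 4 * ∑ k, p k ^ 2 := sum_bernG_sq_le (ℓ := ℓ) hd h0 hη hsm
  have hG0 : 0 ≤ ∑ i, G i ^ 2 := Finset.sum_nonneg fun _ _ => sq_nonneg _
  have hdρ : 0 < d * ρ ^ 2 := by positivity
  rw [hQ] at hsum
  have f1 := mul_le_mul_of_nonneg_left hQ2 hdρ.le
  have f2 := mul_le_mul_of_nonneg_left hQ3 hdρ.le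
  have f3 : d * ρ ^ 2 * ∑ i, G i ^ 2 ≤ 0 := by
    linarith
  have f4 := nonpos_of_mul_nonpos_right f3 hdρ
  exact le_antisymm f4 hG0

end BernsteinMax

lemma HasDerivAt.nonpos_of_eventually_le {f : ℝ → ℝ} {f' : ℝ} (h : HasDerivAt f f' 0)
    (hf : ∀ᶠ t in 𝓝[>] (0 : ℝ), f t ≤ f 0) : f' ≤ 0 := by
  have h1 := (hasDerivWithinAt_iff_tendsto_slope' (by simp)).1 (h.hasDerivWithinAt (s := Ioi 0))
  refine le_of_tendsto h1 ?_
  filter_upwards [hf, self_mem_nhdsWithin] with t ht hpos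
  rw [slope_def_field, sub_zero]
  exact div_nonpos_of_nonpos_of_nonneg (by linarith) (le_of_lt hpos)

section GradientEstimate

variable {d : ℕ} {ℓ : Fin d} {y : EuclideanSpace ℝ (Fin d)} {η : ℝ}
  {v : EuclideanSpace ℝ (Fin d) → ℝ}

lemma hasDerivAt_line {F : EuclideanSpace ℝ (Fin d) → ℝ} (h : DifferentiableAt ℝ F y)
    (β : EuclideanSpace ℝ (Fin d)) :
    HasDerivAt (fun t : ℝ => F (y + t • β)) (fderiv ℝ F y β) 0 := by
  have hl : HasDerivAt (fun t : ℝ => y + t • β) β 0 := by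
    simpa using ((hasDerivAt_id (0 : ℝ)).smul_const β).const_add y
  have h2 : HasFDerivAt F (fderiv ℝ F y) (y + (0 : ℝ) • β) := by simpa using h.hasFDerivAt
  exact h2.comp_hasDerivAt (0 : ℝ) hl

/-- Tangential derivatives of the boundary condition vanish. -/
lemma pd_bdryFun_eq_zero (hv : SmallSol ℓ η v) (h1 : y ℓ = 0) (h2 : 1 < ‖y‖) {i : Fin d}
    (hi : i ≠ ℓ) : pd i (bdryFun ℓ v) y = 0 := by
  have hd := hasDerivAt_line (((hv.contDiffAt_bdryFun h1.ge h2.le)).differentiableAt (by simp))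
    (EuclideanSpace.single i 1)
  have hc : Tendsto (fun t : ℝ => ‖y + t • EuclideanSpace.single i (1 : ℝ)‖) (𝓝 0) (𝓝 ‖y‖) := by
    have : ContinuousAt (fun t : ℝ => ‖y + t • EuclideanSpace.single i (1 : ℝ)‖) 0 := by fun_prop
    simpa using this.tendsto
  have he : (fun t : ℝ => bdryFun ℓ v (y + t • EuclideanSpace.single i 1)) =ᶠ[𝓝 0] fun _ => 0 := by
    filter_upwards [hc.eventually (lt_mem_nhds h2)] with t ht
    exact hv.bdry _ (by simp [h1, hi.symm]) ht.le
  exact hd.unique ((hasDerivAt_const (0 : ℝ) (0 : ℝ)).congr_of_eventuallyEq he)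

lemma pd_bdryFun (hv : SmallSol ℓ η v) (h1 : 0 ≤ y ℓ) (h2 : 1 ≤ ‖y‖) (i : Fin d) :
    pd i (bdryFun ℓ v) y =
      (1 + 2 * pd ℓ v y) * pd i (pd ℓ v) y - ∑ j, pd j v y * pd i (pd j v) y := by
  have hd : ∀ j, DifferentiableAt ℝ (pd j v) y := fun j =>
    (hv.contDiffAt_pd h1 h2 j).differentiableAt (by simp)
  have d1 : DifferentiableAt ℝ (fun z => pd ℓ v z ^ 2) y := (hd ℓ).pow 2
  have d2 : DifferentiableAt ℝ (fun z => pd ℓ v z + pd ℓ v z ^ 2) y := (hd ℓ).add d1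
  have d3 : ∀ j ∈ Finset.univ, DifferentiableAt ℝ (fun z => pd j v z ^ 2) y := fun j _ => (hd j).pow 2
  have d4 : DifferentiableAt ℝ (fun z => ∑ j, pd j v z ^ 2) y := DifferentiableAt.fun_sum d3
  unfold bdryFun
  rw [pd_sub d2 (d4.const_mul _), pd_add (hd ℓ) d1, pd_sq (hd ℓ), pd_const_mul _ d4, pd_sum d3,
    Finset.sum_congr rfl fun j _ => pd_sq (hd j), Finset.mul_sum]
  have : ∀ j, 1 / 2 * (2 * pd j v y * pd i (pd j v) y) = pd j v y * pd i (pd j v) y := fun j => by ring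
  simp only [this]
  ring

set_option maxHeartbeats 400000 in
lemma bernstein_boundary (hd : 3 ≤ d) (h0 : 0 ≤ η) (hη : 10000 * (d : ℝ) ^ 4 * η ≤ 1)
    (hv : SmallSol ℓ η v) (h1 : y ℓ = 0) (h2 : 1 < ‖y‖) {z : EuclideanSpace ℝ (Fin d)} {ρ c : ℝ}
    (hρ : 0 < ρ) (hz : ‖y - z‖ < ρ) (hzℓ : ρ / 2 ≤ z ℓ) (hc : v y ≤ c)
    (hmax : ∀ x : EuclideanSpace ℝ (Fin d), 0 ≤ x ℓ → ‖x - z‖ ≤ ρ → bernW ℓ v z ρ c x ≤ bernW ℓ v z ρ c y) :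
    ∑ i, bernG ℓ v i y ^ 2 = 0 := by
  obtain ⟨hd', s3, s2, s1, s0⟩ := smallness hd h0 hη
  have hsm := hv.small y h1.ge h2.le
  have hP : |pd ℓ v y| ≤ η := (abs_pd_le ℓ).trans hsm
  have hP' := abs_le.1 hP
  set β : EuclideanSpace ℝ (Fin d) := (1 + 2 * pd ℓ v y) • EuclideanSpace.single ℓ 1 -
    ∑ j, pd j v y • EuclideanSpace.single j 1 with hβ
  have hfd : ∀ F : EuclideanSpace ℝ (Fin d) → ℝ, fderiv ℝ F y β =
      (1 + 2 * pd ℓ v y) * pd ℓ F y - ∑ j, pd j v y * pd j F y := fun F => by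
    simp [hβ, pd]
  have hβℓ : β ℓ = 1 + pd ℓ v y := by
    simp [hβ, Pi.single_apply]; ring
  have hbd := hv.bdry y h1 h2.le
  have hG : ∀ i, HasDerivAt (fun t : ℝ => bernG ℓ v i (y + t • β))
      (if i = ℓ then fderiv ℝ (bdryFun ℓ v) y β else 0) 0 := by
    intro i
    unfold bernG
    split_ifs with hi
    · exact hasDerivAt_line ((hv.contDiffAt_bdryFun h1.ge h2.le).differentiableAt (by simp)) β
    · have e := hasDerivAt_line ((hv.contDiffAt_pd h1.ge h2.le i).differentiableAt (by simp)) β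
      have e2 := pd_bdryFun hv h1.ge h2.le i
      rw [pd_bdryFun_eq_zero hv h1 h2 hi] at e2
      have e3 : fderiv ℝ (pd i v) y β = 0 := by
        rw [hfd, e2, pd_comm ((hv.contDiffAt h1.ge h2.le).of_le (by norm_cast))]
        congr 1
        exact Finset.sum_congr rfl fun j _ => by
          rw [pd_comm ((hv.contDiffAt h1.ge h2.le).of_le (by norm_cast))]
      rwa [e3] at e
  obtain ⟨-, ζ', hζ1, hζ2, -⟩ := jet_sq_dist y z β
  have hζd := hζ1.self_of_nhds
  rw [hζ2] at hζd
  have hvd := hasDerivAt_line ((hv.contDiffAt h1.ge h2.le).differentiableAt (by simp)) β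
  have hWd : HasDerivAt (fun t : ℝ => bernW ℓ v z ρ c (y + t • β)) _ 0 :=
    ((((hasDerivAt_const (0 : ℝ) (ρ ^ 2)).sub hζd).pow 2).mul
      (HasDerivAt.fun_sum (u := Finset.univ) fun i _ => (hG i).pow 2)).add
      (((hvd.sub_const c).pow 2).const_mul (2000 * d * ρ ^ 2))
  have hle := hWd.nonpos_of_eventually_le (by
    have hc1 : Tendsto (fun t : ℝ => ‖y + t • β - z‖) (𝓝[>] 0) (𝓝 ‖y - z‖) := by
      have : ContinuousAt (fun t : ℝ => ‖y + t • β - z‖) 0 := by fun_prop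
      have h := this.tendsto
      simp only [zero_smul, add_zero] at h
      exact h.mono_left nhdsWithin_le_nhds
    filter_upwards [hc1.eventually (gt_mem_nhds hz), self_mem_nhdsWithin] with t ht hpos
    simp only [zero_smul, add_zero]
    refine hmax _ ?_ ht.le
    have : (0 : ℝ) < t := hpos
    simp only [PiLp.add_apply, PiLp.smul_apply, smul_eq_mul, hβℓ, h1]
    nlinarith)
  simp only [Pi.pow_apply, Pi.sub_apply, zero_smul, add_zero] at hle
  have hsum0 : ∑ i, (2 : ℕ) * bernG ℓ v i y ^ (2 - 1) *
      (if i = ℓ then fderiv ℝ (bdryFun ℓ v) y β else 0) = 0 := by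
    refine Finset.sum_eq_zero fun i _ => ?_
    split_ifs with hi
    · subst hi; simp [bernG, hbd]
    · simp
  rw [hsum0] at hle
  have hvβ : fderiv ℝ v y β ≤ 0 := by
    rw [hfd]
    have h3 := hv.bdry_nonneg y h1 h2.le
    have h4 : ∑ j, pd j v y * pd j v y = ∑ j, pd j v y ^ 2 :=
      Finset.sum_congr rfl fun j _ => by ring
    rw [bdryFun] at hbd
    rw [h4]; nlinarith
  have hβz : inner ℝ (y - z) β < 0 := by
    have e1 : inner ℝ (y - z) β = (1 + 2 * pd ℓ v y) * (y ℓ - z ℓ) -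
        ∑ j, pd j v y * (y j - z j) := by
      rw [hβ, inner_sub_right, inner_smul_right, inner_sum]
      simp [inner_smul_right, EuclideanSpace.inner_single_right]
    have e2 : |∑ j, pd j v y * (y j - z j)| ≤ d * (η * ρ) := abs_sum_le_card_mul fun j => by
      rw [abs_mul]
      refine mul_le_mul ((abs_pd_le j).trans hsm) ?_ (abs_nonneg _) h0
      have := PiLp.norm_apply_le (y - z) j
      simpa using this.trans hz.le
    have e3 := (abs_le.1 e2).1
    have e4 : d * (η * ρ) ≤ ρ / 4 := by nlinarith
    have e5 : (1 + 2 * pd ℓ v y) * (y ℓ - z ℓ) ≤ (1 - 2 * η) * (y ℓ - z ℓ) := by nlinarith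
    rw [e1]; nlinarith
  have hζ0 : 0 < ρ ^ 2 - ‖y - z‖ ^ 2 := by nlinarith [norm_nonneg (y - z)]
  have hS : 0 ≤ ∑ i, bernG ℓ v i y ^ 2 := Finset.sum_nonneg fun _ _ => sq_nonneg _
  have hle' : 2 * (ρ ^ 2 - ‖y - z‖ ^ 2) * (-(2 * inner ℝ (y - z) β)) * (∑ i, bernG ℓ v i y ^ 2) +
      2000 * d * ρ ^ 2 * (2 * (v y - c) * fderiv ℝ v y β) ≤ 0 := by
    refine le_of_eq_of_le ?_ hle
    push_cast
    ring
  clear hle hWd hG hζd hvd hζ1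
  have q1 : 0 ≤ 2000 * d * ρ ^ 2 * (2 * (v y - c) * fderiv ℝ v y β) :=
    mul_nonneg (by positivity) (mul_nonneg_of_nonpos_of_nonpos (by linarith only [hc]) hvβ)
  have q2 : 0 < (ρ ^ 2 - ‖y - z‖ ^ 2) * (- inner ℝ (y - z) β) := mul_pos hζ0 (by linarith)
  by_contra hne
  have q3 := mul_pos q2 (lt_of_le_of_ne hS (Ne.symm hne))
  nlinarith only [q1, q3, hle']

lemma sum_pd_sq_le_sum_bernG (hd : 3 ≤ d) (h0 : 0 ≤ η) (hη : 10000 * (d : ℝ) ^ 4 * η ≤ 1)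
    (hs : ‖fderiv ℝ v y‖ ≤ η) : ∑ i, pd i v y ^ 2 ≤ 4 * ∑ i, bernG ℓ v i y ^ 2 := by
  obtain ⟨hd', s3, s2, s1, s0⟩ := smallness hd h0 hη
  have h2 := sum_pd_sq_le (v := v) (y := y)
  set Q := ∑ i, pd i v y ^ 2 with hQ
  have hQ0 : 0 ≤ Q := Finset.sum_nonneg fun _ _ => sq_nonneg _
  have hg : ‖fderiv ℝ v y‖ ^ 2 ≤ η := by nlinarith [norm_nonneg (fderiv ℝ v y)]
  have hQ1 : Q ≤ 1 / 10000 := by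
    have := mul_le_mul_of_nonneg_left hg (by linarith : (0 : ℝ) ≤ d)
    linarith
  have e1 := sum_eq_add_ne ℓ fun i => pd i v y ^ 2
  rw [← hQ] at e1
  rw [sum_eq_add_ne ℓ]
  have e2 : (∑ i, if i = ℓ then 0 else bernG ℓ v i y ^ 2) = ∑ i, if i = ℓ then 0 else pd i v y ^ 2 := by
    refine Finset.sum_congr rfl fun i _ => ?_
    by_cases h : i = ℓ <;> simp [bernG, h]
  have e3 : 0 ≤ ∑ i, if i = ℓ then 0 else pd i v y ^ 2 :=
    Finset.sum_nonneg fun _ _ => by split_ifs <;> positivity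
  have h1 := abs_le.1 ((abs_pd_le (f := v) (y := y) ℓ).trans hs)
  rw [e2]
  have e4 : bernG ℓ v ℓ y = pd ℓ v y * (1 + pd ℓ v y) - (1 / 2) * Q := by
    simp only [bernG, if_true, bdryFun]; ring
  rw [e4]
  have e5 : 0.9 ≤ (1 + pd ℓ v y) ^ 2 := by nlinarith
  have e6 : 0.9 * pd ℓ v y ^ 2 ≤ (pd ℓ v y * (1 + pd ℓ v y)) ^ 2 := by
    rw [mul_pow]; nlinarith [sq_nonneg (pd ℓ v y)]
  nlinarith [sq_nonneg (pd ℓ v y * (1 + pd ℓ v y) - Q)]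

lemma norm_fderiv_sq_le : ‖fderiv ℝ v y‖ ^ 2 ≤ d * ∑ i, pd i v y ^ 2 := by
  have h := norm_fderiv_le_sum (f := v) (y := y)
  have h2 := sq_sum_le_card_mul_sum_sq (s := Finset.univ) (f := fun i => |pd i v y|)
  simp only [sq_abs, Finset.card_univ, Fintype.card_fin] at h2
  refine le_trans ?_ h2
  exact pow_le_pow_left₀ (norm_nonneg _) h 2

/-- Gradient estimate for solutions on a half-ball. -/
lemma gradient_estimate (hd : 3 ≤ d) (h0 : 0 ≤ η) (hη : 10000 * (d : ℝ) ^ 4 * η ≤ 1)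
    (hv : SmallSol ℓ η v) (h1 : 0 ≤ y ℓ) (h2 : 2 ≤ ‖y‖) {s O : ℝ}
    (hO : ∀ x : EuclideanSpace ℝ (Fin d), 0 ≤ x ℓ → ‖x - y‖ ≤ ‖y‖ / 2 → |v x - s| ≤ O) :
    ‖fderiv ℝ v y‖ ≤ 1000 * d * O / ‖y‖ := by
  obtain ⟨hd', s3, s2, s1, s0⟩ := smallness hd h0 hη
  set R := ‖y‖ with hR
  set ρ := R / 4 with hρ
  have hρ0 : 0 < ρ := by rw [hρ]; linarith
  set z := y + (ρ / 2) • EuclideanSpace.single ℓ (1 : ℝ) with hz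
  have hzℓ : ρ / 2 ≤ z ℓ := by simp [hz, h1]
  have hyz : ‖y - z‖ = ρ / 2 := by
    rw [hz, sub_add_cancel_left, norm_neg, norm_smul]
    simp [abs_of_pos hρ0]
  have hball : ∀ x : EuclideanSpace ℝ (Fin d), ‖x - z‖ ≤ ρ → ‖x - y‖ ≤ R / 2 ∧ 1 < ‖x‖ := by
    intro x hx
    have a1 : ‖x - y‖ ≤ ‖x - z‖ + ‖z - y‖ := norm_sub_le_norm_sub_add_norm_sub _ _ _
    rw [norm_sub_rev z y, hyz] at a1
    have a2 := norm_sub_norm_le y x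
    rw [norm_sub_rev] at a2
    exact ⟨by linarith, by linarith⟩
  set c := s + O with hc
  have hO0 : 0 ≤ O := (abs_nonneg _).trans (hO y h1 (by simp; linarith))
  set K : Set (EuclideanSpace ℝ (Fin d)) := {x | 0 ≤ x ℓ} ∩ Metric.closedBall z ρ with hK
  have hKc : IsCompact K :=
    (isCompact_closedBall z ρ).inter_left (isClosed_le continuous_const (by fun_prop))
  have hyK : y ∈ K := ⟨h1, by rw [mem_closedBall_iff_norm, hyz]; linarith⟩
  have hcont : ContinuousOn (bernW ℓ v z ρ c) K := by
    intro x hx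
    have b2 := (hball x (mem_closedBall_iff_norm.1 hx.2)).2.le
    have c1 := (hv.contDiffAt hx.1 b2).continuousAt
    have c2 : ∀ i, ContinuousAt (bernG ℓ v i) x := fun i => by
      unfold bernG; split_ifs
      · exact (hv.contDiffAt_bdryFun hx.1 b2).continuousAt
      · exact (hv.contDiffAt_pd hx.1 b2 i).continuousAt
    refine ContinuousAt.continuousWithinAt ?_
    unfold bernW
    refine ContinuousAt.add (ContinuousAt.mul (by fun_prop) (tendsto_finsetSum _ fun i _ => (c2 i).pow 2)) ?_
    exact continuousAt_const.mul ((c1.sub continuousAt_const).pow 2)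
  obtain ⟨x, hxK, hxmax⟩ := hKc.exists_isMaxOn ⟨y, hyK⟩ hcont
  have hxz : ‖x - z‖ ≤ ρ := mem_closedBall_iff_norm.1 hxK.2
  have hxb := hball x hxz
  have hxO := abs_le.1 (hO x hxK.1 hxb.1)
  have hmax : ∀ x' : EuclideanSpace ℝ (Fin d), 0 ≤ x' ℓ → ‖x' - z‖ ≤ ρ →
      bernW ℓ v z ρ c x' ≤ bernW ℓ v z ρ c x := fun x' a b => hxmax ⟨a, mem_closedBall_iff_norm.2 b⟩
  have hfirst : (ρ ^ 2 - ‖x - z‖ ^ 2) ^ 2 * ∑ i, bernG ℓ v i x ^ 2 = 0 := by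
    rcases hxz.eq_or_lt with he | hlt
    · rw [he]; ring
    · have h0x : 0 ≤ x ℓ := hxK.1
      rcases h0x.eq_or_lt with h3 | h3
      · rw [bernstein_boundary hd h0 hη hv h3.symm hxb.2 hρ0 hlt hzℓ (by linarith) hmax, mul_zero]
      · rw [bernstein_interior hd h0 hη hv h3 hxb.2 hρ0 hxz (c := c), mul_zero]
        have o1 : ∀ᶠ x' : EuclideanSpace ℝ (Fin d) in 𝓝 x, 0 < x' ℓ := by
          have : Continuous fun z : EuclideanSpace ℝ (Fin d) => z ℓ := by fun_prop
          exact this.continuousAt.eventually (lt_mem_nhds h3)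
        have o2 : ∀ᶠ x' : EuclideanSpace ℝ (Fin d) in 𝓝 x, ‖x' - z‖ < ρ := by
          have : Continuous fun x : EuclideanSpace ℝ (Fin d) => ‖x - z‖ := by fun_prop
          exact this.continuousAt.eventually (gt_mem_nhds hlt)
        filter_upwards [o1, o2] with x' p1 p2 using hmax x' p1.le p2.le
  have hWx : bernW ℓ v z ρ c x ≤ 2000 * d * ρ ^ 2 * (4 * O ^ 2) := by
    rw [bernW, hfirst, zero_add]
    refine mul_le_mul_of_nonneg_left ?_ (by positivity)
    nlinarith
  have hWy := (hmax y h1 (by rw [hyz]; linarith)).trans hWx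
  have hWy2 : (9 / 16) * ρ ^ 4 * ∑ i, bernG ℓ v i y ^ 2 ≤ 2000 * d * ρ ^ 2 * (4 * O ^ 2) := by
    refine le_trans ?_ hWy
    rw [bernW, hyz]
    have : 0 ≤ 2000 * d * ρ ^ 2 * (v y - c) ^ 2 := by positivity
    have e : (ρ ^ 2 - (ρ / 2) ^ 2) ^ 2 = (9 / 16) * ρ ^ 4 := by ring
    rw [e]; linarith
  have hQ := sum_pd_sq_le_sum_bernG (ℓ := ℓ) hd h0 hη (hv.small y h1 (by linarith))
  have hN := norm_fderiv_sq_le (v := v) (y := y)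
  have e1 : ρ ^ 2 * ∑ i, bernG ℓ v i y ^ 2 ≤ (128000 / 9) * d * O ^ 2 := by
    have : 0 < ρ ^ 2 := by positivity
    refine le_of_mul_le_mul_left ?_ this
    linarith
  have e2 : (R * ‖fderiv ℝ v y‖) ^ 2 ≤ (1000 * d * O) ^ 2 := by
    have r1 : (R * ‖fderiv ℝ v y‖) ^ 2 = 16 * (ρ ^ 2 * ‖fderiv ℝ v y‖ ^ 2) := by rw [hρ]; ring
    have r2 : ‖fderiv ℝ v y‖ ^ 2 ≤ d * (4 * ∑ i, bernG ℓ v i y ^ 2) :=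
      hN.trans (mul_le_mul_of_nonneg_left hQ (by linarith))
    have r3 := mul_le_mul_of_nonneg_left r2 (sq_nonneg ρ)
    have r4 := mul_le_mul_of_nonneg_left e1 (by linarith : (0 : ℝ) ≤ 4 * d)
    rw [r1]
    nlinarith [sq_nonneg (d * O)]
  rw [le_div_iff₀ (by linarith)]
  have e3 : 0 ≤ 1000 * d * O := by positivity
  have := abs_le_of_sq_le_sq' e2 e3
  linarith

end GradientEstimate

/-! ### Touching and comparison -/

/-- At `y`, the function `w` solves a linear elliptic equation `∑ k, ∂²w/∂ξ_k² = 0` whose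
directions are `η`-close to the coordinate vectors, or an almost-Neumann condition. -/
def LinAt {d : ℕ} (ℓ : Fin d) (η : ℝ) (w : EuclideanSpace ℝ (Fin d) → ℝ)
    (y : EuclideanSpace ℝ (Fin d)) : Prop :=
  (0 < y ℓ → ∃ ξ : Fin d → EuclideanSpace ℝ (Fin d),
    (∀ k, ‖ξ k - EuclideanSpace.single k 1‖ ≤ η) ∧ ∃ B C : Fin d → ℝ,
      (∀ k, HasJet (fun t : ℝ => w (y + t • ξ k)) (w y) (B k) (C k)) ∧ ∑ k, C k = 0) ∧
  (y ℓ = 0 → ∃ b : Fin d → ℝ,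
    (∀ i, HasDerivAt (fun t : ℝ => w (y + t • EuclideanSpace.single i 1)) (b i) 0) ∧
      |b ℓ| ≤ η * ∑ i, if i = ℓ then 0 else |b i|)

/-- At `y`, the function `φ` is a strict subsolution for all the problems in `LinAt ℓ η`. -/
def StrictSub {d : ℕ} (ℓ : Fin d) (η : ℝ) (φ : EuclideanSpace ℝ (Fin d) → ℝ)
    (y : EuclideanSpace ℝ (Fin d)) : Prop :=
  (0 < y ℓ → ∀ ξ : Fin d → EuclideanSpace ℝ (Fin d),
    (∀ k, ‖ξ k - EuclideanSpace.single k 1‖ ≤ η) → ∃ B C : Fin d → ℝ,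
      (∀ k, HasJet (fun t : ℝ => φ (y + t • ξ k)) (φ y) (B k) (C k)) ∧ 0 < ∑ k, C k) ∧
  (y ℓ = 0 → ∃ b : Fin d → ℝ,
    (∀ i, HasDerivAt (fun t : ℝ => φ (y + t • EuclideanSpace.single i 1)) (b i) 0) ∧
      η * (∑ i, if i = ℓ then 0 else |b i|) < b ℓ)

section Comparison

variable {d : ℕ} {ℓ : Fin d} {η : ℝ} {y : EuclideanSpace ℝ (Fin d)}
  {w φ : EuclideanSpace ℝ (Fin d) → ℝ}

lemma LinAt.neg (h : LinAt ℓ η w y) : LinAt ℓ η (fun x => - w x) y := by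
  refine ⟨fun hy => ?_, fun hy => ?_⟩
  · obtain ⟨ξ, h1, B, C, h2, h3⟩ := h.1 hy
    exact ⟨ξ, h1, fun k => - B k, fun k => - C k, fun k => (h2 k).neg, by simp [h3]⟩
  · obtain ⟨b, h1, h2⟩ := h.2 hy
    exact ⟨fun i => - b i, fun i => (h1 i).neg, by simpa using h2⟩

lemma LinAt.add_const (h : LinAt ℓ η w y) (c : ℝ) : LinAt ℓ η (fun x => w x + c) y := by
  refine ⟨fun hy => ?_, fun hy => ?_⟩
  · obtain ⟨ξ, h1, B, C, h2, h3⟩ := h.1 hy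
    exact ⟨ξ, h1, B, C, fun k => ((h2 k).add (HasJet.const c)).congr_val rfl (by simp) (by simp), h3⟩
  · obtain ⟨b, h1, h2⟩ := h.2 hy
    exact ⟨b, fun i => (h1 i).add_const c, h2⟩

lemma LinAt.mono {η' : ℝ} (h : LinAt ℓ η w y) (hη : η ≤ η') : LinAt ℓ η' w y := by
  refine ⟨fun hy => ?_, fun hy => ?_⟩
  · obtain ⟨ξ, h1, h2⟩ := h.1 hy
    exact ⟨ξ, fun k => (h1 k).trans hη, h2⟩
  · obtain ⟨b, h1, h2⟩ := h.2 hy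
    refine ⟨b, h1, h2.trans (mul_le_mul_of_nonneg_right hη ?_)⟩
    exact Finset.sum_nonneg fun _ _ => by split_ifs <;> positivity

lemma StrictSub.const_mul (h : StrictSub ℓ η φ y) {c : ℝ} (hc : 0 < c) :
    StrictSub ℓ η (fun x => c * φ x) y := by
  refine ⟨fun hy ξ hξ => ?_, fun hy => ?_⟩
  · obtain ⟨B, C, h2, h3⟩ := h.1 hy ξ hξ
    refine ⟨fun k => c * B k, fun k => c * C k, fun k => (h2 k).const_mul c, ?_⟩
    rw [← Finset.mul_sum]; positivity
  · obtain ⟨b, h1, h2⟩ := h.2 hy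
    refine ⟨fun i => c * b i, fun i => (h1 i).const_mul c, ?_⟩
    have : (∑ i, if i = ℓ then 0 else |c * b i|) = c * ∑ i, if i = ℓ then 0 else |b i| := by
      rw [Finset.mul_sum]
      refine Finset.sum_congr rfl fun i _ => ?_
      split_ifs <;> simp [abs_mul, abs_of_pos hc]
    rw [this]; nlinarith

lemma StrictSub.add_const (h : StrictSub ℓ η φ y) (c : ℝ) : StrictSub ℓ η (fun x => φ x + c) y := by
  refine ⟨fun hy ξ hξ => ?_, fun hy => ?_⟩
  · obtain ⟨B, C, h2, h3⟩ := h.1 hy ξ hξ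
    exact ⟨B, C, fun k => ((h2 k).add (HasJet.const c)).congr_val rfl (by simp) (by simp), h3⟩
  · obtain ⟨b, h1, h2⟩ := h.2 hy
    exact ⟨b, fun i => (h1 i).add_const c, h2⟩

lemma tendsto_line (y ξ : EuclideanSpace ℝ (Fin d)) :
    Tendsto (fun t : ℝ => y + t • ξ) (𝓝 0) (𝓝 y) := by
  have : ContinuousAt (fun t : ℝ => y + t • ξ) 0 := by fun_prop
  simpa using this.tendsto

lemma eventually_line_pos (hy : 0 < y ℓ) (ξ : EuclideanSpace ℝ (Fin d)) :
    ∀ᶠ t in 𝓝 (0 : ℝ), y + t • ξ ∈ upHalf ℓ := by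
  have hc : ContinuousAt (fun x : EuclideanSpace ℝ (Fin d) => x ℓ) y := by fun_prop
  filter_upwards [(tendsto_line y ξ).eventually (hc.eventually (lt_mem_nhds hy))] with t ht
    using le_of_lt ht

lemma not_touch (hw : LinAt ℓ η w y) (hφ : StrictSub ℓ η φ y) (hy : 0 ≤ y ℓ)
    (h : ∀ᶠ x in 𝓝[upHalf ℓ] y, w y - φ y ≤ w x - φ x) : False := by
  rw [eventually_nhdsWithin_iff] at h
  rcases hy.lt_or_eq with hy | hy
  · obtain ⟨ξ, h1, B, C, h2, h3⟩ := hw.1 hy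
    obtain ⟨B', C', h4, h5⟩ := hφ.1 hy ξ h1
    have : ∀ k, 0 ≤ C k - C' k := fun k => by
      refine ((h2 k).sub (h4 k)).nonneg_of_isLocalMin ?_
      filter_upwards [(tendsto_line y (ξ k)).eventually h, eventually_line_pos hy (ξ k)] with t ht ht'
      simpa using ht ht'
    have := Finset.sum_nonneg fun k (_ : k ∈ Finset.univ) => this k
    rw [Finset.sum_sub_distrib] at this
    linarith
  · obtain ⟨b, h1, h2⟩ := hw.2 hy.symm
    obtain ⟨b', h3, h4⟩ := hφ.2 hy.symm
    have ht : ∀ i, i ≠ ℓ → b i = b' i := fun i hi => by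
      have : IsLocalMin (fun t : ℝ => w (y + t • EuclideanSpace.single i 1) -
          φ (y + t • EuclideanSpace.single i 1)) 0 := by
        filter_upwards [(tendsto_line y (EuclideanSpace.single i 1)).eventually h] with t ht
        simpa using ht (by simp [upHalf, ← hy, hi.symm])
      have := this.hasDerivAt_eq_zero ((h1 i).sub (h3 i))
      linarith
    have hn : b' ℓ - b ℓ ≤ 0 := by
      refine HasDerivAt.nonpos_of_eventually_le ((h3 ℓ).sub (h1 ℓ)) ?_
      filter_upwards [nhdsWithin_le_nhds ((tendsto_line y (EuclideanSpace.single ℓ 1)).eventually h),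
        self_mem_nhdsWithin] with t ht hpos
      have := ht (by simp [upHalf, ← hy]; exact le_of_lt hpos)
      simp only [Pi.sub_apply, zero_smul, add_zero]
      linarith
    have he : (∑ i, if i = ℓ then 0 else |b i|) = ∑ i, if i = ℓ then 0 else |b' i| := by
      refine Finset.sum_congr rfl fun i _ => ?_
      split_ifs with hi
      · rfl
      · rw [ht i hi]
    rw [he] at h2
    linarith [le_abs_self (b ℓ)]

lemma comparison {K : Set (EuclideanSpace ℝ (Fin d))} (hK : IsCompact K) (hw : ContinuousOn w K)
    (hφ : ContinuousOn φ K)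
    (h : ∀ y ∈ K, φ y ≤ w y ∨ (0 ≤ y ℓ ∧ K ∈ 𝓝[upHalf ℓ] y ∧ ∃ η, LinAt ℓ η w y ∧ StrictSub ℓ η φ y)) :
    ∀ y ∈ K, φ y ≤ w y := by
  intro y hy
  obtain ⟨x, hx, hmin⟩ := hK.exists_isMinOn ⟨y, hy⟩ (hw.sub hφ)
  have hm : ∀ z ∈ K, w x - φ x ≤ w z - φ z := fun z hz => hmin hz
  rcases h x hx with h1 | ⟨h1, h2, η, h3, h4⟩
  · linarith [hm y hy]
  · exact (not_touch h3 h4 h1 (by filter_upwards [h2] with z hz using hm z hz)).elim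

lemma SmallSol.linAt {v : EuclideanSpace ℝ (Fin d) → ℝ} (hη : η ≤ 1 / 2) (hv : SmallSol ℓ η v)
    (h1 : 0 ≤ y ℓ) (h2 : 1 ≤ ‖y‖) : LinAt ℓ (2 * ‖fderiv ℝ v y‖) v y := by
  have hc := hv.contDiffAt h1 h2
  refine ⟨fun _ => ?_, fun hy => ?_⟩
  · refine ⟨fun k => dirVec ℓ (dirCoef ℓ v k y) k, fun k => ?_, _, _,
      fun k => jet_dirVec (hc.of_le (by norm_cast)) _ k, hv.pde y h1 h2⟩
    rw [norm_dirVec_sub]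
    exact abs_dirCoef_le hη (hv.small y h1 h2) k
  · refine ⟨fun i => pd i v y, fun i => hasDerivAt_line (hc.differentiableAt (by simp)) _, ?_⟩
    have hb := hv.bdry y hy h2
    have h0 := hv.bdry_nonneg y hy h2
    rw [bdryFun, sum_eq_add_ne ℓ] at hb
    rw [abs_of_nonneg h0, Finset.mul_sum]
    have : (∑ i, if i = ℓ then 0 else pd i v y ^ 2) ≤
        ∑ i, 2 * ‖fderiv ℝ v y‖ * if i = ℓ then 0 else |pd i v y| := by
      refine Finset.sum_le_sum fun i _ => ?_
      split_ifs
      · simp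
      · have := abs_pd_le (f := v) (y := y) i
        rw [← sq_abs]
        nlinarith [abs_nonneg (pd i v y), norm_nonneg (fderiv ℝ v y)]
    have h5 : 0 ≤ ∑ i, if i = ℓ then 0 else pd i v y ^ 2 :=
      Finset.sum_nonneg fun _ _ => by split_ifs <;> positivity
    nlinarith [sq_nonneg (pd ℓ v y)]

end Comparison

/-! ### Radial barriers -/

section Radial

variable {d : ℕ} {ℓ : Fin d} {η : ℝ} {ξ : Fin d → EuclideanSpace ℝ (Fin d)}

lemma norm_dir_le (h1 : η ≤ 1) (hξ : ∀ k, ‖ξ k - EuclideanSpace.single k 1‖ ≤ η) (k : Fin d) :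
    ‖ξ k‖ ≤ 2 := by
  have := norm_add_le (ξ k - EuclideanSpace.single k 1) (EuclideanSpace.single k (1 : ℝ))
  rw [sub_add_cancel, PiLp.norm_single, norm_one] at this
  linarith [hξ k]

lemma norm_dir_add_le (h1 : η ≤ 1) (hξ : ∀ k, ‖ξ k - EuclideanSpace.single k 1‖ ≤ η) (k : Fin d) :
    ‖ξ k + EuclideanSpace.single k 1‖ ≤ 3 := by
  have := norm_add_le (ξ k) (EuclideanSpace.single k (1 : ℝ))
  rw [PiLp.norm_single, norm_one] at this
  linarith [norm_dir_le h1 hξ k]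

lemma abs_sum_norm_dir_sq_sub (h1 : η ≤ 1) (hξ : ∀ k, ‖ξ k - EuclideanSpace.single k 1‖ ≤ η) :
    |∑ k, ‖ξ k‖ ^ 2 - d| ≤ d * (3 * η) := by
  have e : ∑ k, ‖ξ k‖ ^ 2 - d = ∑ k, (‖ξ k‖ ^ 2 - 1) := by simp
  rw [e]
  refine abs_sum_le_card_mul fun k => ?_
  have h2 : ‖ξ k‖ ^ 2 - 1 = inner ℝ (ξ k - EuclideanSpace.single k 1) (ξ k + EuclideanSpace.single k 1) := by
    rw [inner_sub_left, inner_add_right, inner_add_right, real_inner_comm (EuclideanSpace.single k 1) (ξ k),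
      real_inner_self_eq_norm_sq, real_inner_self_eq_norm_sq, PiLp.norm_single, norm_one]
    ring
  rw [h2]
  refine (abs_real_inner_le_norm _ _).trans ?_
  have := mul_le_mul (hξ k) (norm_dir_add_le h1 hξ k) (norm_nonneg _) ((norm_nonneg _).trans (hξ k))
  linarith

lemma abs_sum_inner_dir_sq_sub (h1 : η ≤ 1) (hξ : ∀ k, ‖ξ k - EuclideanSpace.single k 1‖ ≤ η)
    (x : EuclideanSpace ℝ (Fin d)) : |∑ k, inner ℝ x (ξ k) ^ 2 - ‖x‖ ^ 2| ≤ d * (3 * η) * ‖x‖ ^ 2 := by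
  have e : ∑ k, inner ℝ x (ξ k) ^ 2 - ‖x‖ ^ 2 = ∑ k, (inner ℝ x (ξ k) ^ 2 - x k ^ 2) := by
    rw [Finset.sum_sub_distrib, EuclideanSpace.real_norm_sq_eq]
  rw [e, mul_assoc]
  refine abs_sum_le_card_mul fun k => ?_
  have h2 : inner ℝ x (ξ k) ^ 2 - x k ^ 2 =
      inner ℝ x (ξ k - EuclideanSpace.single k 1) * inner ℝ x (ξ k + EuclideanSpace.single k 1) := by
    rw [inner_sub_right, inner_add_right, EuclideanSpace.inner_single_right]
    simp; ring
  rw [h2, abs_mul]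
  have := mul_le_mul (abs_real_inner_le_norm x (ξ k - EuclideanSpace.single k 1))
    (abs_real_inner_le_norm x (ξ k + EuclideanSpace.single k 1)) (abs_nonneg _) (by positivity)
  refine this.trans ?_
  have h3 := mul_le_mul (hξ k) (norm_dir_add_le h1 hξ k) (norm_nonneg _) ((norm_nonneg _).trans (hξ k))
  nlinarith [sq_nonneg ‖x‖]

lemma abs_sum_dir_mul_inner_sub (h1 : η ≤ 1) (hξ : ∀ k, ‖ξ k - EuclideanSpace.single k 1‖ ≤ η)
    (x : EuclideanSpace ℝ (Fin d)) : |∑ k, ξ k ℓ * inner ℝ x (ξ k) - x ℓ| ≤ d * (3 * η) * ‖x‖ := by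
  have e : ∑ k, ξ k ℓ * inner ℝ x (ξ k) - x ℓ =
      ∑ k, (ξ k ℓ * inner ℝ x (ξ k) - (EuclideanSpace.single k (1 : ℝ)) ℓ * x k) := by
    rw [Finset.sum_sub_distrib]
    simp
  rw [e, mul_assoc]
  refine abs_sum_le_card_mul fun k => ?_
  have h2 : ξ k ℓ * inner ℝ x (ξ k) - (EuclideanSpace.single k (1 : ℝ)) ℓ * x k =
      (ξ k - EuclideanSpace.single k 1 : EuclideanSpace ℝ (Fin d)) ℓ * inner ℝ x (ξ k) + (EuclideanSpace.single k (1 : ℝ)) ℓ *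
        inner ℝ x (ξ k - EuclideanSpace.single k 1) := by
    rw [inner_sub_right, EuclideanSpace.inner_single_right, PiLp.sub_apply]
    simp only [conj_trivial, one_mul]; ring
  rw [h2]
  have a1 : |(ξ k - EuclideanSpace.single k 1 : EuclideanSpace ℝ (Fin d)) ℓ| ≤ η := (PiLp.norm_apply_le _ ℓ).trans (hξ k)
  have a2 : |(EuclideanSpace.single k (1 : ℝ) : EuclideanSpace ℝ (Fin d)) ℓ| ≤ 1 := by
    have := PiLp.norm_apply_le (EuclideanSpace.single k (1 : ℝ) : EuclideanSpace ℝ (Fin d)) ℓ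
    rwa [PiLp.norm_single, norm_one] at this
  have a3 : |inner ℝ x (ξ k)| ≤ ‖x‖ * 2 := (abs_real_inner_le_norm _ _).trans
    (mul_le_mul_of_nonneg_left (norm_dir_le h1 hξ k) (norm_nonneg _))
  have a4 : |inner ℝ x (ξ k - EuclideanSpace.single k 1)| ≤ ‖x‖ * η := (abs_real_inner_le_norm _ _).trans
    (mul_le_mul_of_nonneg_left (hξ k) (norm_nonneg _))
  refine (abs_add_le _ _).trans ?_
  rw [abs_mul, abs_mul]
  have b1 := mul_le_mul a1 a3 (abs_nonneg _) ((abs_nonneg _).trans a1)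
  have b2 := mul_le_mul a2 a4 (abs_nonneg _) zero_le_one
  linarith

/-- `∑ k, ∂²/∂ξ_k²` of `x ↦ (|x|²)^a`. -/
def radialOp {d : ℕ} (ξ : Fin d → EuclideanSpace ℝ (Fin d)) (a : ℝ) (x : EuclideanSpace ℝ (Fin d)) : ℝ :=
  a * (‖x‖ ^ 2) ^ (a - 1) * (2 * ∑ k, ‖ξ k‖ ^ 2) +
    4 * a * (a - 1) * (‖x‖ ^ 2) ^ (a - 2) * ∑ k, inner ℝ x (ξ k) ^ 2

lemma jet_radial {y z : EuclideanSpace ℝ (Fin d)} (h : y ≠ z) (a : ℝ) (e : EuclideanSpace ℝ (Fin d)) :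
    HasJet (fun t : ℝ => (‖y + t • e - z‖ ^ 2) ^ a) ((‖y - z‖ ^ 2) ^ a)
      (2 * a * (‖y - z‖ ^ 2) ^ (a - 1) * inner ℝ (y - z) e)
      (a * (‖y - z‖ ^ 2) ^ (a - 1) * (2 * ‖e‖ ^ 2) +
        4 * a * (a - 1) * (‖y - z‖ ^ 2) ^ (a - 2) * inner ℝ (y - z) e ^ 2) := by
  have hT : 0 < ‖y - z‖ ^ 2 := by have := norm_pos_iff.2 (sub_ne_zero.2 h); positivity
  exact ((jet_sq_dist y z e).rpow hT a).congr_val rfl (by ring) (by ring)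

lemma abs_radialOp_sub (h1 : η ≤ 1) (hξ : ∀ k, ‖ξ k - EuclideanSpace.single k 1‖ ≤ η)
    {x : EuclideanSpace ℝ (Fin d)} (hx : x ≠ 0) (a : ℝ) :
    |radialOp ξ a x - 2 * a * (d + 2 * a - 2) * (‖x‖ ^ 2) ^ (a - 1)| ≤
      |a| * (2 + 4 * |a - 1|) * (3 * d * η) * (‖x‖ ^ 2) ^ (a - 1) := by
  have hT : 0 < ‖x‖ ^ 2 := by have := norm_pos_iff.2 hx; positivity
  have hs : (‖x‖ ^ 2) ^ (a - 1) = (‖x‖ ^ 2) ^ (a - 2) * ‖x‖ ^ 2 := by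
    rw [show a - 1 = (a - 2) + 1 by ring, rpow_add_one hT.ne']
  have hp : 0 < (‖x‖ ^ 2) ^ (a - 2) := rpow_pos_of_pos hT _
  have e1 := abs_sum_norm_dir_sq_sub h1 hξ
  have e2 := abs_sum_inner_dir_sq_sub h1 hξ x
  rw [radialOp, hs]
  generalize (‖x‖ ^ 2) ^ (a - 2) = P at *
  generalize ‖x‖ ^ 2 = T at *
  set S := ∑ k, ‖ξ k‖ ^ 2
  set U := ∑ k, inner ℝ x (ξ k) ^ 2
  have e3 : a * (P * T) * (2 * S) + 4 * a * (a - 1) * P * U - 2 * a * (d + 2 * a - 2) * (P * T) =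
      2 * (P * T) * a * (S - d) + 4 * a * (a - 1) * P * (U - T) := by ring
  rw [e3]
  refine (abs_add_le _ _).trans ?_
  simp only [abs_mul, abs_of_pos hp, abs_of_pos hT, abs_two, abs_of_pos (by norm_num : (0 : ℝ) < 4)]
  have f1 := mul_le_mul_of_nonneg_left e1 (by positivity : 0 ≤ 2 * (P * T) * |a|)
  have f2 := mul_le_mul_of_nonneg_left e2 (by positivity : 0 ≤ 4 * |a| * |a - 1| * P)
  calc _ ≤ _ := add_le_add f1 f2
    _ = _ := by ring

/-- `∑ k, ∂²/∂ξ_k²` of `x ↦ x_ℓ (|x|²)^b`. -/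
def tiltOp {d : ℕ} (ℓ : Fin d) (ξ : Fin d → EuclideanSpace ℝ (Fin d)) (b : ℝ)
    (x : EuclideanSpace ℝ (Fin d)) : ℝ :=
  x ℓ * radialOp ξ b x + 4 * b * (‖x‖ ^ 2) ^ (b - 1) * ∑ k, ξ k ℓ * inner ℝ x (ξ k)

lemma jet_tilt {y : EuclideanSpace ℝ (Fin d)} (h : y ≠ 0) (b : ℝ) (e : EuclideanSpace ℝ (Fin d)) :
    HasJet (fun t : ℝ => (y + t • e) ℓ * (‖y + t • e‖ ^ 2) ^ b) (y ℓ * (‖y‖ ^ 2) ^ b)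
      (e ℓ * (‖y‖ ^ 2) ^ b + y ℓ * (2 * b * (‖y‖ ^ 2) ^ (b - 1) * inner ℝ y e))
      (y ℓ * (b * (‖y‖ ^ 2) ^ (b - 1) * (2 * ‖e‖ ^ 2) +
        4 * b * (b - 1) * (‖y‖ ^ 2) ^ (b - 2) * inner ℝ y e ^ 2) +
        4 * b * (‖y‖ ^ 2) ^ (b - 1) * (e ℓ * inner ℝ y e)) := by
  have h1 := jet_radial (z := 0) h b e
  simp only [sub_zero] at h1
  exact ((HasJet.affine (y ℓ) (e ℓ)).mul h1).congr_val rfl (by ring) (by ring)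

lemma abs_tiltOp_le (h1 : 10 * d * η ≤ 1) (h2 : η ≤ 1)
    (hξ : ∀ k, ‖ξ k - EuclideanSpace.single k 1‖ ≤ η)
    {x : EuclideanSpace ℝ (Fin d)} (hx : x ≠ 0) (b : ℝ) :
    |tiltOp ℓ ξ b x| ≤ |b| * (2 * d + 9 + 6 * |b - 1|) * ‖x‖ * (‖x‖ ^ 2) ^ (b - 1) := by
  have hP : 0 < (‖x‖ ^ 2) ^ (b - 1) := rpow_pos_of_pos (by have := norm_pos_iff.2 hx; positivity) _
  have e1 := abs_radialOp_sub h2 hξ hx b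
  have e2 := abs_sum_dir_mul_inner_sub (ℓ := ℓ) h2 hξ x
  have hxl : |x ℓ| ≤ ‖x‖ := PiLp.norm_apply_le x ℓ
  rw [tiltOp]
  set P := (‖x‖ ^ 2) ^ (b - 1)
  set R := radialOp ξ b x
  set V := ∑ k, ξ k ℓ * inner ℝ x (ξ k)
  have hd0 : (0 : ℝ) ≤ d := Nat.cast_nonneg d
  have a0 : |2 * b * (d + 2 * b - 2) * P| ≤ |b| * (2 * d + 4 * |b - 1|) * P := by
    rw [show 2 * b * (d + 2 * b - 2) * P = b * (2 * d + 4 * (b - 1)) * P by ring, abs_mul, abs_mul,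
      abs_of_pos hP]
    refine mul_le_mul_of_nonneg_right (mul_le_mul_of_nonneg_left ((abs_add_le _ _).trans ?_) (abs_nonneg _)) hP.le
    rw [abs_mul 4, abs_of_nonneg (by positivity : (0 : ℝ) ≤ 2 * d), abs_of_pos (by norm_num : (0 : ℝ) < 4)]
  have a1 : |R| ≤ |b| * (2 * d + 4 * |b - 1|) * P + |b| * (2 + 4 * |b - 1|) * (3 * d * η) * P := by
    have := abs_sub_abs_le_abs_sub R (2 * b * (d + 2 * b - 2) * P)
    linarith
  have a2 : |b| * (2 + 4 * |b - 1|) * (3 * d * η) * P ≤ |b| * (2 + 4 * |b - 1|) * (1 / 2) * P := by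
    refine mul_le_mul_of_nonneg_right (mul_le_mul_of_nonneg_left (by linarith) (by positivity)) hP.le
  have a3 : |V| ≤ 2 * ‖x‖ := by
    have := abs_sub_abs_le_abs_sub V (x ℓ)
    have : d * (3 * η) * ‖x‖ ≤ 1 * ‖x‖ := mul_le_mul_of_nonneg_right (by linarith) (norm_nonneg _)
    linarith
  refine (abs_add_le _ _).trans ?_
  rw [abs_mul, abs_mul (4 * b * P), abs_mul, abs_mul 4, abs_of_pos hP, abs_of_pos (by norm_num : (0 : ℝ) < 4)]
  have b1 := mul_le_mul hxl (a1.trans (add_le_add_right a2 _)) (abs_nonneg _) (norm_nonneg _)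
  have b2 := mul_le_mul_of_nonneg_left a3 (by positivity : 0 ≤ 4 * |b| * P)
  refine (add_le_add b1 b2).trans (le_of_eq ?_)
  ring

end Radial

/-! ### Exterior barriers -/

/-- The function `α (|y|²)^a + β (|y|²)^a' + κ y_ℓ (|y|²)^b`. -/
def tiltedRadial {d : ℕ} (ℓ : Fin d) (α a β a' κ b : ℝ) (y : EuclideanSpace ℝ (Fin d)) : ℝ :=
  α * (‖y‖ ^ 2) ^ a + β * (‖y‖ ^ 2) ^ a' + κ * (y ℓ * (‖y‖ ^ 2) ^ b)

lemma HasJet.hasDerivAt {f : ℝ → ℝ} {a b c : ℝ} (h : HasJet f a b c) : HasDerivAt f b 0 := by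
  obtain ⟨-, f', h1, h2, -⟩ := h
  exact h2 ▸ h1.self_of_nhds

section Barriers

variable {d : ℕ} {ℓ : Fin d} {η : ℝ} {y : EuclideanSpace ℝ (Fin d)}

lemma strictSub_tiltedRadial {α a β a' κ b : ℝ} (h0 : 0 ≤ η) (hy : y ≠ 0)
    (h_int : ∀ ξ : Fin d → EuclideanSpace ℝ (Fin d), (∀ k, ‖ξ k - EuclideanSpace.single k 1‖ ≤ η) →
      0 < α * radialOp ξ a y + β * radialOp ξ a' y + κ * tiltOp ℓ ξ b y)
    (hbd : η * (d * (2 * ‖y‖ * (|α| * |a| * (‖y‖ ^ 2) ^ (a - 1) + |β| * |a'| * (‖y‖ ^ 2) ^ (a' - 1)))) <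
      κ * (‖y‖ ^ 2) ^ b) :
    StrictSub ℓ η (tiltedRadial ℓ α a β a' κ b) y := by
  have hj := fun e : EuclideanSpace ℝ (Fin d) =>
    (((jet_radial (z := 0) hy a e).const_mul α).add ((jet_radial (z := 0) hy a' e).const_mul β)).add
      ((jet_tilt (ℓ := ℓ) hy b e).const_mul κ)
  simp only [sub_zero] at hj
  have hder := fun i : Fin d => (hj (EuclideanSpace.single i 1)).hasDerivAt
  refine ⟨fun _ ξ hξ => ⟨_, _, fun k => hj (ξ k), ?_⟩, fun hyl => ⟨_, hder, ?_⟩⟩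
  · refine lt_of_lt_of_eq (h_int ξ hξ) ?_
    simp only [Finset.sum_add_distrib, ← Finset.mul_sum, radialOp, tiltOp]
  · have hT : 0 < ‖y‖ ^ 2 := by have := norm_pos_iff.2 hy; positivity
    have e1 : (∑ i, if i = ℓ then 0 else |α * (2 * a * (‖y‖ ^ 2) ^ (a - 1) * inner ℝ y (EuclideanSpace.single i 1)) +
        β * (2 * a' * (‖y‖ ^ 2) ^ (a' - 1) * inner ℝ y (EuclideanSpace.single i 1)) +
        κ * ((EuclideanSpace.single i (1 : ℝ) : EuclideanSpace ℝ (Fin d)) ℓ * (‖y‖ ^ 2) ^ b +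
          y ℓ * (2 * b * (‖y‖ ^ 2) ^ (b - 1) * inner ℝ y (EuclideanSpace.single i 1)))|) ≤
        d * (2 * ‖y‖ * (|α| * |a| * (‖y‖ ^ 2) ^ (a - 1) + |β| * |a'| * (‖y‖ ^ 2) ^ (a' - 1))) := by
      refine (le_abs_self _).trans (abs_sum_le_card_mul fun i => ?_)
      split_ifs with hi
      · rw [abs_zero]; positivity
      · have hz : (EuclideanSpace.single i (1 : ℝ) : EuclideanSpace ℝ (Fin d)) ℓ = 0 := by
          simp [Ne.symm hi]
        rw [hz, hyl, abs_abs, EuclideanSpace.inner_single_right]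
        simp only [zero_mul, add_zero, mul_zero, conj_trivial, one_mul]
        have hyi : |y i| ≤ ‖y‖ := PiLp.norm_apply_le y i
        have q1 : 0 < (‖y‖ ^ 2) ^ (a - 1) := rpow_pos_of_pos hT _
        have q2 : 0 < (‖y‖ ^ 2) ^ (a' - 1) := rpow_pos_of_pos hT _
        refine (abs_add_le _ _).trans ?_
        simp only [abs_mul, abs_two, abs_of_pos q1, abs_of_pos q2]
        have := mul_le_mul_of_nonneg_left hyi
          (by positivity : 0 ≤ 2 * (|α| * |a| * (‖y‖ ^ 2) ^ (a - 1) + |β| * |a'| * (‖y‖ ^ 2) ^ (a' - 1)))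
        linarith
    refine (mul_le_mul_of_nonneg_left e1 h0).trans_lt (hbd.trans_eq ?_)
    simp only [EuclideanSpace.inner_single_right, hyl]
    simp

lemma continuousOn_tiltedRadial {α a β a' κ b : ℝ} :
    ContinuousOn (tiltedRadial ℓ α a β a' κ b) {0}ᶜ := by
  intro y hy
  have hT : ‖y‖ ^ 2 ≠ 0 := by have := norm_pos_iff.2 (show y ≠ 0 from hy); positivity
  have h : ∀ p : ℝ, ContinuousAt (fun y : EuclideanSpace ℝ (Fin d) => (‖y‖ ^ 2) ^ p) y := fun p =>
    ContinuousAt.rpow_const (by fun_prop) (Or.inl hT)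
  have h2 : ContinuousAt (fun y : EuclideanSpace ℝ (Fin d) => y ℓ) y := by fun_prop
  exact (((continuousAt_const.mul (h a)).add (continuousAt_const.mul (h a'))).add
    (continuousAt_const.mul (h2.mul (h b)))).continuousWithinAt

lemma norm_sq_rpow (y : EuclideanSpace ℝ (Fin d)) (p : ℝ) : (‖y‖ ^ 2) ^ p = ‖y‖ ^ (2 * p) := by
  rw [← rpow_natCast, ← rpow_mul (norm_nonneg _)]; norm_num

/-- The slowly decaying exterior barrier `-|y|^{-1/2} + κ y_ℓ |y|^{-3/2}`. -/
def slowBarrier {d : ℕ} (ℓ : Fin d) : EuclideanSpace ℝ (Fin d) → ℝ :=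
  tiltedRadial ℓ 0 0 (-1) (-1 / 4) (1 / (100 * d)) (-3 / 4)

lemma strictSub_slowBarrier (hd : 3 ≤ d) (h0 : 0 ≤ η) (hη : 1000 * (d : ℝ) ^ 2 * η ≤ 1) (hy : y ≠ 0) :
    StrictSub ℓ η (slowBarrier ℓ) y := by
  have hd' : (3 : ℝ) ≤ d := by exact_mod_cast hd
  have hdη : 1000 * d * η ≤ 1 / 3 := by nlinarith
  have h1 : η ≤ 1 / 9000 := by nlinarith
  have hn := norm_pos_iff.2 hy
  refine strictSub_tiltedRadial h0 hy (fun ξ hξ => ?_) ?_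
  · have e1 := abs_radialOp_sub (by linarith) hξ hy (-1 / 4)
    have e2 := abs_tiltOp_le (ℓ := ℓ) (by linarith) (by linarith) hξ hy (-3 / 4)
    have e3 : (‖y‖ ^ 2) ^ ((-1 / 4 : ℝ) - 1) = ‖y‖ * (‖y‖ ^ 2) ^ ((-3 / 4 : ℝ) - 1) := by
      rw [norm_sq_rpow, norm_sq_rpow, ← rpow_one_add' hn.le (by norm_num)]; norm_num
    have hP : 0 < ‖y‖ * (‖y‖ ^ 2) ^ ((-3 / 4 : ℝ) - 1) := mul_pos hn (rpow_pos_of_pos (by positivity) _)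
    rw [e3] at e1
    rw [mul_assoc (_ * _) ‖y‖] at e2
    set P := ‖y‖ * (‖y‖ ^ 2) ^ ((-3 / 4 : ℝ) - 1)
    norm_num [abs_of_neg] at e1 e2
    have e4 := (abs_le.1 e1).2
    have e5 := (abs_le.1 e2).1
    have e6 : (1 / (100 * d) : ℝ) * (3 / 4 * (2 * d + 9 + 21 / 2) * P) ≤ (1 / 10) * P := by
      have : (1 / (100 * d) : ℝ) * (3 / 4 * (2 * d + 9 + 21 / 2)) ≤ 1 / 10 := by
        rw [one_div, inv_mul_le_iff₀ (by positivity)]; linarith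
      nlinarith
    have e7 := mul_le_mul_of_nonneg_left e5 (by positivity : 0 ≤ (1 / (100 * d) : ℝ))
    have e8 : 3 * d * η * P ≤ (1 / 1000) * P := by nlinarith
    nlinarith
  · have e3 : (‖y‖ ^ 2) ^ (-3 / 4 : ℝ) = ‖y‖ * (‖y‖ ^ 2) ^ ((-1 / 4 : ℝ) - 1) := by
      rw [norm_sq_rpow, norm_sq_rpow, ← rpow_one_add' hn.le (by norm_num)]; norm_num
    have hP : 0 < ‖y‖ * (‖y‖ ^ 2) ^ ((-1 / 4 : ℝ) - 1) := mul_pos hn (rpow_pos_of_pos (by positivity) _)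
    rw [e3]
    set P := ‖y‖ * (‖y‖ ^ 2) ^ ((-1 / 4 : ℝ) - 1)
    have e5 : η * d / 2 < 1 / (100 * d) := by
      rw [lt_div_iff₀ (by positivity)]; nlinarith
    have := mul_lt_mul_of_pos_right e5 hP
    refine lt_of_eq_of_lt ?_ this
    norm_num [P]; ring

lemma slowBarrier_bounds (hd : 3 ≤ d) (h1 : 0 ≤ y ℓ) (hy : y ≠ 0) :
    - ‖y‖ ^ (-1 / 2 : ℝ) ≤ slowBarrier ℓ y ∧
      slowBarrier ℓ y ≤ - ((299 / 300) * ‖y‖ ^ (-1 / 2 : ℝ)) := by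
  have hd' : (3 : ℝ) ≤ d := by exact_mod_cast hd
  have hn := norm_pos_iff.2 hy
  have e1 : (‖y‖ ^ 2) ^ (-1 / 4 : ℝ) = ‖y‖ ^ (-1 / 2 : ℝ) := by rw [norm_sq_rpow]; norm_num
  have e2 : ‖y‖ * (‖y‖ ^ 2) ^ (-3 / 4 : ℝ) = ‖y‖ ^ (-1 / 2 : ℝ) := by
    rw [norm_sq_rpow, ← rpow_one_add' hn.le (by norm_num)]; norm_num
  have e3 : 0 < (‖y‖ ^ 2) ^ (-3 / 4 : ℝ) := rpow_pos_of_pos (by positivity) _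
  have e4 : y ℓ ≤ ‖y‖ := (le_abs_self _).trans (PiLp.norm_apply_le y ℓ)
  have e5 : y ℓ * (‖y‖ ^ 2) ^ (-3 / 4 : ℝ) ≤ ‖y‖ ^ (-1 / 2 : ℝ) :=
    (mul_le_mul_of_nonneg_right e4 e3.le).trans_eq e2
  have e6 : 0 ≤ y ℓ * (‖y‖ ^ 2) ^ (-3 / 4 : ℝ) := mul_nonneg h1 e3.le
  have e7 : (1 / (100 * d) : ℝ) ≤ 1 / 300 := one_div_le_one_div_of_le (by norm_num) (by linarith)
  have e8 : 0 ≤ (1 / (100 * d) : ℝ) := by positivity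
  have e9 : 0 < ‖y‖ ^ (-1 / 2 : ℝ) := rpow_pos_of_pos hn _
  simp only [slowBarrier, tiltedRadial, e1, zero_mul, zero_add]
  constructor
  · nlinarith [mul_nonneg e8 e6]
  · nlinarith [mul_le_mul e7 e5 e6 (by norm_num)]

end Barriers

/-- The exterior barrier `-2|y|^{2-d} + |y|^{3/2-d} + κ y_ℓ |y|^{1/2-d}`. -/
def fastBarrier {d : ℕ} (ℓ : Fin d) : EuclideanSpace ℝ (Fin d) → ℝ :=
  tiltedRadial ℓ (-2) (1 - d / 2) 1 (3 / 4 - d / 2) (1 / (100 * d ^ 2)) (1 / 4 - d / 2)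

/-- Numerical bounds on the error terms of the fast barrier. -/
lemma fastBarrier_numerics {d η s : ℝ} (hd : 3 ≤ d) (h0 : 0 ≤ η) (hs : 1 ≤ s)
    (g : 1000 * d ^ 4 * (η * s) ≤ 1) :
    (d / 2 - 1) * (2 + 4 * (d / 2)) * (3 * d * η) * s ≤ 1 / 100 ∧
    (d / 2 - 3 / 4) * (2 + 4 * (d / 2 + 1 / 4)) * (3 * d * η) ≤ 1 / 100 ∧
    1 / (100 * d ^ 2) * ((d / 2 - 1 / 4) * (2 * d + 9 + 6 * (d / 2 + 3 / 4))) ≤ 1 / 10 ∧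
    η * d * (2 * (2 * (d / 2 - 1) * s + (d / 2 - 3 / 4))) < 1 / (100 * d ^ 2) := by
  have hdp : 0 < d := by linarith
  have gη : η ≤ η * s := le_mul_of_one_le_right h0 hs
  have hηs : 0 ≤ η * s := h0.trans gη
  have g3 : 3000 * d ^ 3 * (η * s) ≤ 1 := by
    have : 0 ≤ d ^ 3 * (η * s) := by positivity
    nlinarith only [this, g, hd]
  have g3' : d ^ 3 * η ≤ d ^ 3 * (η * s) := mul_le_mul_of_nonneg_left gη (by positivity)
  refine ⟨?_, ?_, ?_, ?_⟩
  · have h1 : (d / 2 - 1) * (2 + 4 * (d / 2)) ≤ d ^ 2 := by nlinarith only [hd]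
    have h2 := mul_le_mul_of_nonneg_right h1 (by positivity : 0 ≤ 3 * d * (η * s))
    linarith only [h2, g3]
  · have h1 : (d / 2 - 3 / 4) * (2 + 4 * (d / 2 + 1 / 4)) ≤ d ^ 2 := by nlinarith only [hd]
    have h2 := mul_le_mul_of_nonneg_right h1 (by positivity : 0 ≤ 3 * d * η)
    linarith only [h2, g3, g3']
  · rw [one_div, inv_mul_le_iff₀ (by positivity)]; nlinarith only [hd]
  · rw [lt_div_iff₀ (by positivity)]
    have h3 : 0 ≤ d * (η * s) := by positivity
    have h4 : 0 ≤ d * η := by positivity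
    have h1 : η * d * (2 * (2 * (d / 2 - 1) * s + (d / 2 - 3 / 4))) ≤ 3 * d ^ 2 * (η * s) := by
      have := mul_le_mul_of_nonneg_left gη (by positivity : 0 ≤ d ^ 2)
      linarith only [this, h3, h4]
    have h2 := mul_le_mul_of_nonneg_right h1 (by positivity : 0 ≤ 100 * d ^ 2)
    have h5 : 0 ≤ d ^ 4 * (η * s) := by positivity
    linarith only [h2, g, h5]

section FastBarrier

variable {d : ℕ} {ℓ : Fin d} {η : ℝ} {y : EuclideanSpace ℝ (Fin d)}

lemma strictSub_fastBarrier (hd : 3 ≤ d) (h0 : 0 ≤ η) (hy : 1 ≤ ‖y‖)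
    (hη : 1000 * (d : ℝ) ^ 4 * (η * ‖y‖ ^ (1 / 2 : ℝ)) ≤ 1) :
    StrictSub ℓ η (fastBarrier ℓ) y := by
  have hd' : (3 : ℝ) ≤ d := by exact_mod_cast hd
  have hn : 0 < ‖y‖ := by linarith
  have hy0 : y ≠ 0 := norm_pos_iff.1 hn
  have hs1 : 1 ≤ ‖y‖ ^ (1 / 2 : ℝ) := one_le_rpow hy (by norm_num)
  set s := ‖y‖ ^ (1 / 2 : ℝ) with hs
  have hηs : 0 ≤ η * s := mul_nonneg h0 (by linarith)
  have g3 : 3000 * (d : ℝ) ^ 3 * (η * s) ≤ 1 := by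
    have : 0 ≤ (d : ℝ) ^ 3 * (η * s) := by positivity
    nlinarith
  have g2 : 9000 * (d : ℝ) ^ 2 * (η * s) ≤ 1 := by
    have : 0 ≤ (d : ℝ) ^ 2 * (η * s) := by positivity
    nlinarith
  have g1 : 27000 * (d : ℝ) * (η * s) ≤ 1 := by
    have : 0 ≤ (d : ℝ) * (η * s) := by positivity
    nlinarith
  have gη : η ≤ η * s := le_mul_of_one_le_right h0 hs1
  have g1' : 27000 * (d : ℝ) * η ≤ 1 := (mul_le_mul_of_nonneg_left gη (by positivity)).trans g1
  have g0 : η ≤ 1 / 81000 := by nlinarith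
  obtain ⟨n1, n2, n3, n4⟩ := fastBarrier_numerics hd' h0 hs1 hη
  refine strictSub_tiltedRadial h0 hy0 (fun ξ hξ => ?_) ?_
  · have e1 := abs_radialOp_sub (by linarith) hξ hy0 (1 - d / 2)
    have e1' := abs_radialOp_sub (by linarith) hξ hy0 (3 / 4 - d / 2)
    have e2 := abs_tiltOp_le (ℓ := ℓ) (by linarith) (by linarith) hξ hy0 (1 / 4 - d / 2)
    have e3 : (‖y‖ ^ 2) ^ ((1 - d / 2 : ℝ) - 1) = s * (‖y‖ ^ 2) ^ ((3 / 4 - d / 2 : ℝ) - 1) := by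
      rw [norm_sq_rpow, norm_sq_rpow, hs, ← rpow_add hn]; congr 1; ring
    have e4 : ‖y‖ * (‖y‖ ^ 2) ^ ((1 / 4 - d / 2 : ℝ) - 1) = (‖y‖ ^ 2) ^ ((3 / 4 - d / 2 : ℝ) - 1) := by
      rw [norm_sq_rpow, norm_sq_rpow, ← rpow_one_add' hn.le (by linarith)]; congr 1; ring
    have hP : 0 < (‖y‖ ^ 2) ^ ((3 / 4 - d / 2 : ℝ) - 1) := rpow_pos_of_pos (by positivity) _
    rw [e3] at e1
    rw [mul_assoc (_ * _) ‖y‖, e4] at e2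
    set P := (‖y‖ ^ 2) ^ ((3 / 4 - d / 2 : ℝ) - 1)
    have a1 : |1 - (d : ℝ) / 2| = d / 2 - 1 := by rw [abs_of_neg (by linarith)]; ring
    have a2 : |1 - (d : ℝ) / 2 - 1| = d / 2 := by rw [abs_of_neg (by linarith)]; ring
    have a3 : |3 / 4 - (d : ℝ) / 2| = d / 2 - 3 / 4 := by rw [abs_of_neg (by linarith)]; ring
    have a4 : |3 / 4 - (d : ℝ) / 2 - 1| = d / 2 + 1 / 4 := by rw [abs_of_neg (by linarith)]; ring
    have a5 : |1 / 4 - (d : ℝ) / 2| = d / 2 - 1 / 4 := by rw [abs_of_neg (by linarith)]; ring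
    have a6 : |1 / 4 - (d : ℝ) / 2 - 1| = d / 2 + 3 / 4 := by rw [abs_of_neg (by linarith)]; ring
    rw [a1, a2] at e1
    rw [a3, a4] at e1'
    rw [a5, a6] at e2
    have f1 := (abs_le.1 e1).2
    have f2 := (abs_le.1 e1').1
    have f3 := (abs_le.1 e2).1
    have k1 := mul_le_mul_of_nonneg_right n1 hP.le
    have k2 := mul_le_mul_of_nonneg_right n2 hP.le
    have k3 := mul_le_mul_of_nonneg_right n3 hP.le
    have k4 := mul_le_mul_of_nonneg_left f3 (by positivity : 0 ≤ (1 / (100 * d ^ 2) : ℝ))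
    have k5 : 2 * (3 / 4 - (d : ℝ) / 2) * (d + 2 * (3 / 4 - d / 2) - 2) * P ≥ (3 / 4) * P := by
      have : 2 * (3 / 4 - (d : ℝ) / 2) * (d + 2 * (3 / 4 - d / 2) - 2) ≥ 3 / 4 := by
        nlinarith only [hd']
      exact mul_le_mul_of_nonneg_right this hP.le
    have k6 : 2 * (1 - (d : ℝ) / 2) * (d + 2 * (1 - d / 2) - 2) * (s * P) = 0 := by ring
    rw [k6] at f1
    linarith
  · have e3 : ‖y‖ * (‖y‖ ^ 2) ^ ((1 - d / 2 : ℝ) - 1) = s * (‖y‖ ^ 2) ^ (1 / 4 - d / 2 : ℝ) := by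
      rw [norm_sq_rpow, norm_sq_rpow, hs, ← rpow_add hn, ← rpow_one_add' hn.le (by linarith)]
      congr 1; ring
    have e4 : ‖y‖ * (‖y‖ ^ 2) ^ ((3 / 4 - d / 2 : ℝ) - 1) = (‖y‖ ^ 2) ^ (1 / 4 - d / 2 : ℝ) := by
      rw [norm_sq_rpow, norm_sq_rpow, ← rpow_one_add' hn.le (by linarith)]; congr 1; ring
    have hP : 0 < (‖y‖ ^ 2) ^ (1 / 4 - d / 2 : ℝ) := rpow_pos_of_pos (by positivity) _
    have e5 : ∀ A B X Y : ℝ, η * (d * (2 * ‖y‖ * (A * X + B * Y))) =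
      η * (d * (2 * (A * (‖y‖ * X) + B * (‖y‖ * Y)))) := fun A B X Y => by ring
    rw [e5, e3, e4, abs_of_neg (by norm_num : (-2 : ℝ) < 0), abs_one,
      abs_of_neg (by linarith : 1 - (d : ℝ) / 2 < 0), abs_of_neg (by linarith : 3 / 4 - (d : ℝ) / 2 < 0)]
    set P := (‖y‖ ^ 2) ^ (1 / 4 - d / 2 : ℝ)
    have := mul_lt_mul_of_pos_right n4 hP
    linarith

lemma fastBarrier_bounds (hd : 3 ≤ d) (h1 : 0 ≤ y ℓ) (hy : 2 ≤ ‖y‖) :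
    - (2 * ‖y‖ ^ (2 - d : ℝ)) ≤ fastBarrier ℓ y ∧ fastBarrier ℓ y ≤ - ‖y‖ ^ (2 - d : ℝ) := by
  have hd' : (3 : ℝ) ≤ d := by exact_mod_cast hd
  have hn : 0 < ‖y‖ := by linarith
  set s := ‖y‖ ^ (-1 / 2 : ℝ) with hs
  have e1 : (‖y‖ ^ 2) ^ (1 - d / 2 : ℝ) = ‖y‖ ^ (2 - d : ℝ) := by rw [norm_sq_rpow]; congr 1; ring
  have e2 : (‖y‖ ^ 2) ^ (3 / 4 - d / 2 : ℝ) = s * ‖y‖ ^ (2 - d : ℝ) := by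
    rw [norm_sq_rpow, hs, ← rpow_add hn]; congr 1; ring
  have e3 : ‖y‖ * (‖y‖ ^ 2) ^ (1 / 4 - d / 2 : ℝ) = s * ‖y‖ ^ (2 - d : ℝ) := by
    rw [norm_sq_rpow, hs, ← rpow_add hn, ← rpow_one_add' hn.le (by linarith)]; congr 1; ring
  have hs1 : s ≤ 3 / 4 := by
    have h2 : s ≤ (2 : ℝ) ^ (-1 / 2 : ℝ) := rpow_le_rpow_of_nonpos (by norm_num) hy (by norm_num)
    have h3 : ((2 : ℝ) ^ (-1 / 2 : ℝ)) ^ 2 = 1 / 2 := by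
      rw [← rpow_natCast, ← rpow_mul (by norm_num)]; norm_num
    have h4 : 0 < (2 : ℝ) ^ (-1 / 2 : ℝ) := by positivity
    nlinarith
  have hs0 : 0 < s := rpow_pos_of_pos hn _
  have hQ : 0 < ‖y‖ ^ (2 - d : ℝ) := rpow_pos_of_pos hn _
  have e4 : y ℓ ≤ ‖y‖ := (le_abs_self _).trans (PiLp.norm_apply_le y ℓ)
  have e5 : 0 < (‖y‖ ^ 2) ^ (1 / 4 - d / 2 : ℝ) := rpow_pos_of_pos (by positivity) _
  have e6 : y ℓ * (‖y‖ ^ 2) ^ (1 / 4 - d / 2 : ℝ) ≤ s * ‖y‖ ^ (2 - d : ℝ) :=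
    (mul_le_mul_of_nonneg_right e4 e5.le).trans_eq e3
  have e7 : 0 ≤ y ℓ * (‖y‖ ^ 2) ^ (1 / 4 - d / 2 : ℝ) := mul_nonneg h1 e5.le
  have e8 : (1 / (100 * d ^ 2) : ℝ) ≤ 1 / 300 := one_div_le_one_div_of_le (by norm_num) (by nlinarith)
  have e9 : 0 ≤ (1 / (100 * d ^ 2) : ℝ) := by positivity
  simp only [fastBarrier, tiltedRadial, e1, e2]
  constructor
  · nlinarith [mul_nonneg e9 e7, mul_pos hs0 hQ]
  · nlinarith [mul_le_mul e8 e6 e7 (by norm_num), mul_le_mul_of_nonneg_right hs1 hQ.le]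

/-- The barrier `|y-z|^(-2 d)` used to propagate positivity. -/
lemma strictSub_bump (hd : 3 ≤ d) (h0 : 0 ≤ η) {z : EuclideanSpace ℝ (Fin d)} {r : ℝ} (hr : 0 < r)
    (hη : 1000 * (d : ℝ) ^ 2 * η ≤ 1) (hz : r / 2 ≤ z ℓ) (hy : y ≠ z) (hyr : ‖y - z‖ ≤ 3 * r) :
    StrictSub ℓ η (fun x => (‖x - z‖ ^ 2) ^ (-d : ℝ)) y := by
  have hd' : (3 : ℝ) ≤ d := by exact_mod_cast hd
  have hdη : 1000 * d * η ≤ 1 / 3 := by nlinarith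
  have h1 : η ≤ 1 / 9000 := by nlinarith
  have hn : 0 < ‖y - z‖ := norm_pos_iff.2 (sub_ne_zero.2 hy)
  have hP : 0 < (‖y - z‖ ^ 2) ^ (-d - 1 : ℝ) := rpow_pos_of_pos (by positivity) _
  refine ⟨fun _ ξ hξ => ⟨_, _, fun k => jet_radial hy (-d : ℝ) (ξ k), ?_⟩,
    fun hyl => ⟨_, fun i => (jet_radial hy (-d : ℝ) (EuclideanSpace.single i 1)).hasDerivAt, ?_⟩⟩
  · have e1 := abs_radialOp_sub (by linarith) hξ (sub_ne_zero.2 hy) (-d : ℝ)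
    have e2 := (abs_le.1 e1).1
    rw [abs_of_neg (by linarith : -(d : ℝ) < 0), abs_of_neg (by linarith : -(d : ℝ) - 1 < 0)] at e2
    refine lt_of_lt_of_eq (b := radialOp ξ (-d : ℝ) (y - z)) ?_ ?_
    · set P := (‖y - z‖ ^ 2) ^ (-d - 1 : ℝ)
      have e3 : - -(d : ℝ) * (2 + 4 * -(-d - 1)) * (3 * d * η) ≤ d := by
        have : (2 + 4 * -(-(d : ℝ) - 1)) * (3 * d * η) ≤ 1 := by nlinarith
        nlinarith
      have e4 : 2 * -(d : ℝ) * (d + 2 * -d - 2) ≥ 2 * d := by nlinarith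
      have e5 := mul_le_mul_of_nonneg_right e3 hP.le
      have e6 := mul_le_mul_of_nonneg_right e4 hP.le
      have : 0 < d * P := by positivity
      linarith
    · simp only [Finset.sum_add_distrib, ← Finset.mul_sum, radialOp]
  · set P := (‖y - z‖ ^ 2) ^ (-d - 1 : ℝ)
    simp only [EuclideanSpace.inner_single_right, conj_trivial, one_mul]
    have e1 : (∑ i, if i = ℓ then 0 else |2 * -(d : ℝ) * P * (y - z) i|) ≤ d * (2 * d * P * (3 * r)) := by
      refine (le_abs_self _).trans (abs_sum_le_card_mul fun i => ?_)
      split_ifs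
      · rw [abs_zero]; positivity
      · rw [abs_abs, abs_mul, abs_mul, abs_of_pos hP, abs_of_neg (by linarith : 2 * -(d : ℝ) < 0)]
        have := (PiLp.norm_apply_le (y - z) i).trans hyr
        rw [Real.norm_eq_abs] at this
        have := mul_le_mul_of_nonneg_left this (by positivity : 0 ≤ 2 * d * P)
        linarith
    refine (mul_le_mul_of_nonneg_left e1 h0).trans_lt ?_
    rw [PiLp.sub_apply, hyl]
    have e2 : 3 * d * η * r < z ℓ := by nlinarith
    have := mul_lt_mul_of_pos_left e2 (by positivity : 0 < 2 * d * P)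
    linarith

end FastBarrier

/-! ### Harnack-type propagation of positivity -/

/-- The constant of one Harnack step. -/
def harnackC (d : ℕ) : ℝ := ((25 : ℝ) ^ d)⁻¹ - ((36 : ℝ) ^ d)⁻¹

lemma harnackC_pos {d : ℕ} (hd : 3 ≤ d) : 0 < harnackC d := by
  have : (25 : ℝ) ^ d < 36 ^ d := pow_lt_pow_left₀ (by norm_num) (by norm_num) (by omega)
  exact sub_pos.2 (inv_strictAnti₀ (by positivity) this)

lemma harnackC_le_one {d : ℕ} : harnackC d ≤ 1 := by
  have h1 : ((25 : ℝ) ^ d)⁻¹ ≤ 1 := inv_le_one_of_one_le₀ (one_le_pow₀ (by norm_num))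
  have h2 : 0 < ((36 : ℝ) ^ d)⁻¹ := by positivity
  unfold harnackC; linarith

section Harnack

variable {d : ℕ} {ℓ : Fin d} {η : ℝ} {w : EuclideanSpace ℝ (Fin d) → ℝ}

lemma isCompact_half_ball_diff (z : EuclideanSpace ℝ (Fin d)) (a b : ℝ) :
    IsCompact {x : EuclideanSpace ℝ (Fin d) | 0 ≤ x ℓ ∧ a ≤ ‖x - z‖ ∧ ‖x - z‖ ≤ b} := by
  refine (isCompact_closedBall z b).of_isClosed_subset ?_ fun x hx => by
    simpa [dist_eq_norm] using hx.2.2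
  have h1 : Continuous fun x : EuclideanSpace ℝ (Fin d) => x ℓ := by fun_prop
  have h2 : Continuous fun x : EuclideanSpace ℝ (Fin d) => ‖x - z‖ := by fun_prop
  exact (isClosed_le continuous_const h1).inter
    ((isClosed_le continuous_const h2).inter (isClosed_le h2 continuous_const))

lemma half_ball_diff_mem_nhdsWithin {z y : EuclideanSpace ℝ (Fin d)} {a b : ℝ} (h1 : a < ‖y - z‖)
    (h2 : ‖y - z‖ < b) :
    {x : EuclideanSpace ℝ (Fin d) | 0 ≤ x ℓ ∧ a ≤ ‖x - z‖ ∧ ‖x - z‖ ≤ b} ∈ 𝓝[upHalf ℓ] y := by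
  have hc : ContinuousAt (fun x : EuclideanSpace ℝ (Fin d) => ‖x - z‖) y := by fun_prop
  filter_upwards [nhdsWithin_le_nhds (hc.eventually (lt_mem_nhds h1)),
    nhdsWithin_le_nhds (hc.eventually (gt_mem_nhds h2)), self_mem_nhdsWithin] with x h3 h4 h5
    using ⟨h5, h3.le, h4.le⟩

lemma harnack_step (hd : 3 ≤ d) (h0 : 0 ≤ η) (hη : 1000 * (d : ℝ) ^ 2 * η ≤ 1)
    {p : EuclideanSpace ℝ (Fin d)} {r a : ℝ} (hp : 0 ≤ p ℓ) (hr : 0 < r) (ha0 : 0 ≤ a)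
    (hw : ∀ x, 0 ≤ x ℓ → ‖x - p‖ ≤ 4 * r → ContinuousAt w x ∧ LinAt ℓ η w x ∧ 0 ≤ w x)
    (ha : ∀ x, 0 ≤ x ℓ → ‖x - p‖ ≤ r → a ≤ w x) {y : EuclideanSpace ℝ (Fin d)} (hy : 0 ≤ y ℓ)
    (hyr : ‖y - p‖ ≤ 2 * r) : harnackC d * a ≤ w y := by
  rcases ha0.eq_or_lt with rfl | ha0
  · rw [mul_zero]; exact (hw y hy (by linarith)).2.2
  set z : EuclideanSpace ℝ (Fin d) := p + EuclideanSpace.single ℓ (r / 2) with hz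
  have hzp : ‖z - p‖ = r / 2 := by
    rw [hz, add_sub_cancel_left, PiLp.norm_single, Real.norm_eq_abs, abs_of_pos (by linarith)]
  have hzl : r / 2 ≤ z ℓ := by rw [hz]; simpa using hp
  have t1 : ∀ x, ‖x - p‖ ≤ ‖x - z‖ + r / 2 := fun x => by
    rw [← hzp]; simpa using norm_add_le (x - z) (z - p)
  have t2 : ∀ x, ‖x - z‖ ≤ ‖x - p‖ + r / 2 := fun x => by
    rw [← hzp, norm_sub_rev z p]; simpa using norm_add_le (x - p) (p - z)
  by_cases hyz : ‖y - z‖ ≤ r / 2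
  · have := ha y hy ((t1 y).trans (by linarith))
    nlinarith [harnackC_le_one (d := d)]
  push Not at hyz
  set A := a * ((r / 2) ^ 2) ^ d with hA
  have hA0 : 0 < A := by positivity
  set φ : EuclideanSpace ℝ (Fin d) → ℝ :=
    fun x => A * (‖x - z‖ ^ 2) ^ (-d : ℝ) + - (A * ((3 * r) ^ 2) ^ (-d : ℝ)) with hφ
  have hpow : ∀ t : ℝ, (t ^ 2) ^ (-d : ℝ) = ((t ^ 2) ^ d)⁻¹ := fun t => by
    rw [rpow_neg (by positivity), rpow_natCast]
  have hcomp := comparison (ℓ := ℓ) (w := w) (φ := φ) (isCompact_half_ball_diff (ℓ := ℓ) z (r / 2) (3 * r))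
    (fun x hx => (hw x hx.1 ((t1 x).trans (by linarith [hx.2.2]))).1.continuousWithinAt) ?_ ?_ y
    ⟨hy, hyz.le, (t2 y).trans (by linarith)⟩
  · refine le_trans ?_ hcomp
    have h1 : ‖y - z‖ ≤ 5 / 2 * r := (t2 y).trans (by linarith)
    have h2 : ((‖y - z‖ ^ 2) ^ d)⁻¹ ≥ (((5 / 2 * r) ^ 2) ^ d)⁻¹ := by
      have : 0 < ‖y - z‖ := by linarith
      gcongr
    have h3 : harnackC d * a = A * (((5 / 2 * r) ^ 2) ^ d)⁻¹ - A * (((3 * r) ^ 2) ^ d)⁻¹ := by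
      have e1 : ((5 / 2 * r) ^ 2) ^ d = 25 ^ d * ((r / 2) ^ 2) ^ d := by rw [← mul_pow]; ring_nf
      have e2 : ((3 * r) ^ 2) ^ d = 36 ^ d * ((r / 2) ^ 2) ^ d := by rw [← mul_pow]; ring_nf
      have e3 : 0 < ((r / 2) ^ 2) ^ d := by positivity
      rw [e1, e2, hA, harnackC]
      field_simp
    simp only [hφ, hpow]
    rw [h3]
    have := mul_le_mul_of_nonneg_left h2 hA0.le
    linarith
  · refine fun x hx => ContinuousAt.continuousWithinAt ?_
    have hx0 : ‖x - z‖ ^ 2 ≠ 0 := by have : 0 < ‖x - z‖ := by linarith [hx.2.1]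
                                     positivity
    exact (continuousAt_const.mul (ContinuousAt.rpow_const
      (by fun_prop : ContinuousAt (fun x => ‖x - z‖ ^ 2) x) (Or.inl hx0))).add
      continuousAt_const
  · rintro x ⟨hx1, hx2, hx3⟩
    rcases hx2.eq_or_lt with h | hx2
    · left
      have : A * ((‖x - z‖ ^ 2) ^ d)⁻¹ = a := by
        rw [← h, hA, mul_assoc, mul_inv_cancel₀ (by positivity), mul_one]
      have h' := ha x hx1 ((t1 x).trans (by linarith))
      have : 0 ≤ A * (((3 * r) ^ 2) ^ d)⁻¹ := by positivity
      simp only [hφ, hpow]; linarith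
    rcases hx3.eq_or_lt with h | hx3
    · left
      have h' := (hw x hx1 ((t1 x).trans (by linarith))).2.2
      simp only [hφ, h]; linarith
    · right
      refine ⟨hx1, half_ball_diff_mem_nhdsWithin hx2 hx3, η,
        (hw x hx1 ((t1 x).trans (by linarith))).2.1, ?_⟩
      refine ((strictSub_bump hd h0 hr hη hzl ?_ hx3.le).const_mul hA0).add_const _
      rintro rfl
      simp at hx2; linarith

/-- Positivity propagates along segments. -/
lemma harnack_segment (hd : 3 ≤ d) (h0 : 0 ≤ η) (hη : 1000 * (d : ℝ) ^ 2 * η ≤ 1)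
    {p q : EuclideanSpace ℝ (Fin d)} {r a : ℝ} (hr : 0 < r) (ha0 : 0 ≤ a) {n : ℕ}
    (hpq : ‖q - p‖ ≤ n * r) (hp : 0 ≤ p ℓ) (hq : 0 ≤ q ℓ)
    (hw : ∀ t : ℝ, 0 ≤ t → t ≤ 1 → ∀ x, 0 ≤ x ℓ → ‖x - (p + t • (q - p))‖ ≤ 4 * r →
      ContinuousAt w x ∧ LinAt ℓ η w x ∧ 0 ≤ w x)
    (ha : ∀ x, 0 ≤ x ℓ → ‖x - p‖ ≤ r → a ≤ w x) :
    ∀ x, 0 ≤ x ℓ → ‖x - q‖ ≤ r → harnackC d ^ n * a ≤ w x := by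
  rcases n.eq_zero_or_pos with rfl | hn
  · have : q - p = 0 := by simpa using hpq
    rw [sub_eq_zero.1 this]; simpa using ha
  have hn' : (0 : ℝ) < n := by exact_mod_cast hn
  have key : ∀ k : ℕ, k ≤ n → ∀ x, 0 ≤ x ℓ → ‖x - (p + ((k : ℝ) / n) • (q - p))‖ ≤ r →
      harnackC d ^ k * a ≤ w x := by
    intro k
    induction k with
    | zero => intro _ x hx h; simpa using ha x hx (by simpa using h)
    | succ k ih =>
      intro hk x hx h
      have hk' : (k : ℝ) / n ≤ 1 := by rw [div_le_one hn']; exact_mod_cast (by omega : k ≤ n)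
      have hk0 : 0 ≤ (k : ℝ) / n := by positivity
      rw [pow_succ', mul_assoc]
      refine harnack_step hd h0 hη (p := p + ((k : ℝ) / n) • (q - p)) ?_ hr
        (mul_nonneg (pow_nonneg (harnackC_pos hd).le _) ha0) (hw _ hk0 hk') (ih (by omega)) hx ?_
      · simp only [PiLp.add_apply, PiLp.smul_apply, PiLp.sub_apply, smul_eq_mul]
        nlinarith
      · have e : x - (p + ((k : ℝ) / n) • (q - p)) =
            (x - (p + (((k + 1 : ℕ) : ℝ) / n) • (q - p))) + (1 / n : ℝ) • (q - p) := by
          push_cast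
          rw [add_div, add_smul]; abel
        rw [e]
        refine (norm_add_le _ _).trans ?_
        have : ‖(1 / n : ℝ) • (q - p)‖ ≤ r := by
          rw [norm_smul, Real.norm_eq_abs, abs_of_pos (by positivity), one_div,
            inv_mul_le_iff₀ hn']; exact hpq
        linarith
  have := key n le_rfl
  rw [div_self hn'.ne', one_smul, add_sub_cancel] at this
  exact this

lemma harnack_sphere (hd : 3 ≤ d) (h0 : 0 ≤ η) (hη : 1000 * (d : ℝ) ^ 2 * η ≤ 1) {R a : ℝ}
    (hR : 0 < R) (ha0 : 0 ≤ a) {p : EuclideanSpace ℝ (Fin d)} (hp : 0 ≤ p ℓ) (hpR : ‖p‖ = R)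
    (hw : ∀ x, 0 ≤ x ℓ → R / 4 ≤ ‖x‖ → ContinuousAt w x ∧ LinAt ℓ η w x ∧ 0 ≤ w x) {j : ℕ}
    (ha : ∀ x, 0 ≤ x ℓ → ‖x - p‖ ≤ R / 16 / 2 ^ j → a ≤ w x) {y : EuclideanSpace ℝ (Fin d)}
    (hy : 0 ≤ y ℓ) (hyR : ‖y‖ = R) : harnackC d ^ (64 + j) * a ≤ w y := by
  have hc := (harnackC_pos hd).le
  have near : ∀ q : EuclideanSpace ℝ (Fin d), R ≤ ‖q‖ → ∀ s ≤ R / 16, ∀ x, 0 ≤ x ℓ → ‖x - q‖ ≤ 4 * s →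
      ContinuousAt w x ∧ LinAt ℓ η w x ∧ 0 ≤ w x := fun q hq s hs x hx h => by
    refine hw x hx ?_
    have := norm_sub_norm_le q x
    rw [norm_sub_rev] at this
    linarith
  have up : ∀ i ≤ j, ∀ x, 0 ≤ x ℓ → ‖x - p‖ ≤ 2 ^ i * (R / 16 / 2 ^ j) → harnackC d ^ i * a ≤ w x := by
    intro i
    induction i with
    | zero => intro _ x hx h; simpa using ha x hx (by simpa using h)
    | succ i ih =>
      intro hi x hx h
      rw [pow_succ', mul_assoc]
      refine harnack_step hd h0 hη hp (r := 2 ^ i * (R / 16 / 2 ^ j)) (by positivity) (by positivity)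
        (near p hpR.ge _ ?_) (ih (by omega)) hx (h.trans_eq (by ring))
      rw [mul_div_assoc', div_le_iff₀ (by positivity), mul_comm]
      gcongr
      · norm_num
      · omega
  have start := up j le_rfl
  rw [mul_div_cancel₀ _ (by positivity)] at start
  set e : EuclideanSpace ℝ (Fin d) := EuclideanSpace.single ℓ R with he
  have hen : ‖e‖ = R := by rw [he, PiLp.norm_single, Real.norm_eq_abs, abs_of_pos hR]
  have hel : e ℓ = R := by simp [he]
  have vert : ∀ q : EuclideanSpace ℝ (Fin d), 0 ≤ q ℓ → ‖q‖ = R → ∀ t : ℝ, 0 ≤ t → R ≤ ‖q + t • e‖ := by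
    intro q hq hqR t ht
    refine le_of_sq_le_sq ?_ (norm_nonneg _)
    rw [norm_add_sq_real, hqR, inner_smul_right, he, EuclideanSpace.inner_single_right]
    simp only [conj_trivial]
    have : 0 ≤ t * (R * q ℓ) := by positivity
    nlinarith [sq_nonneg ‖t • (EuclideanSpace.single ℓ R : EuclideanSpace ℝ (Fin d))‖]
  have coord : ∀ q : EuclideanSpace ℝ (Fin d), R ≤ q ℓ → R ≤ ‖q‖ := fun q h =>
    h.trans ((le_abs_self _).trans (PiLp.norm_apply_le q ℓ))
  have s1 := harnack_segment (w := w) hd h0 hη (p := p) (q := p + e) (r := R / 16) (n := 16) (by positivity)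
    (by positivity) (by rw [add_sub_cancel_left, hen]; norm_num; linarith) hp
    (by rw [PiLp.add_apply, hel]; linarith)
    (fun t ht _ => near _ (by rw [add_sub_cancel_left]; exact vert p hp hpR t ht) _ le_rfl) start
  have s2 := harnack_segment (w := w) hd h0 hη (p := p + e) (q := y + e) (r := R / 16) (n := 32) (by positivity)
    (by positivity) (by
      rw [add_sub_add_right_eq_sub]
      refine (norm_sub_le _ _).trans ?_
      rw [hyR, hpR]; norm_num; linarith) (by rw [PiLp.add_apply, hel]; linarith)
    (by rw [PiLp.add_apply, hel]; linarith)
    (fun t ht ht' => near _ (by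
      apply coord
      simp only [PiLp.add_apply, PiLp.smul_apply, PiLp.sub_apply, smul_eq_mul, hel]
      nlinarith) _ le_rfl) s1
  have s3 := harnack_segment (w := w) hd h0 hη (p := y + e) (q := y) (r := R / 16) (n := 16) (by positivity)
    (by positivity) (by rw [sub_add_cancel_left, norm_neg, hen]; norm_num; linarith)
    (by rw [PiLp.add_apply, hel]; linarith) hy
    (fun t _ ht => near _ (by
      have : y + e + t • (y - (y + e)) = y + (1 - t) • e := by
        rw [sub_add_cancel_left, sub_smul, one_smul, smul_neg]; abel
      rw [this]
      exact vert y hy hyR _ (by linarith)) _ le_rfl) s2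
  have := s3 y hy (by simp; positivity)
  calc harnackC d ^ (64 + j) * a =
      harnackC d ^ 16 * (harnackC d ^ 32 * (harnackC d ^ 16 * (harnackC d ^ j * a))) := by ring
    _ ≤ w y := this

end Harnack

/-! ### Consequences of the Harnack inequality -/

/-- `w` is `± v` up to an additive constant. -/
def IsAff {d : ℕ} (v w : EuclideanSpace ℝ (Fin d) → ℝ) : Prop :=
  ∃ σ k : ℝ, (σ = 1 ∨ σ = -1) ∧ w = fun x => σ * v x + k

section Affine

variable {d : ℕ} {ℓ : Fin d} {η : ℝ} {v w ψ : EuclideanSpace ℝ (Fin d) → ℝ}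
  {y : EuclideanSpace ℝ (Fin d)}

lemma isAff_add_const (c : ℝ) : IsAff v (fun x => v x + c) := ⟨1, c, Or.inl rfl, by simp⟩

lemma isAff_const_sub (c : ℝ) : IsAff v (fun x => c - v x) :=
  ⟨-1, c, Or.inr rfl, by funext x; ring⟩

lemma IsAff.abs_sub_eq (h : IsAff v w) (x y : EuclideanSpace ℝ (Fin d)) :
    |w x - w y| = |v x - v y| := by
  obtain ⟨σ, k, rfl | rfl, rfl⟩ := h
  · simp
  · rw [← abs_neg]; congr 1; ring

lemma IsAff.continuousAt (h : IsAff v w) (hv : SmallSol ℓ η v) (h1 : 0 ≤ y ℓ) (h2 : 1 ≤ ‖y‖) :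
    ContinuousAt w y := by
  obtain ⟨σ, k, -, rfl⟩ := h
  exact (continuousAt_const.mul (hv.contDiffAt h1 h2).continuousAt).add continuousAt_const

lemma IsAff.linAt (h : IsAff v w) (hη : η ≤ 1 / 2) (hv : SmallSol ℓ η v) (h1 : 0 ≤ y ℓ)
    (h2 : 1 ≤ ‖y‖) : LinAt ℓ (2 * ‖fderiv ℝ v y‖) w y := by
  obtain ⟨σ, k, rfl | rfl, rfl⟩ := h
  · simpa using (hv.linAt hη h1 h2).add_const k
  · simpa using (hv.linAt hη h1 h2).neg.add_const k

lemma IsAff.gradient_estimate (h : IsAff v w) (hd : 3 ≤ d) (h0 : 0 ≤ η)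
    (hη : 10000 * (d : ℝ) ^ 4 * η ≤ 1) (hv : SmallSol ℓ η v) (h1 : 0 ≤ y ℓ) (h2 : 2 ≤ ‖y‖) {O : ℝ}
    (hO : ∀ x, 0 ≤ x ℓ → ‖x - y‖ ≤ ‖y‖ / 2 → |w x| ≤ O) : ‖fderiv ℝ v y‖ ≤ 1000 * d * O / ‖y‖ := by
  obtain ⟨σ, k, rfl | rfl, rfl⟩ := h
  · exact _root_.gradient_estimate hd h0 hη hv h1 h2 (s := -k) fun x hx hxy => by
      simpa using hO x hx hxy
  · refine _root_.gradient_estimate hd h0 hη hv h1 h2 (s := k) fun x hx hxy => ?_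
    rw [abs_sub_comm]
    simpa [neg_add_eq_sub] using hO x hx hxy

/-- Comparison with a strict subsolution on a half annulus. -/
lemma IsAff.barrier_annulus (h : IsAff v w) (hη : η ≤ 1 / 2) (hv : SmallSol ℓ η v) {R₁ R₂ B c : ℝ}
    (hR : 1 ≤ R₁) (hB : 0 < B) (hψc : ContinuousOn ψ {0}ᶜ)
    (hψ : ∀ y, 0 ≤ y ℓ → R₁ < ‖y‖ → StrictSub ℓ (2 * ‖fderiv ℝ v y‖) ψ y)
    (h1 : ∀ y, 0 ≤ y ℓ → ‖y‖ = R₁ → B * ψ y + c ≤ w y)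
    (h2 : ∀ y, 0 ≤ y ℓ → ‖y‖ = R₂ → B * ψ y + c ≤ w y) :
    ∀ y, 0 ≤ y ℓ → R₁ ≤ ‖y‖ → ‖y‖ ≤ R₂ → B * ψ y + c ≤ w y := by
  intro y hy hy1 hy2
  have hK := isCompact_half_ball_diff (ℓ := ℓ) 0 R₁ R₂
  have hK2 := fun x : EuclideanSpace ℝ (Fin d) => half_ball_diff_mem_nhdsWithin (ℓ := ℓ) (z := 0) (y := x)
    (a := R₁) (b := R₂)
  simp only [sub_zero] at hK hK2
  refine comparison (ℓ := ℓ) (φ := fun x => B * ψ x + c) hK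
    (fun x hx => (h.continuousAt hv hx.1 (hR.trans hx.2.1)).continuousWithinAt) ?_ ?_ y ⟨hy, hy1, hy2⟩
  · refine (continuousOn_const.mul (hψc.mono fun x hx => ?_)).add continuousOn_const
    rintro rfl
    have := hx.2.1
    rw [norm_zero] at this; linarith
  · rintro x ⟨hx, hx1, hx2⟩
    rcases hx1.eq_or_lt with e | hx1
    · exact Or.inl (h1 x hx e.symm)
    rcases hx2.eq_or_lt with e | hx2
    · exact Or.inl (h2 x hx e)
    · exact Or.inr ⟨hx, hK2 x hx1 hx2, _, h.linAt hη hv hx (hR.trans hx1.le),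
        ((hψ x hx hx1).const_mul hB).add_const c⟩

lemma SmallSol.strictSub_slowBarrier (hd : 3 ≤ d) (hη : 10000 * (d : ℝ) ^ 4 * η ≤ 1)
    (h0 : 0 ≤ η) (hv : SmallSol ℓ η v) (h1 : 0 ≤ y ℓ) (h2 : 1 ≤ ‖y‖) :
    StrictSub ℓ (2 * ‖fderiv ℝ v y‖) (slowBarrier ℓ) y := by
  have hs := hv.small y h1 h2
  obtain ⟨-, -, g2, -, -⟩ := smallness hd h0 hη
  refine _root_.strictSub_slowBarrier hd (by positivity) ?_ fun h => ?_
  · have := mul_le_mul_of_nonneg_left hs (by positivity : 0 ≤ 2000 * (d : ℝ) ^ 2)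
    have : 0 ≤ (d : ℝ) ^ 2 * η := by positivity
    linarith
  · rw [h, norm_zero] at h2; linarith

lemma rpow_neg_half_le_one {r : ℝ} (hr : 1 ≤ r) : r ^ (-1 / 2 : ℝ) ≤ 1 :=
  rpow_le_one_of_one_le_of_nonpos hr (by norm_num)

lemma ne_zero_of_one_le_norm (h : 1 ≤ ‖y‖) : y ≠ 0 := by
  rintro rfl
  rw [norm_zero] at h; linarith

lemma slowBarrier_nonpos (hd : 3 ≤ d) (h1 : 0 ≤ y ℓ) (h2 : 1 ≤ ‖y‖) : slowBarrier ℓ y ≤ 0 := by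
  have := (slowBarrier_bounds hd h1 (ne_zero_of_one_le_norm h2)).2
  have : 0 ≤ ‖y‖ ^ (-1 / 2 : ℝ) := by positivity
  linarith

/-- The minimum principle on half annuli. -/
lemma IsAff.min_principle (h : IsAff v w) (hd : 3 ≤ d) (h0 : 0 ≤ η)
    (hη : 10000 * (d : ℝ) ^ 4 * η ≤ 1) (hv : SmallSol ℓ η v) {R₁ R₂ a : ℝ}
    (hR : 1 ≤ R₁) (h1 : ∀ y, 0 ≤ y ℓ → ‖y‖ = R₁ → a ≤ w y) (h2 : ∀ y, 0 ≤ y ℓ → ‖y‖ = R₂ → a ≤ w y) :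
    ∀ y, 0 ≤ y ℓ → R₁ ≤ ‖y‖ → ‖y‖ ≤ R₂ → a ≤ w y := by
  intro y hy hy1 hy2
  have g := (smallness hd h0 hη).2.2.2.2
  refine le_of_forall_pos_le_add fun ε hε => ?_
  have hR2 : 1 ≤ R₂ := hR.trans (hy1.trans hy2)
  have := h.barrier_annulus (by linarith) hv hR hε (ψ := slowBarrier ℓ) (c := a) (R₂ := R₂)
    continuousOn_tiltedRadial
    (fun x hx hx1 => hv.strictSub_slowBarrier hd hη h0 hx (hR.trans hx1.le))
    (fun x hx hx1 => by nlinarith [h1 x hx hx1, slowBarrier_nonpos hd hx (hR.trans hx1.ge)])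
    (fun x hx hx1 => by nlinarith [h2 x hx hx1, slowBarrier_nonpos hd hx (hR2.trans hx1.ge)]) y hy hy1 hy2
  have hy' := hR.trans hy1
  have := (slowBarrier_bounds hd hy (ne_zero_of_one_le_norm hy')).1
  nlinarith [rpow_neg_half_le_one hy']

/-- Comparison with a barrier in the exterior domain. -/
lemma IsAff.barrier_exterior (h : IsAff v w) (hη : η ≤ 1 / 2) (hv : SmallSol ℓ η v) {R₁ B : ℝ}
    (hR : 1 ≤ R₁) (hB : 0 < B) (hψc : ContinuousOn ψ {0}ᶜ)
    (hψ : ∀ y, 0 ≤ y ℓ → R₁ < ‖y‖ → StrictSub ℓ (2 * ‖fderiv ℝ v y‖) ψ y)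
    (hψ0 : ∀ y, 0 ≤ y ℓ → R₁ ≤ ‖y‖ → ψ y ≤ 0)
    (h1 : ∀ y, 0 ≤ y ℓ → ‖y‖ = R₁ → B * ψ y ≤ w y)
    (h2 : ∀ ε > 0, ∃ R, ∀ y, 0 ≤ y ℓ → R ≤ ‖y‖ → -ε ≤ w y) :
    ∀ y, 0 ≤ y ℓ → R₁ ≤ ‖y‖ → B * ψ y ≤ w y := by
  intro y hy hy1
  refine le_of_forall_pos_le_add fun ε hε => ?_
  obtain ⟨R, hR2⟩ := h2 ε hε
  have := h.barrier_annulus hη hv hR hB hψc hψ (c := -ε) (R₂ := max R ‖y‖)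
    (fun x hx hx1 => by linarith [h1 x hx hx1])
    (fun x hx hx1 => by
      have := hR2 x hx ((le_max_left _ _).trans hx1.ge)
      have := hψ0 x hx (hy1.trans ((le_max_right _ _).trans hx1.ge))
      nlinarith) y hy hy1 (le_max_right _ _)
  linarith

lemma SmallSol.abs_sub_le_of_segment (hv : SmallSol ℓ η v) {p q : EuclideanSpace ℝ (Fin d)} {B : ℝ}
    (h : ∀ t : ℝ, 0 ≤ t → t ≤ 1 → 0 ≤ (p + t • (q - p)) ℓ ∧ 1 ≤ ‖p + t • (q - p)‖ ∧
      ‖fderiv ℝ v (p + t • (q - p))‖ ≤ B) : |v q - v p| ≤ B * ‖q - p‖ := by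
  have hseg : ∀ x ∈ segment ℝ p q, 0 ≤ x ℓ ∧ 1 ≤ ‖x‖ ∧ ‖fderiv ℝ v x‖ ≤ B := by
    intro x hx
    rw [segment_eq_image'] at hx
    obtain ⟨t, ht, rfl⟩ := hx
    exact h t ht.1 ht.2
  have := (convex_segment p q).norm_image_sub_le_of_norm_fderiv_le
    (fun x hx => (hv.contDiffAt (hseg x hx).1 (hseg x hx).2.1).differentiableAt (by simp))
    (fun x hx => (hseg x hx).2.2) (left_mem_segment ℝ p q) (right_mem_segment ℝ p q)
  rwa [Real.norm_eq_abs] at this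

lemma norm_add_single_ge {R t : ℝ} (hy : 0 ≤ y ℓ) (hy1 : R ≤ ‖y‖) (ht : 0 ≤ t) :
    R ≤ ‖y + EuclideanSpace.single ℓ t‖ := by
  refine hy1.trans (le_of_sq_le_sq ?_ (norm_nonneg _))
  rw [norm_add_sq_real, EuclideanSpace.inner_single_right]
  simp only [conj_trivial]
  have : 0 ≤ t * y ℓ := by positivity
  nlinarith [sq_nonneg ‖(EuclideanSpace.single ℓ t : EuclideanSpace ℝ (Fin d))‖]

/-- Linear growth of solutions with small gradient. -/
lemma SmallSol.abs_sub_le (hv : SmallSol ℓ η v) {p q : EuclideanSpace ℝ (Fin d)} (hp : 0 ≤ p ℓ)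
    (hp1 : 1 ≤ ‖p‖) (hq : 0 ≤ q ℓ) (hq1 : 1 ≤ ‖q‖) : |v q - v p| ≤ η * (4 + ‖q - p‖) := by
  set e : EuclideanSpace ℝ (Fin d) := EuclideanSpace.single ℓ 2 with he
  have hen : ‖e‖ = 2 := by rw [he, PiLp.norm_single]; norm_num
  have hsm : ∀ (t : ℝ), t • e = EuclideanSpace.single ℓ (t * 2) := fun t => by
    rw [he]; ext i; by_cases hi : i = ℓ <;> simp [hi]
  have up : ∀ x : EuclideanSpace ℝ (Fin d), 0 ≤ x ℓ → 1 ≤ ‖x‖ → |v (x + e) - v x| ≤ η * 2 := by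
    intro x hx hx1
    have := hv.abs_sub_le_of_segment (p := x) (q := x + e) (B := η) fun t ht _ => by
      rw [add_sub_cancel_left, hsm]
      have h1 : 0 ≤ (x + EuclideanSpace.single ℓ (t * 2)) ℓ := by
        simp; linarith
      have h2 := norm_add_single_ge hx hx1 (by linarith : 0 ≤ t * 2)
      exact ⟨h1, h2, hv.small _ h1 h2⟩
    rwa [add_sub_cancel_left, hen] at this
  have mid : |v (q + e) - v (p + e)| ≤ η * ‖q - p‖ := by
    have := hv.abs_sub_le_of_segment (p := p + e) (q := q + e) (B := η) fun t ht ht1 => by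
      have h1 : 2 ≤ (p + e + t • (q + e - (p + e))) ℓ := by
        simp only [PiLp.add_apply, PiLp.smul_apply, PiLp.sub_apply, smul_eq_mul, he]
        simp
        nlinarith
      have h2 : 1 ≤ ‖p + e + t • (q + e - (p + e))‖ := by
        have := (le_abs_self _).trans (PiLp.norm_apply_le (p + e + t • (q + e - (p + e))) ℓ)
        linarith
      exact ⟨by linarith, h2, hv.small _ (by linarith) h2⟩
    rwa [add_sub_add_right_eq_sub] at this
  have a1 := abs_le.1 (up p hp hp1)
  have a2 := abs_le.1 (up q hq hq1)
  have a3 := abs_le.1 mid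
  rw [abs_le]; constructor <;> linarith

/-- The Harnack inequality at a point where the function almost attains its maximum. -/
lemma IsAff.harnack_point (h : IsAff v w) (hd : 3 ≤ d) (h0 : 0 ≤ η)
    (hη : 10000 * (d : ℝ) ^ 4 * η ≤ 1) (hv : SmallSol ℓ η v) {Λ R : ℝ} {j : ℕ} (hΛ : 0 ≤ Λ)
    (hj : 4000 * d * Λ ≤ 2 ^ j) (hR : 4 ≤ R) {p : EuclideanSpace ℝ (Fin d)} (hp : 0 ≤ p ℓ)
    (hpR : ‖p‖ = R) (hpos : ∀ x, 0 ≤ x ℓ → R / 4 ≤ ‖x‖ → 0 ≤ w x)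
    (hup : ∀ x, 0 ≤ x ℓ → R / 4 ≤ ‖x‖ → ‖x‖ ≤ 2 * R → w x ≤ Λ * w p) (hy : 0 ≤ y ℓ)
    (hyR : ‖y‖ = R) : harnackC d ^ (64 + j) / 2 * w p ≤ w y := by
  obtain ⟨hd', -, g2, -, g0⟩ := smallness hd h0 hη
  have hwp : 0 ≤ w p := hpos p hp (by linarith)
  have h2j : 0 < (2 : ℝ) ^ j := by positivity
  have := harnack_sphere (w := w) (η := 2 * η) hd (by linarith) (by linarith) (by linarith : 0 < R)
    (by linarith : 0 ≤ w p / 2) hp hpR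
    (fun x hx hx1 => ⟨h.continuousAt hv hx (by linarith),
      (h.linAt (by linarith) hv hx (by linarith)).mono (by linarith [hv.small x hx (by linarith)]),
      hpos x hx hx1⟩) (j := j) ?_ hy hyR
  · linarith
  intro x hx hxp
  set D := 2000 * d * (Λ * w p) / R with hD
  have hgrad : ∀ z, 0 ≤ z ℓ → ‖z - p‖ ≤ R / 16 → 1 ≤ ‖z‖ ∧ ‖fderiv ℝ v z‖ ≤ D := by
    intro z hz hzp
    have t1 : ‖p‖ ≤ ‖z‖ + ‖z - p‖ := by rw [norm_sub_rev]; simpa using norm_add_le z (p - z)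
    have t2 : ‖z‖ ≤ ‖p‖ + ‖z - p‖ := by simpa using norm_add_le p (z - p)
    refine ⟨by linarith, (h.gradient_estimate hd h0 hη hv hz (by linarith) (O := Λ * w p) ?_).trans ?_⟩
    · intro x' hx' hxz
      have t3 : ‖z‖ ≤ ‖x'‖ + ‖x' - z‖ := by rw [norm_sub_rev]; simpa using norm_add_le x' (z - x')
      have t4 : ‖x'‖ ≤ ‖z‖ + ‖x' - z‖ := by simpa using norm_add_le z (x' - z)
      rw [abs_of_nonneg (hpos x' hx' (by linarith))]
      exact hup x' hx' (by linarith) (by linarith)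
    · rw [hD, div_le_div_iff₀ (by linarith) (by linarith)]
      have : 0 ≤ d * (Λ * w p) := by positivity
      nlinarith
  have hxp' : ‖x - p‖ ≤ R / 16 := hxp.trans (div_le_self (by linarith) (one_le_pow₀ (by norm_num)))
  have hosc : |v x - v p| ≤ D * ‖x - p‖ := hv.abs_sub_le_of_segment fun t ht ht1 => by
    have h1 : 0 ≤ (p + t • (x - p)) ℓ := by
      simp only [PiLp.add_apply, PiLp.smul_apply, PiLp.sub_apply, smul_eq_mul]
      nlinarith
    have h2 := hgrad _ h1 (by
      rw [add_sub_cancel_left, norm_smul, Real.norm_eq_abs, abs_of_nonneg ht]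
      exact (mul_le_of_le_one_left (norm_nonneg _) ht1).trans hxp')
    exact ⟨h1, h2⟩
  rw [← h.abs_sub_eq] at hosc
  have hD0 : 0 ≤ D := by positivity
  have : D * ‖x - p‖ ≤ w p / 2 := by
    refine (mul_le_mul_of_nonneg_left hxp hD0).trans ?_
    rw [hD, div_mul_div_comm, div_le_div_iff₀ (by positivity) (by norm_num)]
    have := mul_le_mul_of_nonneg_right hj (by positivity : 0 ≤ w p * R)
    have : 0 ≤ 2 ^ j * (w p * R) := by positivity
    linarith
  linarith [(abs_le.1 hosc).1]

end Affine

/-! ### Boundedness, the limit at infinity, and decay -/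

section Limit

variable {d : ℕ} {ℓ : Fin d} {η : ℝ} {v w ψ : EuclideanSpace ℝ (Fin d) → ℝ}
  {y : EuclideanSpace ℝ (Fin d)}

lemma IsAff.barrier_exterior_of_nonneg (h : IsAff v w) (hη : η ≤ 1 / 2) (hv : SmallSol ℓ η v) {R₁ B : ℝ}
    (hR : 1 ≤ R₁) (hB : 0 ≤ B) (hψc : ContinuousOn ψ {0}ᶜ)
    (hψ : ∀ y, 0 ≤ y ℓ → R₁ < ‖y‖ → StrictSub ℓ (2 * ‖fderiv ℝ v y‖) ψ y)
    (hψ0 : ∀ y, 0 ≤ y ℓ → R₁ ≤ ‖y‖ → ψ y ≤ 0)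
    (h1 : ∀ y, 0 ≤ y ℓ → ‖y‖ = R₁ → B * ψ y ≤ w y)
    (h2 : ∀ ε > 0, ∃ R, ∀ y, 0 ≤ y ℓ → R ≤ ‖y‖ → -ε ≤ w y) (hy : 0 ≤ y ℓ) (hy1 : R₁ ≤ ‖y‖) :
    B * ψ y ≤ w y := by
  refine le_of_forall_pos_le_add fun ε hε => ?_
  have hq : 0 < ε / (1 + |ψ y|) := by positivity
  have := h.barrier_exterior hη hv hR (add_pos_of_nonneg_of_pos hB hq) hψc hψ hψ0 (fun x hx hx1 => by
    nlinarith [h1 x hx hx1, hψ0 x hx hx1.ge]) h2 y hy hy1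
  have e : ε / (1 + |ψ y|) * (1 + |ψ y|) = ε := div_mul_cancel₀ _ (by positivity)
  nlinarith [neg_abs_le (ψ y)]

lemma isCompact_half_annulus (a b : ℝ) :
    IsCompact {x : EuclideanSpace ℝ (Fin d) | 0 ≤ x ℓ ∧ a ≤ ‖x‖ ∧ ‖x‖ ≤ b} := by
  simpa using isCompact_half_ball_diff (ℓ := ℓ) 0 a b

lemma norm_single_pos {t : ℝ} (ht : 0 ≤ t) :
    ‖(EuclideanSpace.single ℓ t : EuclideanSpace ℝ (Fin d))‖ = t := by
  rw [PiLp.norm_single, Real.norm_eq_abs, abs_of_nonneg ht]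

/-- If `w ≥ a` on a large half sphere, then `w ≥ a/4` at distance `4`. -/
lemma IsAff.quarter_le (h : IsAff v w) (hd : 3 ≤ d) (h0 : 0 ≤ η)
    (hη : 10000 * (d : ℝ) ^ 4 * η ≤ 1) (hv : SmallSol ℓ η v) {R a : ℝ} (hR : 4 ≤ R) (ha : 0 < a)
    (hpos : ∀ x, 0 ≤ x ℓ → 1 ≤ ‖x‖ → 0 ≤ w x) (hR1 : ∀ x, 0 ≤ x ℓ → ‖x‖ = R → a ≤ w x)
    (hy : 0 ≤ y ℓ) (hy1 : ‖y‖ = 4) : a / 4 ≤ w y := by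
  have g := (smallness hd h0 hη).2.2.2.2
  have := h.barrier_annulus (by linarith) hv le_rfl ha (ψ := slowBarrier ℓ) (c := a * (299 / 300)) (R₂ := R)
    continuousOn_tiltedRadial
    (fun x hx hx1 => hv.strictSub_slowBarrier hd hη h0 hx hx1.le)
    (fun x hx hx1 => by
      have h2 := (slowBarrier_bounds hd hx (ne_zero_of_one_le_norm hx1.ge)).2
      rw [hx1, one_rpow] at h2
      have := hpos x hx hx1.ge
      nlinarith)
    (fun x hx hx1 => by
      have := slowBarrier_nonpos hd hx (by linarith : 1 ≤ ‖x‖)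
      have := hR1 x hx hx1
      nlinarith) y hy (by linarith) (by linarith)
  have h2 := (slowBarrier_bounds hd hy (ne_zero_of_one_le_norm (by linarith))).1
  have h3 : ‖y‖ ^ (-1 / 2 : ℝ) = 1 / 2 := by
    rw [hy1, show (4 : ℝ) = 2 ^ (2 : ℝ) by norm_num, ← rpow_mul (by norm_num)]
    norm_num [rpow_neg_one]
  rw [h3] at h2
  nlinarith

lemma IsAff.exists_upper_bound (h : IsAff v w) (hd : 3 ≤ d) (h0 : 0 ≤ η)
    (hη : 10000 * (d : ℝ) ^ 4 * η ≤ 1) (hv : SmallSol ℓ η v)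
    (hpos : ∀ x, 0 ≤ x ℓ → 1 ≤ ‖x‖ → 0 ≤ w x) :
    ∃ T, ∀ x, 0 ≤ x ℓ → 1 ≤ ‖x‖ → w x ≤ T := by
  have g := (smallness hd h0 hη).2.2.2.2
  obtain ⟨M₁, hM₁⟩ := (isCompact_half_annulus (ℓ := ℓ) 1 8).exists_bound_of_continuousOn (f := w)
    fun x hx => (h.continuousAt hv hx.1 hx.2.1).continuousWithinAt
  obtain ⟨j, hj⟩ := pow_unbounded_of_one_lt (4000 * (d : ℝ) * 4) (one_lt_two)
  set c₁ := harnackC d ^ (64 + j) / 2 with hc₁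
  have hc₁0 : 0 < c₁ := by have := harnackC_pos hd; positivity
  set e : EuclideanSpace ℝ (Fin d) := EuclideanSpace.single ℓ 4 with he
  have hen : ‖e‖ = 4 := norm_single_pos (by norm_num)
  have hel : 0 ≤ e ℓ := by simp [he]
  refine ⟨max M₁ (4 * w e / c₁ + 1), fun y hy hy1 => ?_⟩
  by_contra! hlt
  have hw1 : M₁ < w y := (le_max_left _ _).trans_lt hlt
  have hw2 : 4 * w e / c₁ + 1 < w y := (le_max_right _ _).trans_lt hlt
  have hy8 : 8 < ‖y‖ := by
    by_contra! h8
    have := hM₁ y ⟨hy, hy1, h8⟩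
    rw [Real.norm_eq_abs] at this
    linarith [le_abs_self (w y)]
  have hwe : 0 ≤ w e := hpos e hel (by linarith)
  have hwy : 0 < w y := lt_trans (by positivity) hw2
  obtain ⟨p, hp, hpy, hmax⟩ : ∃ p : EuclideanSpace ℝ (Fin d), 0 ≤ p ℓ ∧ ‖y‖ ≤ ‖p‖ ∧
      ∀ x, 0 ≤ x ℓ → ‖y‖ ≤ ‖x‖ → w x / ‖x‖ ^ 2 ≤ w p / ‖p‖ ^ 2 := by
    set δ := w y / ‖y‖ ^ 2 with hδ
    have hδ0 : 0 < δ := by positivity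
    set A := w y + 4 + ‖y‖ with hA
    set R₁ := max ‖y‖ ((A + 1) / δ) with hR₁
    obtain ⟨p, hp, hmax⟩ := (isCompact_half_annulus (ℓ := ℓ) ‖y‖ R₁).exists_isMaxOn
      ⟨y, hy, le_rfl, le_max_left _ _⟩ (f := fun x => w x / ‖x‖ ^ 2) fun x hx => by
        have hx1 : 1 ≤ ‖x‖ := hy1.trans hx.2.1
        refine ((h.continuousAt hv hx.1 hx1).div (by fun_prop) ?_).continuousWithinAt
        positivity
    refine ⟨p, hp.1, hp.2.1, fun x hx hx1 => ?_⟩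
    by_cases hxR : ‖x‖ ≤ R₁
    · exact hmax ⟨hx, hx1, hxR⟩
    push Not at hxR
    refine le_trans ?_ (hmax (show y ∈ _ from ⟨hy, le_rfl, le_max_left _ _⟩))
    have h1 : (A + 1) / δ ≤ ‖x‖ := (le_max_right _ _).trans hxR.le
    rw [div_le_iff₀ hδ0] at h1
    have hx0 : 1 ≤ ‖x‖ := hy1.trans hx1
    change w x / ‖x‖ ^ 2 ≤ δ
    rw [div_le_iff₀ (by positivity)]
    have h2 := hv.abs_sub_le hy hy1 hx hx0
    rw [← h.abs_sub_eq] at h2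
    have h3 := norm_sub_le x y
    have h4 : η * (4 + ‖x - y‖) ≤ 1 * (4 + ‖x - y‖) :=
      mul_le_mul_of_nonneg_right (by linarith) (by positivity)
    have h5 : w x ≤ A + ‖x‖ := by linarith [le_abs_self (w x - w y)]
    have hA0 : 0 ≤ A := by positivity
    nlinarith
  set R := ‖p‖ with hR
  have hR8 : 8 < R := hy8.trans_le hpy
  have hwp : w y ≤ w p := by
    have h1 := hmax y hy le_rfl
    rw [div_le_div_iff₀ (by positivity) (by positivity)] at h1
    have h2 : ‖y‖ ^ 2 ≤ R ^ 2 := by gcongr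
    have h3 := hpos p hp (by linarith)
    have h4 := mul_le_mul_of_nonneg_left h2 h3
    exact le_of_mul_le_mul_right (h1.trans h4) (by positivity)
  have hfar : ∀ x, 0 ≤ x ℓ → ‖y‖ ≤ ‖x‖ → ‖x‖ ≤ 2 * R → w x ≤ 4 * w p := by
    intro x hx hx1 hx2
    have h1 := hmax x hx hx1
    rw [div_le_div_iff₀ (by have := hy1.trans hx1; positivity) (by positivity)] at h1
    have h2 : ‖x‖ ^ 2 ≤ (2 * R) ^ 2 := by gcongr
    have h3 := mul_le_mul_of_nonneg_left h2 (hwy.le.trans hwp)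
    refine le_of_mul_le_mul_right (h1.trans (h3.trans_eq ?_)) (by positivity : 0 < R ^ 2)
    ring
  have hnear : ∀ x, 0 ≤ x ℓ → 1 ≤ ‖x‖ → ‖x‖ ≤ ‖y‖ → w x ≤ w p := by
    intro x hx hx1 hx2
    obtain ⟨σ, k, hσ, hw⟩ := id h
    have hneg : IsAff v (fun x => - w x) := ⟨-σ, -k, by
      rcases hσ with rfl | rfl <;> simp, by funext x; rw [hw]; ring⟩
    have := hneg.min_principle hd h0 hη hv (a := - w p) le_rfl (R₂ := ‖y‖)
      (fun z hz hz1 => by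
        have := hM₁ z ⟨hz, hz1.ge, by linarith⟩
        rw [Real.norm_eq_abs] at this
        linarith [le_abs_self (w z)])
      (fun z hz hz1 => by
        have h1 := hmax z hz hz1.ge
        rw [hz1, div_le_div_iff₀ (by positivity) (by positivity)] at h1
        have h2 : ‖y‖ ^ 2 ≤ R ^ 2 := by gcongr
        have h4 := mul_le_mul_of_nonneg_left h2 (hwy.le.trans hwp)
        have := le_of_mul_le_mul_right (h1.trans h4) (by positivity)
        linarith) x hx hx1 hx2
    linarith
  have hsph : ∀ x, 0 ≤ x ℓ → ‖x‖ = R → c₁ * w p ≤ w x := fun x hx hx1 =>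
    h.harnack_point hd h0 hη hv (Λ := 4) (by norm_num) hj.le (by linarith) hp rfl
      (fun x hx hx1 => hpos x hx (by linarith)) (fun x hx hx1 hx2 => by
        rcases le_total ‖x‖ ‖y‖ with h1 | h1
        · have := hnear x hx (by linarith) h1
          linarith
        · exact hfar x hx h1 hx2) hx hx1
  have := h.quarter_le hd h0 hη hv (by linarith) (mul_pos hc₁0 (hwy.trans_le hwp)) hpos hsph hel hen
  rw [← lt_sub_iff_add_lt, div_lt_iff₀ hc₁0] at hw2
  nlinarith

/-- A bounded solution has a limit at infinity. -/
lemma SmallSol.exists_limit (hd : 3 ≤ d) (h0 : 0 ≤ η)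
    (hη : 10000 * (d : ℝ) ^ 4 * η ≤ 1) (hv : SmallSol ℓ η v) {B : ℝ}
    (hB : ∀ x, 0 ≤ x ℓ → 1 ≤ ‖x‖ → |v x| ≤ B) :
    ∃ s, ∀ ε > 0, ∃ R, ∀ x, 0 ≤ x ℓ → R ≤ ‖x‖ → |v x - s| ≤ ε := by
  have g := (smallness hd h0 hη).2.2.2.2
  set L := {a : ℝ | ∃ R, ∀ x, 0 ≤ x ℓ → R ≤ ‖x‖ → a ≤ v x} with hL
  set U := {b : ℝ | ∃ R, ∀ x, 0 ≤ x ℓ → R ≤ ‖x‖ → v x ≤ b} with hU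
  have hsingle : ∀ R : ℝ, ∃ x : EuclideanSpace ℝ (Fin d), 0 ≤ x ℓ ∧ R ≤ ‖x‖ ∧ 1 ≤ ‖x‖ := fun R =>
    ⟨EuclideanSpace.single ℓ (max R 1), by simp, by
      rw [norm_single_pos (by positivity)]; exact ⟨le_max_left _ _, le_max_right _ _⟩⟩
  have hLU : ∀ a ∈ L, ∀ b ∈ U, a ≤ b := by
    rintro a ⟨R, ha⟩ b ⟨R', hb⟩
    obtain ⟨x, hx, hx1, -⟩ := hsingle (max R R')
    exact (ha x hx ((le_max_left _ _).trans hx1)).trans (hb x hx ((le_max_right _ _).trans hx1))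
  have hBL : -B ∈ L := ⟨1, fun x hx hx1 => (abs_le.1 (hB x hx hx1)).1⟩
  have hBU : B ∈ U := ⟨1, fun x hx hx1 => (abs_le.1 (hB x hx hx1)).2⟩
  have hLb : BddAbove L := ⟨B, fun a ha => hLU a ha B hBU⟩
  have hUb : BddBelow U := ⟨-B, fun b hb => hLU _ hBL b hb⟩
  have hst : sSup L ≤ sInf U := csSup_le ⟨_, hBL⟩ fun a ha => le_csInf ⟨_, hBU⟩ fun b hb => hLU a ha b hb
  have hlow : ∀ ε > 0, ∃ R, ∀ x, 0 ≤ x ℓ → R ≤ ‖x‖ → sSup L - ε ≤ v x := fun ε hε => by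
    obtain ⟨a, ⟨R, ha⟩, ha1⟩ := exists_lt_of_lt_csSup ⟨_, hBL⟩ (sub_lt_self (sSup L) hε)
    exact ⟨R, fun x hx hx1 => ha1.le.trans (ha x hx hx1)⟩
  have hupp : ∀ ε > 0, ∃ R, ∀ x, 0 ≤ x ℓ → R ≤ ‖x‖ → v x ≤ sInf U + ε := fun ε hε => by
    obtain ⟨a, ⟨R, ha⟩, ha1⟩ := exists_lt_of_csInf_lt ⟨_, hBU⟩ (lt_add_of_pos_right (sInf U) hε)
    exact ⟨R, fun x hx hx1 => (ha x hx hx1).trans ha1.le⟩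
  rcases hst.eq_or_lt with heq | hlt
  · refine ⟨sSup L, fun ε hε => ?_⟩
    obtain ⟨R, hR⟩ := hlow ε hε
    obtain ⟨R', hR'⟩ := hupp ε hε
    refine ⟨max R R', fun x hx hx1 => abs_le.2 ⟨?_, ?_⟩⟩
    · linarith [hR x hx ((le_max_left _ _).trans hx1)]
    · linarith [hR' x hx ((le_max_right _ _).trans hx1)]
  exfalso
  set δ := sInf U - sSup L with hδ
  have hδ0 : 0 < δ := sub_pos.2 hlt
  obtain ⟨j, hj⟩ := pow_unbounded_of_one_lt (4000 * (d : ℝ) * 3) (one_lt_two)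
  set c₁ := harnackC d ^ (64 + j) / 2 with hc₁
  have hc₁0 : 0 < c₁ := by have := harnackC_pos hd; positivity
  have hc₁1 : c₁ ≤ 1 := by
    have := pow_le_one₀ (n := 64 + j) (harnackC_pos hd).le harnackC_le_one
    rw [hc₁]; linarith
  set ε := c₁ * δ / 2 with hε
  have hε0 : 0 < ε := by positivity
  have hεδ : ε ≤ δ / 2 := by rw [hε]; nlinarith
  obtain ⟨R₁, hR₁⟩ := hlow ε hε0
  obtain ⟨R₂, hR₂⟩ := hupp ε hε0
  set R₀ := max (max R₁ R₂) 1 with hR₀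
  have hR₀1 : 1 ≤ R₀ := le_max_right _ _
  have hw : IsAff v (fun x => v x + -(sSup L - ε)) := isAff_add_const _
  have hsph : ∀ R' : ℝ, ∃ R, R' ≤ R ∧ 4 * R₀ ≤ R ∧ ∀ x, 0 ≤ x ℓ → ‖x‖ = R → sSup L - ε + c₁ * δ ≤ v x := by
    intro R'
    have : ∃ p : EuclideanSpace ℝ (Fin d), 0 ≤ p ℓ ∧ max R' (4 * R₀) ≤ ‖p‖ ∧ sInf U - ε ≤ v p := by
      by_contra! hc
      have : sInf U - ε ∈ U := ⟨_, fun x hx hx1 => (hc x hx hx1).le⟩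
      linarith [csInf_le hUb this]
    obtain ⟨p, hp, hpR, hvp⟩ := this
    have hp1 := (le_max_right _ _).trans hpR
    refine ⟨‖p‖, (le_max_left _ _).trans hpR, hp1, fun x hx hx1 => ?_⟩
    have far : ∀ z : EuclideanSpace ℝ (Fin d), ‖p‖ / 4 ≤ ‖z‖ → R₁ ≤ ‖z‖ ∧ R₂ ≤ ‖z‖ := fun z hz => by
      have h1 : R₀ ≤ ‖z‖ := by linarith
      exact ⟨((le_max_left _ _).trans (le_max_left _ _)).trans h1,
        ((le_max_right _ _).trans (le_max_left _ _)).trans h1⟩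
    have := hw.harnack_point hd h0 hη hv (Λ := 3) (by norm_num) hj.le (by linarith) hp rfl
      (fun z hz hz1 => by linarith [hR₁ z hz (far z hz1).1])
      (fun z hz hz1 _ => by linarith [hR₂ z hz (far z hz1).2]) hx hx1
    rw [← hc₁] at this
    have h3 : c₁ * δ ≤ c₁ * (v p + -(sSup L - ε)) := mul_le_mul_of_nonneg_left (by linarith) hc₁0.le
    linarith
  obtain ⟨R, -, hR, hR1⟩ := hsph 0
  have : sSup L - ε + c₁ * δ ∈ L := by
    refine ⟨R, fun x hx hx1 => ?_⟩
    obtain ⟨R', hR', -, hR2⟩ := hsph ‖x‖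
    have := hw.min_principle hd h0 hη hv (a := c₁ * δ) (by linarith : 1 ≤ R) (R₂ := R')
      (fun z hz hz1 => by linarith [hR1 z hz hz1]) (fun z hz hz1 => by linarith [hR2 z hz hz1]) x hx hx1 hR'
    linarith
  linarith [le_csSup hLb this]

end Limit

/-! ### Decay at infinity -/

section Decay

variable {d : ℕ} {ℓ : Fin d} {η : ℝ} {v : EuclideanSpace ℝ (Fin d) → ℝ}
  {y : EuclideanSpace ℝ (Fin d)} {s D : ℝ}

lemma SmallSol.slow_decay (hd : 3 ≤ d) (h0 : 0 ≤ η)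
    (hη : 10000 * (d : ℝ) ^ 4 * η ≤ 1) (hv : SmallSol ℓ η v)
    (hs : ∀ ε > 0, ∃ R, ∀ x, 0 ≤ x ℓ → R ≤ ‖x‖ → |v x - s| ≤ ε)
    (hD : ∀ x, 0 ≤ x ℓ → ‖x‖ = 1 → |v x - s| ≤ D) (hD0 : 0 ≤ D) (hy : 0 ≤ y ℓ) (hy1 : 1 ≤ ‖y‖) :
    |v y - s| ≤ 300 / 299 * D * ‖y‖ ^ (-1 / 2 : ℝ) := by
  have g := (smallness hd h0 hη).2.2.2.2
  have key : ∀ w : EuclideanSpace ℝ (Fin d) → ℝ, IsAff v w → (∀ x, -|v x - s| ≤ w x) →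
      -(300 / 299 * D * ‖y‖ ^ (-1 / 2 : ℝ)) ≤ w y := by
    intro w h hw
    have := h.barrier_exterior_of_nonneg (ψ := slowBarrier ℓ) (B := 300 / 299 * D) (by linarith) hv le_rfl
      (by positivity) continuousOn_tiltedRadial
      (fun x hx hx1 => hv.strictSub_slowBarrier hd hη h0 hx hx1.le)
      (fun x hx hx1 => slowBarrier_nonpos hd hx hx1)
      (fun x hx hx1 => by
        have h2 := (slowBarrier_bounds hd hx (ne_zero_of_one_le_norm hx1.ge)).2
        rw [hx1, one_rpow] at h2
        have := hD x hx hx1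
        have := hw x
        nlinarith)
      (fun ε hε => by
        obtain ⟨R, hR⟩ := hs ε hε
        exact ⟨R, fun x hx hx1 => by linarith [hw x, hR x hx hx1]⟩) hy hy1
    have h2 := (slowBarrier_bounds hd hy (ne_zero_of_one_le_norm hy1)).1
    have := mul_le_mul_of_nonneg_left h2 (by positivity : 0 ≤ 300 / 299 * D)
    linarith
  have k1 := key _ (isAff_add_const (-s)) fun x => by simpa [sub_eq_add_neg] using neg_abs_le (v x - s)
  have k2 := key _ (isAff_const_sub s) fun x => by rw [abs_sub_comm]; exact neg_abs_le _
  rw [abs_le]; constructor <;> linarith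

lemma rpow_neg_half_half {r : ℝ} (hr : 0 < r) : (r / 2) ^ (-1 / 2 : ℝ) ≤ 3 / 2 * r ^ (-1 / 2 : ℝ) := by
  have e : (r / 2) ^ (-1 / 2 : ℝ) = r ^ (-1 / 2 : ℝ) * (1 / 2 : ℝ) ^ (-1 / 2 : ℝ) := by
    rw [← mul_rpow hr.le (by norm_num)]; congr 1; ring
  have h3 : ((1 / 2 : ℝ) ^ (-1 / 2 : ℝ)) ^ 2 = 2 := by
    rw [← rpow_natCast, ← rpow_mul (by norm_num)]; norm_num [rpow_neg_one]
  have h4 : 0 < (1 / 2 : ℝ) ^ (-1 / 2 : ℝ) := by positivity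
  have h5 : (1 / 2 : ℝ) ^ (-1 / 2 : ℝ) ≤ 3 / 2 := by nlinarith
  have : 0 < r ^ (-1 / 2 : ℝ) := by positivity
  rw [e]; nlinarith

lemma half_norm_le {x : EuclideanSpace ℝ (Fin d)} (h : ‖x - y‖ ≤ ‖y‖ / 2) : ‖y‖ / 2 ≤ ‖x‖ := by
  have : ‖y‖ ≤ ‖x‖ + ‖x - y‖ := by rw [norm_sub_rev]; simpa using norm_add_le x (y - x)
  linarith

/-- First (suboptimal) gradient decay. -/
lemma SmallSol.slow_gradient_decay (hd : 3 ≤ d) (h0 : 0 ≤ η)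
    (hη : 10000 * (d : ℝ) ^ 4 * η ≤ 1) (hv : SmallSol ℓ η v)
    (hs : ∀ ε > 0, ∃ R, ∀ x, 0 ≤ x ℓ → R ≤ ‖x‖ → |v x - s| ≤ ε)
    (hD : ∀ x, 0 ≤ x ℓ → ‖x‖ = 1 → |v x - s| ≤ D) (hD0 : 0 ≤ D) (hy : 0 ≤ y ℓ) (hy1 : 2 ≤ ‖y‖) :
    ‖fderiv ℝ v y‖ * ‖y‖ ^ (1 / 2 : ℝ) ≤ 1000 * d * D := by
  have hy0 : 0 < ‖y‖ := by linarith
  have hP : 0 < ‖y‖ ^ (-1 / 2 : ℝ) := by positivity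
  have h1 := gradient_estimate hd h0 hη hv hy hy1 (s := s) (O := 2 * D * ‖y‖ ^ (-1 / 2 : ℝ)) fun x hx hxy => by
    have hxn := half_norm_le hxy
    refine (hv.slow_decay hd h0 hη hs hD hD0 hx (by linarith)).trans ?_
    have h2 : ‖x‖ ^ (-1 / 2 : ℝ) ≤ (‖y‖ / 2) ^ (-1 / 2 : ℝ) :=
      rpow_le_rpow_of_nonpos (by positivity) hxn (by norm_num)
    have h3 := h2.trans (rpow_neg_half_half hy0)
    have h4 := mul_le_mul_of_nonneg_left h3 (by positivity : 0 ≤ 300 / 299 * D)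
    have : 0 ≤ D * ‖y‖ ^ (-1 / 2 : ℝ) := by positivity
    linarith
  have e : ‖y‖ ^ (-1 / 2 : ℝ) * ‖y‖ ^ (1 / 2 : ℝ) = 1 := by
    rw [← rpow_add hy0]; norm_num
  have hQ : 0 < ‖y‖ ^ (1 / 2 : ℝ) := by positivity
  calc ‖fderiv ℝ v y‖ * ‖y‖ ^ (1 / 2 : ℝ)
      ≤ 1000 * d * (2 * D * ‖y‖ ^ (-1 / 2 : ℝ)) / ‖y‖ * ‖y‖ ^ (1 / 2 : ℝ) := by gcongr
    _ = 2000 * d * D * (‖y‖ ^ (-1 / 2 : ℝ) * ‖y‖ ^ (1 / 2 : ℝ)) / ‖y‖ := by ring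
    _ ≤ 1000 * d * D := by
      rw [e, mul_one, div_le_iff₀ hy0]
      have : 0 ≤ d * D := by positivity
      nlinarith

/-- The optimal decay rate. -/
lemma SmallSol.fast_decay (hd : 3 ≤ d) (h0 : 0 ≤ η)
    (hη : 10000 * (d : ℝ) ^ 4 * η ≤ 1) (hv : SmallSol ℓ η v)
    (hs : ∀ ε > 0, ∃ R, ∀ x, 0 ≤ x ℓ → R ≤ ‖x‖ → |v x - s| ≤ ε)
    (hD : ∀ x, 0 ≤ x ℓ → ‖x‖ = 1 → |v x - s| ≤ D) (hD0 : 0 ≤ D) (hDs : 2000000 * (d : ℝ) ^ 5 * D ≤ 1)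
    (hy : 0 ≤ y ℓ) (hy1 : 1 ≤ ‖y‖) : |v y - s| ≤ 2 ^ d * D * ‖y‖ ^ (2 - d : ℝ) := by
  have g := (smallness hd h0 hη).2.2.2.2
  have hd' : (3 : ℝ) ≤ d := by exact_mod_cast hd
  have e2 : (2 : ℝ) ^ d * 2 ^ (2 - d : ℝ) = 4 := by
    rw [← rpow_natCast, ← rpow_add (by norm_num)]; norm_num
  have hsl : ∀ x : EuclideanSpace ℝ (Fin d), 0 ≤ x ℓ → 1 ≤ ‖x‖ → |v x - s| ≤ 2 * D := fun x hx hx1 => by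
    refine (hv.slow_decay hd h0 hη hs hD hD0 hx hx1).trans ?_
    nlinarith [mul_le_mul_of_nonneg_left (rpow_neg_half_le_one hx1) hD0]
  rcases lt_or_ge ‖y‖ 2 with hy2 | hy2
  · refine (hsl y hy hy1).trans ?_
    have h1 : (2 : ℝ) ^ (2 - d : ℝ) ≤ ‖y‖ ^ (2 - d : ℝ) :=
      rpow_le_rpow_of_nonpos (by linarith) hy2.le (by linarith)
    have h2 := mul_le_mul_of_nonneg_left h1 (by positivity : 0 ≤ 2 ^ d * D)
    nlinarith
  have key : ∀ w : EuclideanSpace ℝ (Fin d) → ℝ, IsAff v w → (∀ x, -|v x - s| ≤ w x) →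
      -(2 ^ d * D * ‖y‖ ^ (2 - d : ℝ)) ≤ w y := by
    intro w h hw
    have := h.barrier_exterior_of_nonneg (ψ := fastBarrier ℓ) (B := 2 ^ d * D / 2) (R₁ := 2) (by linarith) hv
      (by norm_num) (by positivity) continuousOn_tiltedRadial
      (fun x hx hx1 => by
        refine strictSub_fastBarrier hd (by positivity) (by linarith) ?_
        have := hv.slow_gradient_decay hd h0 hη hs hD hD0 hx hx1.le
        have := mul_le_mul_of_nonneg_left this (by positivity : 0 ≤ 2000 * (d : ℝ) ^ 4)
        linarith)
      (fun x hx hx1 => by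
        have := (fastBarrier_bounds hd hx hx1).2
        have : 0 ≤ ‖x‖ ^ (2 - d : ℝ) := by positivity
        linarith)
      (fun x hx hx1 => by
        have h2 := (fastBarrier_bounds hd hx hx1.ge).2
        rw [hx1] at h2
        have := hsl x hx (by linarith)
        have := hw x
        have := mul_le_mul_of_nonneg_left h2 (by positivity : 0 ≤ 2 ^ d * D / 2)
        nlinarith)
      (fun ε hε => by
        obtain ⟨R, hR⟩ := hs ε hε
        exact ⟨R, fun x hx hx1 => by linarith [hw x, hR x hx hx1]⟩) hy hy2
    have h2 := (fastBarrier_bounds hd hy hy2).1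
    have := mul_le_mul_of_nonneg_left h2 (by positivity : 0 ≤ 2 ^ d * D / 2)
    linarith
  have k1 := key _ (isAff_add_const (-s)) fun x => by simpa [sub_eq_add_neg] using neg_abs_le (v x - s)
  have k2 := key _ (isAff_const_sub s) fun x => by rw [abs_sub_comm]; exact neg_abs_le _
  rw [abs_le]; constructor <;> linarith

lemma SmallSol.fast_gradient_decay (hd : 3 ≤ d) (h0 : 0 ≤ η)
    (hη : 10000 * (d : ℝ) ^ 4 * η ≤ 1) (hv : SmallSol ℓ η v)
    (hs : ∀ ε > 0, ∃ R, ∀ x, 0 ≤ x ℓ → R ≤ ‖x‖ → |v x - s| ≤ ε)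
    (hD : ∀ x, 0 ≤ x ℓ → ‖x‖ = 1 → |v x - s| ≤ D) (hD0 : 0 ≤ D) (hDs : 2000000 * (d : ℝ) ^ 5 * D ≤ 1)
    (hy : 0 ≤ y ℓ) (hy1 : 2 ≤ ‖y‖) : ‖fderiv ℝ v y‖ ≤ 1000 * d * 4 ^ d * D * ‖y‖ ^ (1 - d : ℝ) := by
  have hd' : (3 : ℝ) ≤ d := by exact_mod_cast hd
  have hy0 : 0 < ‖y‖ := by linarith
  have h1 := gradient_estimate hd h0 hη hv hy hy1 (s := s) (O := 4 ^ d * D * ‖y‖ ^ (2 - d : ℝ)) fun x hx hxy => by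
    have hxn := half_norm_le hxy
    refine (hv.fast_decay hd h0 hη hs hD hD0 hDs hx (by linarith)).trans ?_
    have h2 : ‖x‖ ^ (2 - d : ℝ) ≤ (‖y‖ / 2) ^ (2 - d : ℝ) :=
      rpow_le_rpow_of_nonpos (by positivity) hxn (by linarith)
    have h3 : (‖y‖ / 2) ^ (2 - d : ℝ) ≤ 2 ^ d * ‖y‖ ^ (2 - d : ℝ) := by
      rw [div_eq_mul_inv, mul_rpow hy0.le (by norm_num), mul_comm]
      gcongr
      rw [inv_rpow (by norm_num), ← rpow_neg (by norm_num), ← rpow_natCast]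
      exact rpow_le_rpow_of_exponent_le (by norm_num) (by linarith)
    have h4 := mul_le_mul_of_nonneg_left (h2.trans h3) (by positivity : 0 ≤ 2 ^ d * D)
    refine h4.trans_eq ?_
    rw [show (4 : ℝ) = 2 * 2 by norm_num, mul_pow]; ring
  refine h1.trans_eq ?_
  have : ‖y‖ ^ (2 - d : ℝ) = ‖y‖ ^ (1 - d : ℝ) * ‖y‖ := by
    rw [← rpow_add_one hy0.ne']; congr 1; ring
  rw [this]; field_simp

/-- The boundary values on the unit sphere are controlled by the oscillation on `1 ≤ |y| ≤ 2`. -/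
lemma SmallSol.abs_sub_limit_le (hd : 3 ≤ d) (h0 : 0 ≤ η)
    (hη : 10000 * (d : ℝ) ^ 4 * η ≤ 1) (hv : SmallSol ℓ η v)
    (hs : ∀ ε > 0, ∃ R, ∀ x, 0 ≤ x ℓ → R ≤ ‖x‖ → |v x - s| ≤ ε) {m : ℝ}
    (hm : ∀ x z, 0 ≤ x ℓ → 1 ≤ ‖x‖ → ‖x‖ ≤ 2 → 0 ≤ z ℓ → 1 ≤ ‖z‖ → ‖z‖ ≤ 2 → v x - v z ≤ m) :
    ∀ x, 0 ≤ x ℓ → ‖x‖ = 1 → |v x - s| ≤ 4 * m := by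
  have hK := isCompact_half_annulus (ℓ := ℓ) 1 1
  have hne : {x : EuclideanSpace ℝ (Fin d) | 0 ≤ x ℓ ∧ 1 ≤ ‖x‖ ∧ ‖x‖ ≤ 1}.Nonempty :=
    ⟨EuclideanSpace.single ℓ 1, by simp⟩
  obtain ⟨p, hp, hmax⟩ := hK.exists_isMaxOn hne (f := fun x => |v x - s|) fun x hx =>
    (((hv.contDiffAt hx.1 hx.2.1).continuousAt.sub continuousAt_const).abs).continuousWithinAt
  have hpn : ‖p‖ = 1 := le_antisymm hp.2.2 hp.2.1
  have hD : ∀ x, 0 ≤ x ℓ → ‖x‖ = 1 → |v x - s| ≤ |v p - s| := fun x hx hx1 =>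
    hmax (show x ∈ _ from ⟨hx, hx1.ge, hx1.le⟩)
  set q : EuclideanSpace ℝ (Fin d) := (2 : ℝ) • p with hq
  have hqn : ‖q‖ = 2 := by rw [hq, norm_smul, hpn]; norm_num
  have hql : 0 ≤ q ℓ := by
    rw [hq, PiLp.smul_apply, smul_eq_mul]; linarith [hp.1]
  have h1 := hv.slow_decay hd h0 hη hs hD (abs_nonneg _) hql (by linarith)
  have h2 : ‖q‖ ^ (-1 / 2 : ℝ) ≤ 72 / 100 := by
    have h3 : ((2 : ℝ) ^ (-1 / 2 : ℝ)) ^ 2 = 1 / 2 := by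
      rw [← rpow_natCast, ← rpow_mul (by norm_num)]; norm_num
    have h4 : 0 < (2 : ℝ) ^ (-1 / 2 : ℝ) := by positivity
    rw [hqn]; nlinarith
  have h3 : |v p - v q| ≤ m := by
    have a := hm p q hp.1 hpn.ge (by linarith) hql (by linarith) hqn.le
    have b := hm q p hql (by linarith) hqn.le hp.1 hpn.ge (by linarith)
    rw [abs_le]; constructor <;> linarith
  have h4 : |v p - s| ≤ |v p - v q| + |v q - s| := _root_.abs_sub_le _ _ _
  have h5 := mul_le_mul_of_nonneg_left h2 (by positivity : 0 ≤ 300 / 299 * |v p - s|)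
  have h6 : |v p - s| ≤ 4 * m := by linarith [(abs_nonneg _).trans h3]
  exact fun x hx hx1 => (hD x hx hx1).trans h6

/-- Existence of the limit and decay estimates for one-sidedly bounded solutions. -/
lemma SmallSol.exists_decay (hd : 3 ≤ d) (h0 : 0 ≤ η) (hη : 1000000000 * (d : ℝ) ^ 5 * η ≤ 1)
    (hv : SmallSol ℓ η v)
    (hb : (∃ M, ∀ x, 0 ≤ x ℓ → 1 ≤ ‖x‖ → v x ≤ M) ∨ ∃ M, ∀ x, 0 ≤ x ℓ → 1 ≤ ‖x‖ → M ≤ v x) {m : ℝ}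
    (hm : ∀ x z, 0 ≤ x ℓ → 1 ≤ ‖x‖ → ‖x‖ ≤ 2 → 0 ≤ z ℓ → 1 ≤ ‖z‖ → ‖z‖ ≤ 2 → v x - v z ≤ m)
    (hm8 : m ≤ 8 * η) :
    ∃ s, (∀ x, 0 ≤ x ℓ → ‖x‖ = 1 → |v x - s| ≤ 4 * m) ∧
      (∀ x, 0 ≤ x ℓ → 1 ≤ ‖x‖ → |v x - s| ≤ 2 ^ d * (4 * m) * ‖x‖ ^ (2 - d : ℝ)) ∧
      ∀ x, 0 ≤ x ℓ → 2 ≤ ‖x‖ → ‖fderiv ℝ v x‖ ≤ 1000 * d * 4 ^ d * (4 * m) * ‖x‖ ^ (1 - d : ℝ) := by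
  have hd' : (3 : ℝ) ≤ d := by exact_mod_cast hd
  have hη4 : 10000 * (d : ℝ) ^ 4 * η ≤ 1 := by
    have : 0 ≤ (d : ℝ) ^ 4 * η := by positivity
    nlinarith
  have hbdd : ∃ B, ∀ x, 0 ≤ x ℓ → 1 ≤ ‖x‖ → |v x| ≤ B := by
    rcases hb with ⟨M, hM⟩ | ⟨M, hM⟩
    · obtain ⟨T, hT⟩ := (isAff_const_sub (v := v) M).exists_upper_bound hd h0 hη4 hv
        fun x hx hx1 => sub_nonneg.2 (hM x hx hx1)
      refine ⟨|M| + |T|, fun x hx hx1 => abs_le.2 ⟨?_, ?_⟩⟩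
      · have := hT x hx hx1
        linarith [neg_abs_le M, le_abs_self T]
      · have := hM x hx hx1
        linarith [le_abs_self M, abs_nonneg T]
    · obtain ⟨T, hT⟩ := (isAff_add_const (v := v) (-M)).exists_upper_bound hd h0 hη4 hv
        fun x hx hx1 => by linarith [hM x hx hx1]
      refine ⟨|M| + |T|, fun x hx hx1 => abs_le.2 ⟨?_, ?_⟩⟩
      · have := hM x hx hx1
        linarith [neg_abs_le M, abs_nonneg T]
      · have := hT x hx hx1
        linarith [le_abs_self M, le_abs_self T]
  obtain ⟨B, hB⟩ := hbdd
  obtain ⟨s, hs⟩ := hv.exists_limit hd h0 hη4 hB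
  have hD := hv.abs_sub_limit_le hd h0 hη4 hs hm
  have hD0 : 0 ≤ 4 * m :=
    (abs_nonneg _).trans (hD (EuclideanSpace.single ℓ 1) (by simp) (by simp))
  have hDs : 2000000 * (d : ℝ) ^ 5 * (4 * m) ≤ 1 := by
    have := mul_le_mul_of_nonneg_left hm8 (by positivity : 0 ≤ 8000000 * (d : ℝ) ^ 5)
    have : 0 ≤ (d : ℝ) ^ 5 * η := by positivity
    linarith
  exact ⟨s, hD, fun x hx hx1 => hv.fast_decay hd h0 hη4 hs hD hD0 hDs hx hx1,
    fun x hx hx1 => hv.fast_gradient_decay hd h0 hη4 hs hD hD0 hDs hx hx1⟩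

end Decay

/-! ### Doubling of variables -/

section Doubling

variable {d : ℕ} {ℓ : Fin d} {x x' : EuclideanSpace ℝ (Fin d)}

/-- The trace of a bilinear form is invariant under reflections. -/
lemma sum_reflect (B : EuclideanSpace ℝ (Fin d) →L[ℝ] EuclideanSpace ℝ (Fin d) →L[ℝ] ℝ)
    {e : EuclideanSpace ℝ (Fin d)} (he : ‖e‖ = 1) :
    ∑ k, B (EuclideanSpace.single k 1 - (2 * e k) • e) (EuclideanSpace.single k 1 - (2 * e k) • e) =
      ∑ k, B (EuclideanSpace.single k 1) (EuclideanSpace.single k 1) := by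
  have h1 : ∑ k, e k * B (EuclideanSpace.single k 1) e = B e e := by
    conv_rhs => enter [1]; rw [eq_sum_single e]
    simp
  have h2 : ∑ k, e k * B e (EuclideanSpace.single k 1) = B e e := by
    conv_rhs => enter [2]; rw [eq_sum_single e]
    simp
  have h3 : ∑ k, e k ^ 2 = 1 := by
    rw [← EuclideanSpace.real_norm_sq_eq, he]; norm_num
  have h4 : ∀ k, B (EuclideanSpace.single k 1 - (2 * e k) • e)
      (EuclideanSpace.single k 1 - (2 * e k) • e) =
      B (EuclideanSpace.single k 1) (EuclideanSpace.single k 1) -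
        2 * (e k * B (EuclideanSpace.single k 1) e) - 2 * (e k * B e (EuclideanSpace.single k 1)) +
        4 * B e e * e k ^ 2 := fun k => by
    simp only [map_sub, map_smul, _root_.sub_apply, _root_.smul_apply, smul_eq_mul]
    ring
  simp only [h4, Finset.sum_add_distrib, Finset.sum_sub_distrib, ← Finset.mul_sum, h1, h2, h3]
  ring

/-- The penalization used in the doubling of variables. -/
def doublePen (ℓ : Fin d) (x x' : EuclideanSpace ℝ (Fin d)) : ℝ :=
  1000 * d * ((‖x - x'‖ ^ 2) ^ (1 / 2 : ℝ) - 1 / 2 * (‖x - x'‖ ^ 2) ^ (3 / 4 : ℝ)) +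
    2 * (‖x‖ ^ 2 + ‖x'‖ ^ 2) ^ (3 / 4 : ℝ) -
    1 / 2 * ((x ℓ + x' ℓ) * (‖x‖ ^ 2 + ‖x'‖ ^ 2) ^ (1 / 4 : ℝ))

lemma pow_four_rpow {a : ℝ} (ha : 0 ≤ a) (p : ℝ) : (a ^ 4) ^ p = a ^ (4 * p) := by
  rw [← rpow_natCast, ← rpow_mul ha]; norm_num

lemma jet_norm_sq (x ξ : EuclideanSpace ℝ (Fin d)) :
    HasJet (fun t : ℝ => ‖x + t • ξ‖ ^ 2) (‖x‖ ^ 2) (2 * inner ℝ x ξ) (2 * ‖ξ‖ ^ 2) := by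
  simpa using jet_sq_dist x 0 ξ

lemma jet_concave {D : ℝ → ℝ} {ρ b c : ℝ} (hρ : 0 < ρ) (hD : HasJet D (ρ ^ 4) b c) :
    HasJet (fun t => D t ^ (1 / 2 : ℝ) - 1 / 2 * D t ^ (3 / 4 : ℝ)) (ρ ^ 2 - 1 / 2 * ρ ^ 3)
      ((1 / 2 / ρ ^ 2 - 3 / 8 / ρ) * b)
      (- (1 / 4) / ρ ^ 6 * b ^ 2 + 1 / 2 / ρ ^ 2 * c + 3 / 32 / ρ ^ 5 * b ^ 2 - 3 / 8 / ρ * c) := by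
  have h4 : 0 < ρ ^ 4 := by positivity
  have e1 : (ρ ^ 4) ^ (1 / 2 - 1 : ℝ) = 1 / ρ ^ 2 := by
    rw [pow_four_rpow hρ.le, show (4 * (1 / 2 - 1) : ℝ) = -(2 : ℕ) by norm_num, rpow_neg hρ.le,
      rpow_natCast, one_div]
  have e2 : (ρ ^ 4) ^ (1 / 2 - 2 : ℝ) = 1 / ρ ^ 6 := by
    rw [pow_four_rpow hρ.le, show (4 * (1 / 2 - 2) : ℝ) = -(6 : ℕ) by norm_num, rpow_neg hρ.le,
      rpow_natCast, one_div]
  have e3 : (ρ ^ 4) ^ (3 / 4 - 1 : ℝ) = 1 / ρ := by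
    rw [pow_four_rpow hρ.le, show (4 * (3 / 4 - 1) : ℝ) = -1 by norm_num, rpow_neg hρ.le,
      rpow_one, one_div]
  have e4 : (ρ ^ 4) ^ (3 / 4 - 2 : ℝ) = 1 / ρ ^ 5 := by
    rw [pow_four_rpow hρ.le, show (4 * (3 / 4 - 2) : ℝ) = -(5 : ℕ) by norm_num, rpow_neg hρ.le,
      rpow_natCast, one_div]
  have e5 : (ρ ^ 4) ^ (1 / 2 : ℝ) = ρ ^ 2 := by
    rw [pow_four_rpow hρ.le, show (4 * (1 / 2) : ℝ) = (2 : ℕ) by norm_num, rpow_natCast]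
  have e6 : (ρ ^ 4) ^ (3 / 4 : ℝ) = ρ ^ 3 := by
    rw [pow_four_rpow hρ.le, show (4 * (3 / 4) : ℝ) = (3 : ℕ) by norm_num, rpow_natCast]
  have := (hD.rpow h4 (1 / 2)).sub ((hD.rpow h4 (3 / 4)).const_mul (1 / 2))
  rw [e1, e2, e3, e4, e5, e6] at this
  exact this.congr_val rfl (by ring) (by ring)

lemma jet_convex {Q lam : ℝ → ℝ} {σ b c p q : ℝ} (hσ : 0 < σ) (hQ : HasJet Q (σ ^ 4) b c)
    (hlam : HasJet lam p q 0) :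
    HasJet (fun t => 2 * Q t ^ (3 / 4 : ℝ) - 1 / 2 * (lam t * Q t ^ (1 / 4 : ℝ)))
      (2 * σ ^ 3 - 1 / 2 * (p * σ))
      (3 / 2 / σ * b - 1 / 2 * (q * σ + p * (1 / 4 / σ ^ 3 * b)))
      (- (3 / 8) / σ ^ 5 * b ^ 2 + 3 / 2 / σ * c -
        1 / 2 * (2 * (q * (1 / 4 / σ ^ 3 * b)) +
          p * (- (3 / 16) / σ ^ 7 * b ^ 2 + 1 / 4 / σ ^ 3 * c))) := by
  have h4 : 0 < σ ^ 4 := by positivity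
  have e1 : (σ ^ 4) ^ (1 / 4 - 1 : ℝ) = 1 / σ ^ 3 := by
    rw [pow_four_rpow hσ.le, show (4 * (1 / 4 - 1) : ℝ) = -(3 : ℕ) by norm_num, rpow_neg hσ.le,
      rpow_natCast, one_div]
  have e2 : (σ ^ 4) ^ (1 / 4 - 2 : ℝ) = 1 / σ ^ 7 := by
    rw [pow_four_rpow hσ.le, show (4 * (1 / 4 - 2) : ℝ) = -(7 : ℕ) by norm_num, rpow_neg hσ.le,
      rpow_natCast, one_div]
  have e3 : (σ ^ 4) ^ (3 / 4 - 1 : ℝ) = 1 / σ := by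
    rw [pow_four_rpow hσ.le, show (4 * (3 / 4 - 1) : ℝ) = -1 by norm_num, rpow_neg hσ.le,
      rpow_one, one_div]
  have e4 : (σ ^ 4) ^ (3 / 4 - 2 : ℝ) = 1 / σ ^ 5 := by
    rw [pow_four_rpow hσ.le, show (4 * (3 / 4 - 2) : ℝ) = -(5 : ℕ) by norm_num, rpow_neg hσ.le,
      rpow_natCast, one_div]
  have e5 : (σ ^ 4) ^ (1 / 4 : ℝ) = σ := by
    rw [pow_four_rpow hσ.le, show (4 * (1 / 4) : ℝ) = 1 by norm_num, rpow_one]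
  have e6 : (σ ^ 4) ^ (3 / 4 : ℝ) = σ ^ 3 := by
    rw [pow_four_rpow hσ.le, show (4 * (3 / 4) : ℝ) = (3 : ℕ) by norm_num, rpow_natCast]
  have := ((hQ.rpow h4 (3 / 4)).const_mul 2).sub
    ((hlam.mul (hQ.rpow h4 (1 / 4))).const_mul (1 / 2))
  rw [e1, e2, e3, e4, e5, e6] at this
  exact this.congr_val rfl (by ring) (by ring)

lemma convex_bound {σ b c p q : ℝ} (hσ : 0 < σ) (hc : 0 ≤ c) (hb : b ^ 2 ≤ 2 * σ ^ 4 * c)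
    (hq : q ^ 2 ≤ c) (hp : 0 ≤ p) (hp2 : p ^ 2 ≤ 2 * σ ^ 4) :
    - (3 / 8) / σ ^ 5 * b ^ 2 + 3 / 2 / σ * c -
        1 / 2 * (2 * (q * (1 / 4 / σ ^ 3 * b)) +
          p * (- (3 / 16) / σ ^ 7 * b ^ 2 + 1 / 4 / σ ^ 3 * c)) ≤ 3 * c / σ := by
  have h1 : p ≤ 3 / 2 * σ ^ 2 := by
    refine abs_le_of_sq_le_sq' ?_ (by positivity) |>.2
    nlinarith [pow_pos hσ 4]
  have h2 : -(q * b) ≤ 3 / 2 * σ ^ 2 * c := by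
    have : (q * b) ^ 2 ≤ (3 / 2 * σ ^ 2 * c) ^ 2 := by
      have := mul_le_mul hq hb (sq_nonneg b) hc
      have : 0 ≤ σ ^ 4 * c ^ 2 := by positivity
      nlinarith
    linarith [(abs_le_of_sq_le_sq' this (by positivity)).1]
  have h3 : p * b ^ 2 ≤ 3 * σ ^ 6 * c := by
    have := mul_le_mul h1 hb (sq_nonneg b) (by positivity)
    linarith
  have e : 3 * c / σ - (- (3 / 8) / σ ^ 5 * b ^ 2 + 3 / 2 / σ * c -
        1 / 2 * (2 * (q * (1 / 4 / σ ^ 3 * b)) +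
          p * (- (3 / 16) / σ ^ 7 * b ^ 2 + 1 / 4 / σ ^ 3 * c))) =
      (1 / σ ^ 7) * (3 / 2 * σ ^ 6 * c + 3 / 8 * σ ^ 2 * b ^ 2 + 1 / 4 * σ ^ 4 * (q * b) -
        3 / 32 * (p * b ^ 2) + 1 / 8 * p * σ ^ 4 * c) := by
    field_simp
    ring
  have h4 : 0 ≤ 3 / 2 * σ ^ 6 * c + 3 / 8 * σ ^ 2 * b ^ 2 + 1 / 4 * σ ^ 4 * (q * b) -
        3 / 32 * (p * b ^ 2) + 1 / 8 * p * σ ^ 4 * c := by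
    have a1 := mul_le_mul_of_nonneg_left h2 (by positivity : 0 ≤ σ ^ 4)
    have a2 : 0 ≤ σ ^ 2 * b ^ 2 := by positivity
    have a3 : 0 ≤ p * σ ^ 4 * c := by positivity
    have a4 : 0 ≤ σ ^ 6 * c := by positivity
    nlinarith only [a1, a2, a3, a4, h3]
  have := mul_nonneg (by positivity : 0 ≤ 1 / σ ^ 7) h4
  linarith

lemma sq_coord_le (z : EuclideanSpace ℝ (Fin d)) (i : Fin d) : z i ^ 2 ≤ ‖z‖ ^ 2 := by
  have := PiLp.norm_apply_le z i
  rw [Real.norm_eq_abs] at this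
  rw [← sq_abs]; gcongr

/-- Second derivative of the penalization along a pair of directions. -/
lemma jet_doublePen {ρ σ : ℝ} (hρ : 0 < ρ) (hσ : 0 < σ) (hD : ‖x - x'‖ = ρ ^ 2)
    (hQ : ‖x‖ ^ 2 + ‖x'‖ ^ 2 = σ ^ 4) (hx : 0 ≤ x ℓ) (hx' : 0 ≤ x' ℓ)
    (u w : EuclideanSpace ℝ (Fin d)) :
    ∃ S, HasJet (fun t : ℝ => doublePen ℓ (x + t • u) (x' + t • w)) (doublePen ℓ x x')
      (1000 * d * ((1 / 2 / ρ ^ 2 - 3 / 8 / ρ) * (2 * inner ℝ (x - x') (u - w))) +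
        (3 / 2 / σ * (2 * (inner ℝ x u + inner ℝ x' w)) - 1 / 2 * ((u ℓ + w ℓ) * σ +
          (x ℓ + x' ℓ) * (1 / 4 / σ ^ 3 * (2 * (inner ℝ x u + inner ℝ x' w)))))) S ∧
      S ≤ 1000 * d * ((‖u - w‖ ^ 2 - inner ℝ (x - x') (u - w) ^ 2 / ρ ^ 4) / ρ ^ 2 -
        3 / 8 / ρ * (inner ℝ (x - x') (u - w) ^ 2 / ρ ^ 4)) +
        6 * (‖u‖ ^ 2 + ‖w‖ ^ 2) / σ := by
  have jD : HasJet (fun t : ℝ => ‖(x + t • u) - (x' + t • w)‖ ^ 2) (ρ ^ 4)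
      (2 * inner ℝ (x - x') (u - w)) (2 * ‖u - w‖ ^ 2) := by
    have h : (fun t : ℝ => ‖(x + t • u) - (x' + t • w)‖ ^ 2) =
        fun t : ℝ => ‖(x - x') + t • (u - w)‖ ^ 2 := by
      ext t; congr 2; rw [smul_sub]; abel
    rw [h]
    exact (jet_norm_sq _ _).congr_val (by rw [hD]; ring) rfl rfl
  have jQ : HasJet (fun t : ℝ => ‖x + t • u‖ ^ 2 + ‖x' + t • w‖ ^ 2) (σ ^ 4)
      (2 * (inner ℝ x u + inner ℝ x' w)) (2 * (‖u‖ ^ 2 + ‖w‖ ^ 2)) :=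
    ((jet_norm_sq x u).add (jet_norm_sq x' w)).congr_val hQ (by ring) (by ring)
  have jl : HasJet (fun t : ℝ => (x + t • u) ℓ + (x' + t • w) ℓ) (x ℓ + x' ℓ) (u ℓ + w ℓ) 0 := by
    simp only [PiLp.add_apply, PiLp.smul_apply, smul_eq_mul]
    exact ((HasJet.affine _ _).add (HasJet.affine _ _)).congr_val rfl rfl (by ring)
  have J := ((jet_concave hρ jD).const_mul (1000 * d)).add (jet_convex hσ jQ jl)
  have hf : (fun t : ℝ => doublePen ℓ (x + t • u) (x' + t • w)) = fun t : ℝ =>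
      1000 * d * ((‖(x + t • u) - (x' + t • w)‖ ^ 2) ^ (1 / 2 : ℝ) -
        1 / 2 * (‖(x + t • u) - (x' + t • w)‖ ^ 2) ^ (3 / 4 : ℝ)) +
      (2 * (‖x + t • u‖ ^ 2 + ‖x' + t • w‖ ^ 2) ^ (3 / 4 : ℝ) -
        1 / 2 * (((x + t • u) ℓ + (x' + t • w) ℓ) *
          (‖x + t • u‖ ^ 2 + ‖x' + t • w‖ ^ 2) ^ (1 / 4 : ℝ))) := by
    ext t; rw [doublePen]; ring
  rw [← hf] at J
  have hval := J.1
  simp only [zero_smul, add_zero] at hval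
  rw [← hval] at J
  refine ⟨_, J, ?_⟩
  · have hcs : (inner ℝ x u + inner ℝ x' w) ^ 2 ≤ σ ^ 4 * (‖u‖ ^ 2 + ‖w‖ ^ 2) := by
      have a1 := abs_real_inner_le_norm x u
      have a2 := abs_real_inner_le_norm x' w
      have a3 : |inner ℝ x u + inner ℝ x' w| ≤ ‖x‖ * ‖u‖ + ‖x'‖ * ‖w‖ :=
        (abs_add_le _ _).trans (add_le_add a1 a2)
      rw [← hQ, ← sq_abs]
      calc _ ≤ (‖x‖ * ‖u‖ + ‖x'‖ * ‖w‖) ^ 2 := by gcongr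
        _ ≤ _ := by nlinarith only [sq_nonneg (‖x‖ * ‖w‖ - ‖x'‖ * ‖u‖)]
    have hq : (u ℓ + w ℓ) ^ 2 ≤ 2 * (‖u‖ ^ 2 + ‖w‖ ^ 2) := by
      nlinarith only [sq_coord_le u ℓ, sq_coord_le w ℓ, sq_nonneg (u ℓ - w ℓ)]
    have hp : (x ℓ + x' ℓ) ^ 2 ≤ 2 * σ ^ 4 := by
      nlinarith only [sq_coord_le x ℓ, sq_coord_le x' ℓ, sq_nonneg (x ℓ - x' ℓ), hQ]
    have h1 := convex_bound (b := 2 * (inner ℝ x u + inner ℝ x' w)) hσ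
      (by positivity : 0 ≤ 2 * (‖u‖ ^ 2 + ‖w‖ ^ 2)) (by nlinarith only [hcs]) hq
      (by positivity) hp
    have hI : inner ℝ (x - x') (u - w) ^ 2 ≤ ρ ^ 4 * ‖u - w‖ ^ 2 := by
      rw [← sq_abs]
      calc _ ≤ (‖x - x'‖ * ‖u - w‖) ^ 2 := by gcongr; exact abs_real_inner_le_norm _ _
        _ = _ := by rw [hD]; ring
    have h2 : - (1 / 4) / ρ ^ 6 * (2 * inner ℝ (x - x') (u - w)) ^ 2 +
        1 / 2 / ρ ^ 2 * (2 * ‖u - w‖ ^ 2) +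
        3 / 32 / ρ ^ 5 * (2 * inner ℝ (x - x') (u - w)) ^ 2 - 3 / 8 / ρ * (2 * ‖u - w‖ ^ 2) ≤
        (‖u - w‖ ^ 2 - inner ℝ (x - x') (u - w) ^ 2 / ρ ^ 4) / ρ ^ 2 -
        3 / 8 / ρ * (inner ℝ (x - x') (u - w) ^ 2 / ρ ^ 4) := by
      have h3 := mul_le_mul_of_nonneg_left hI (by positivity : 0 ≤ 3 / 4 / ρ ^ 5)
      rw [← sub_nonneg] at h3 ⊢
      refine h3.trans_eq ?_
      field_simp
      ring
    have h3 := mul_le_mul_of_nonneg_left h2 (by positivity : (0 : ℝ) ≤ 1000 * d)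
    refine (add_le_add h3 h1).trans_eq ?_
    ring

section DoublingCore

variable {d : ℕ} {ℓ : Fin d} {x x' : EuclideanSpace ℝ (Fin d)}

lemma HasJet.unique {f : ℝ → ℝ} {a b c a' b' c' : ℝ} (h : HasJet f a b c)
    (h' : HasJet f a' b' c') : b = b' ∧ c = c' := by
  obtain ⟨h0, g, h1, h2, h3⟩ := h
  obtain ⟨k0, g', k1, k2, k3⟩ := h'
  have e : g =ᶠ[𝓝 0] g' := by
    filter_upwards [h1, k1] with t ht kt using ht.unique kt
  refine ⟨by rw [← h2, ← k2, e.self_of_nhds], ?_⟩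
  exact h3.unique (k3.congr_of_eventuallyEq e)

lemma sum_sq_coord (γ : EuclideanSpace ℝ (Fin d)) : ∑ k, γ k ^ 2 = ‖γ‖ ^ 2 :=
  (EuclideanSpace.real_norm_sq_eq γ).symm

lemma sum_mul_coord (x y : EuclideanSpace ℝ (Fin d)) : ∑ k, x k * y k = inner ℝ x y := by
  simp [PiLp.inner_apply, mul_comm]

lemma inner_perturbed (x γ p : EuclideanSpace ℝ (Fin d)) (k : Fin d) :
    inner ℝ x (EuclideanSpace.single k 1 + γ k • p) = x k + γ k * inner ℝ x p := by
  rw [inner_add_right, inner_smul_right, EuclideanSpace.inner_single_right]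
  simp

lemma norm_sq_perturbed (γ : EuclideanSpace ℝ (Fin d)) {p : EuclideanSpace ℝ (Fin d)}
    (hp : ‖p‖ = 1) (k : Fin d) :
    ‖(EuclideanSpace.single k 1 + γ k • p : EuclideanSpace ℝ (Fin d))‖ ^ 2 =
      1 + 2 * (γ k * p k) + γ k ^ 2 := by
  rw [norm_add_sq_real, inner_smul_right, EuclideanSpace.inner_single_left, norm_smul, hp,
    PiLp.norm_single, mul_one, Real.norm_eq_abs, sq_abs]
  simp

lemma sum_inner_perturbed_sq (x γ p : EuclideanSpace ℝ (Fin d)) :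
    ∑ k, inner ℝ x (EuclideanSpace.single k 1 + γ k • p) ^ 2 =
      ‖x‖ ^ 2 + 2 * (inner ℝ x γ * inner ℝ x p) + ‖γ‖ ^ 2 * inner ℝ x p ^ 2 := by
  have h : ∀ k, inner ℝ x (EuclideanSpace.single k 1 + γ k • p) ^ 2 =
      x k ^ 2 + (2 * inner ℝ x p) * (x k * γ k) + inner ℝ x p ^ 2 * γ k ^ 2 := fun k => by
    rw [inner_perturbed]; ring
  simp only [h, Finset.sum_add_distrib, ← Finset.mul_sum, sum_sq_coord, sum_mul_coord]
  ring

lemma sum_norm_perturbed_sq (γ : EuclideanSpace ℝ (Fin d)) {p : EuclideanSpace ℝ (Fin d)}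
    (hp : ‖p‖ = 1) :
    ∑ k, ‖(EuclideanSpace.single k 1 + γ k • p : EuclideanSpace ℝ (Fin d))‖ ^ 2 =
      d + 2 * inner ℝ γ p + ‖γ‖ ^ 2 := by
  simp only [norm_sq_perturbed γ hp, Finset.sum_add_distrib, ← Finset.mul_sum, sum_sq_coord,
    sum_mul_coord]
  simp

/-- The radial barrier used to exclude the origin. -/
def radBar (x : EuclideanSpace ℝ (Fin d)) : ℝ := (‖x‖ ^ 2) ^ (-(1 / 4) : ℝ)

lemma jet_radBar (hx : x ≠ 0) (ξ : EuclideanSpace ℝ (Fin d)) :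
    HasJet (fun t : ℝ => radBar (x + t • ξ)) (radBar x)
      (-(1 / 4) * (‖x‖ ^ 2) ^ (-(1 / 4) - 1 : ℝ) * (2 * inner ℝ x ξ))
      ((‖x‖ ^ 2) ^ (-(1 / 4) - 2 : ℝ) *
        (5 / 4 * inner ℝ x ξ ^ 2 - 1 / 2 * (‖x‖ ^ 2 * ‖ξ‖ ^ 2))) := by
  have hq : 0 < ‖x‖ ^ 2 := by have := norm_pos_iff.2 hx; positivity
  refine ((jet_norm_sq x ξ).rpow hq (-(1 / 4))).congr_val rfl rfl ?_
  have h : (‖x‖ ^ 2) ^ (-(1 / 4) - 1 : ℝ) = (‖x‖ ^ 2) ^ (-(1 / 4) - 2 : ℝ) * ‖x‖ ^ 2 := by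
    rw [← rpow_add_one hq.ne']; norm_num
  rw [h]
  ring

lemma contDiffAt_radBar (hx : x ≠ 0) : ContDiffAt ℝ 2 radBar x := by
  have hq : ‖x‖ ^ 2 ≠ 0 := by have := norm_pos_iff.2 hx; positivity
  exact (contDiff_norm_sq ℝ).contDiffAt.rpow_const_of_ne hq

lemma sum_radBar_nonpos (hd : 3 ≤ d) {γ p : EuclideanSpace ℝ (Fin d)} (hp : ‖p‖ = 1)
    (hγ : ‖γ‖ ≤ 1 / 100) :
    ∑ k, (‖x‖ ^ 2) ^ (-(1 / 4) - 2 : ℝ) *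
      (5 / 4 * inner ℝ x (EuclideanSpace.single k 1 + γ k • p) ^ 2 -
        1 / 2 * (‖x‖ ^ 2 *
          ‖(EuclideanSpace.single k 1 + γ k • p : EuclideanSpace ℝ (Fin d))‖ ^ 2)) ≤ 0 := by
  rw [← Finset.mul_sum, Finset.sum_sub_distrib, ← Finset.mul_sum, ← Finset.mul_sum,
    ← Finset.mul_sum, sum_inner_perturbed_sq, sum_norm_perturbed_sq γ hp]
  refine mul_nonpos_of_nonneg_of_nonpos (by positivity) ?_
  have hd' : (3 : ℝ) ≤ d := by exact_mod_cast hd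
  have a1 : |inner ℝ x γ| ≤ ‖x‖ * ‖γ‖ := abs_real_inner_le_norm x γ
  have a2 : |inner ℝ x p| ≤ ‖x‖ := by simpa [hp] using abs_real_inner_le_norm x p
  have a3 : |inner ℝ γ p| ≤ ‖γ‖ := by simpa [hp] using abs_real_inner_le_norm γ p
  have b1 : inner ℝ x γ * inner ℝ x p ≤ ‖x‖ ^ 2 * (1 / 100) := by
    refine (le_abs_self _).trans ?_
    rw [abs_mul]
    calc _ ≤ (‖x‖ * ‖γ‖) * ‖x‖ := by gcongr
      _ ≤ (‖x‖ * (1 / 100)) * ‖x‖ := by gcongr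
      _ = _ := by ring
  have b2 : ‖γ‖ ^ 2 * inner ℝ x p ^ 2 ≤ (1 / 100) ^ 2 * ‖x‖ ^ 2 := by
    rw [← sq_abs (inner ℝ x p)]; gcongr
  have b3 : 3 - 2 / 100 ≤ d + 2 * inner ℝ γ p + ‖γ‖ ^ 2 := by
    linarith [(abs_le.1 a3).1, sq_nonneg ‖γ‖]
  have b4 := mul_le_mul_of_nonneg_left b3 (sq_nonneg ‖x‖)
  have b5 := sq_nonneg ‖x‖
  linarith

/-- A pair of sub- and supersolutions has no penalized interior local maximum. -/
lemma not_isLocalMax_doubling (hd : 0 < d) {F G : EuclideanSpace ℝ (Fin d) → ℝ}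
    (hF : ContDiffAt ℝ 2 F x) (hG : ContDiffAt ℝ 2 G x')
    {p γ p' γ' : EuclideanSpace ℝ (Fin d)} (hp : ‖p‖ = 1) (hp' : ‖p'‖ = 1)
    (hγ : ‖γ‖ ≤ 1 / 100 * ‖x‖ ^ 2) (hγ' : ‖γ'‖ ≤ 1 / 100 * ‖x'‖ ^ 2)
    (h1 : -1 ≤ ∑ k, fderiv ℝ (fderiv ℝ F) x (EuclideanSpace.single k 1 + γ k • p)
      (EuclideanSpace.single k 1 + γ k • p))
    (h2 : ∑ k, fderiv ℝ (fderiv ℝ G) x' (EuclideanSpace.single k 1 + γ' k • p')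
      (EuclideanSpace.single k 1 + γ' k • p') ≤ 1)
    {ρ σ : ℝ} (hρ : 0 < ρ) (hσ : 0 < σ) (hρ1 : ρ ≤ 1) (hσ1 : σ ≤ 1) (hD : ‖x - x'‖ = ρ ^ 2)
    (hQ : ‖x‖ ^ 2 + ‖x'‖ ^ 2 = σ ^ 4) (hρσ : σ ^ 5 ≤ 100 * ρ ^ 2) (hx : 0 ≤ x ℓ) (hx' : 0 ≤ x' ℓ)
    (hmax : ∀ ξ ζ : EuclideanSpace ℝ (Fin d), IsLocalMax (fun t : ℝ =>
      F (x + t • ξ) - G (x' + t • ζ) - doublePen ℓ (x + t • ξ) (x' + t • ζ)) 0) : False := by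
  set e : EuclideanSpace ℝ (Fin d) := (1 / ρ ^ 2) • (x - x') with he
  have hρ2 : 0 < ρ ^ 2 := by positivity
  have hen : ‖e‖ = 1 := by
    rw [he, norm_smul, hD, Real.norm_eq_abs, abs_of_pos (by positivity)]; field_simp
  set R : Fin d → EuclideanSpace ℝ (Fin d) := fun k =>
    EuclideanSpace.single k 1 - (2 * e k) • e with hR
  set g : Fin d → ℝ := fun k => inner ℝ γ' (R k) with hg
  set H : Fin d → EuclideanSpace ℝ (Fin d) := fun k => EuclideanSpace.single k 1 + γ k • p with hH
  set Z : Fin d → EuclideanSpace ℝ (Fin d) := fun k => R k + g k • p' with hZ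
  have hgsum : ∑ k, g k ^ 2 = ‖γ'‖ ^ 2 := by
    have := sum_reflect ((innerSL ℝ γ').smulRight (innerSL ℝ γ')) hen
    simp only [ContinuousLinearMap.smulRight_apply, _root_.smul_apply, smul_eq_mul,
      innerSL_apply_apply, EuclideanSpace.inner_single_right, conj_trivial, one_mul] at this
    rw [← sum_sq_coord γ']
    simp only [_root_.pow_two]
    exact this
  have hGsum : ∑ k, fderiv ℝ (fderiv ℝ G) x' (Z k) (Z k) ≤ 1 := by
    set T : EuclideanSpace ℝ (Fin d) →L[ℝ] EuclideanSpace ℝ (Fin d) :=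
      ContinuousLinearMap.id ℝ _ + (innerSL ℝ γ').smulRight p' with hT
    have hTa : ∀ z, T z = z + (inner ℝ γ' z) • p' := fun z => by
      simp [hT]
    have := sum_reflect ((fderiv ℝ (fderiv ℝ G) x').bilinearComp T T) hen
    simp only [ContinuousLinearMap.bilinearComp_apply, hTa,
      EuclideanSpace.inner_single_right, conj_trivial, one_mul] at this
    exact this.trans_le h2
  have hRn : ∀ k, ‖R k‖ ^ 2 = 1 := fun k => by
    rw [hR, norm_sub_sq_real, inner_smul_right, EuclideanSpace.inner_single_left, norm_smul, hen,
      PiLp.norm_single, mul_one, Real.norm_eq_abs, sq_abs]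
    simp only [conj_trivial, one_mul, norm_mul, Real.norm_eq_abs, mul_pow, sq_abs]
    norm_num
    ring
  have hHn : ∀ k, ‖H k‖ ^ 2 ≤ 2 * (1 + γ k ^ 2) := fun k => by
    rw [hH, norm_sq_perturbed γ hp]
    have := sq_coord_le p k
    rw [hp] at this
    nlinarith only [this, sq_nonneg (γ k - p k)]
  have hZn : ∀ k, ‖Z k‖ ^ 2 ≤ 2 * (1 + g k ^ 2) := fun k => by
    have a1 : ‖Z k‖ ≤ ‖R k‖ + |g k| := by
      refine (norm_add_le _ _).trans_eq ?_
      rw [norm_smul, hp', Real.norm_eq_abs, mul_one]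
    have a2 := hRn k
    have a3 := sq_abs (g k)
    calc ‖Z k‖ ^ 2 ≤ (‖R k‖ + |g k|) ^ 2 := by gcongr
      _ ≤ _ := by nlinarith only [a2, a3, sq_nonneg (‖R k‖ - |g k|)]
  set μ : Fin d → EuclideanSpace ℝ (Fin d) := fun k => γ k • p - g k • p' with hμ
  have hμn : ∀ k, ‖μ k‖ ^ 2 ≤ 2 * (γ k ^ 2 + g k ^ 2) := fun k => by
    have a1 : ‖μ k‖ ≤ |γ k| + |g k| := by
      refine (norm_sub_le _ _).trans_eq ?_
      rw [norm_smul, norm_smul, hp', hp, Real.norm_eq_abs, Real.norm_eq_abs, mul_one, mul_one]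
    have a2 := sq_abs (γ k)
    have a3 := sq_abs (g k)
    calc ‖μ k‖ ^ 2 ≤ (|γ k| + |g k|) ^ 2 := by gcongr
      _ ≤ _ := by nlinarith only [a2, a3, sq_nonneg (|γ k| - |g k|)]
  have hξ : ∀ k, H k - Z k = (2 * e k) • e + μ k := fun k => by
    simp only [hH, hZ, hR, hμ]; abel
  have hxe : x - x' = ρ ^ 2 • e := by
    rw [he, smul_smul]; field_simp; simp
  have hin : ∀ k, inner ℝ (x - x') (H k - Z k) ^ 2 / ρ ^ 4 = (2 * e k + inner ℝ e (μ k)) ^ 2 :=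
    fun k => by
      rw [hxe, hξ, inner_smul_left, inner_add_right, inner_smul_right,
        real_inner_self_eq_norm_sq, hen]
      simp
      field_simp
  have hnξ : ∀ k, ‖H k - Z k‖ ^ 2 = (2 * e k + inner ℝ e (μ k)) ^ 2 +
      (‖μ k‖ ^ 2 - inner ℝ e (μ k) ^ 2) := fun k => by
    rw [hξ, norm_add_sq_real, inner_smul_left, norm_smul, hen, Real.norm_eq_abs, mul_one, sq_abs]
    simp
    ring
  have hS : ∀ k, fderiv ℝ (fderiv ℝ F) x (H k) (H k) - fderiv ℝ (fderiv ℝ G) x' (Z k) (Z k) ≤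
      1000 * d * (2 * (γ k ^ 2 + g k ^ 2) / ρ ^ 2 -
        3 / 8 / ρ * (2 * e k ^ 2 - 2 * (γ k ^ 2 + g k ^ 2))) +
        6 * (4 + 2 * (γ k ^ 2 + g k ^ 2)) / σ := fun k => by
    obtain ⟨S, hS1, hS2⟩ := jet_doublePen (ℓ := ℓ) hρ hσ hD hQ hx hx' (H k) (Z k)
    have hc := (((HasJet.of_contDiffAt hF (H k)).sub (HasJet.of_contDiffAt hG (Z k))).sub
      hS1).nonpos_of_isLocalMax (hmax (H k) (Z k))
    refine (by linarith : _ ≤ S).trans (hS2.trans ?_)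
    rw [hin, hnξ]
    have a1 := hμn k
    have a2 : inner ℝ e (μ k) ^ 2 ≤ ‖μ k‖ ^ 2 := by
      rw [← sq_abs]
      have := abs_real_inner_le_norm e (μ k)
      rw [hen, one_mul] at this
      gcongr
    have a3 : 2 * e k ^ 2 - 2 * (γ k ^ 2 + g k ^ 2) ≤ (2 * e k + inner ℝ e (μ k)) ^ 2 := by
      nlinarith only [a1, a2, sq_nonneg (e k + inner ℝ e (μ k))]
    have a4 : ‖H k‖ ^ 2 + ‖Z k‖ ^ 2 ≤ 4 + 2 * (γ k ^ 2 + g k ^ 2) := by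
      linarith [hHn k, hZn k]
    have a5 : (2 * e k + inner ℝ e (μ k)) ^ 2 + (‖μ k‖ ^ 2 - inner ℝ e (μ k) ^ 2) -
        (2 * e k + inner ℝ e (μ k)) ^ 2 ≤ 2 * (γ k ^ 2 + g k ^ 2) := by
      linarith [sq_nonneg (inner ℝ e (μ k))]
    gcongr
  have hsum := Finset.sum_le_sum fun k (_ : k ∈ Finset.univ) => hS k
  have hesum : ∑ k, e k ^ 2 = 1 := by rw [sum_sq_coord, hen]; norm_num
  have hγsum := sum_sq_coord γ
  set N : ℝ := ‖γ‖ ^ 2 + ‖γ'‖ ^ 2 with hN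
  have hsum2 : ∑ k, (1000 * d * (2 * (γ k ^ 2 + g k ^ 2) / ρ ^ 2 -
        3 / 8 / ρ * (2 * e k ^ 2 - 2 * (γ k ^ 2 + g k ^ 2))) +
        6 * (4 + 2 * (γ k ^ 2 + g k ^ 2)) / σ) =
      1000 * d * (2 * N / ρ ^ 2 - 3 / 8 / ρ * (2 - 2 * N)) + 6 * (4 * d + 2 * N) / σ := by
    have : ∀ k, (1000 * d * (2 * (γ k ^ 2 + g k ^ 2) / ρ ^ 2 -
        3 / 8 / ρ * (2 * e k ^ 2 - 2 * (γ k ^ 2 + g k ^ 2))) +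
        6 * (4 + 2 * (γ k ^ 2 + g k ^ 2)) / σ) =
        (1000 * d * (2 / ρ ^ 2 + 3 / 4 / ρ) + 12 / σ) * (γ k ^ 2 + g k ^ 2) -
          1000 * d * (3 / 4 / ρ) * e k ^ 2 + 24 / σ := fun k => by ring
    simp only [this, Finset.sum_add_distrib, Finset.sum_sub_distrib, ← Finset.mul_sum, hγsum,
      hgsum, hesum]
    simp
    ring
  rw [hsum2, Finset.sum_sub_distrib] at hsum
  have hlow : -2 ≤ 1000 * d * (2 * N / ρ ^ 2 - 3 / 8 / ρ * (2 - 2 * N)) +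
      6 * (4 * d + 2 * N) / σ := by
    refine le_trans ?_ hsum
    linarith
  have hd1 : (1 : ℝ) ≤ d := by exact_mod_cast hd
  have hNb : N ≤ 1 / 100 * ρ ^ 2 := by
    have b1 : ‖γ‖ ^ 2 ≤ (1 / 100 * ‖x‖ ^ 2) ^ 2 := by gcongr
    have b2 : ‖γ'‖ ^ 2 ≤ (1 / 100 * ‖x'‖ ^ 2) ^ 2 := by gcongr
    have b3 : (‖x‖ ^ 2) ^ 2 + (‖x'‖ ^ 2) ^ 2 ≤ (σ ^ 4) ^ 2 := by
      rw [← hQ]; nlinarith only [mul_nonneg (sq_nonneg ‖x‖) (sq_nonneg ‖x'‖)]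
    have b4 : (σ ^ 4) ^ 2 ≤ σ ^ 5 := by
      calc (σ ^ 4) ^ 2 = σ ^ 5 * σ ^ 3 := by ring
        _ ≤ σ ^ 5 * 1 := by gcongr; exact pow_le_one₀ hσ.le hσ1
        _ = _ := mul_one _
    have b5 : N ≤ 1 / 100 ^ 2 * ((‖x‖ ^ 2) ^ 2 + (‖x'‖ ^ 2) ^ 2) := by
      rw [hN]; linarith
    linarith
  have hρσ2 : ρ ≤ 6 / 5 * σ := by
    have b1 : ρ ^ 4 ≤ 2 * σ ^ 4 := by
      have := norm_sub_le x x'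
      rw [hD] at this
      have h3 : (ρ ^ 2) ^ 2 ≤ (‖x‖ + ‖x'‖) ^ 2 := by gcongr
      nlinarith only [h3, hQ, sq_nonneg (‖x‖ - ‖x'‖)]
    by_contra! hcon
    have : (6 / 5 * σ) ^ 4 < ρ ^ 4 := by gcongr
    nlinarith only [this, b1, pow_pos hσ 4]
  have hN0 : 0 ≤ N := by positivity
  have hN1 : N ≤ 1 / 100 := hNb.trans (by nlinarith only [hρ1, hρ])
  have c1 : 2 * N / ρ ^ 2 ≤ 2 / 100 := by
    rw [div_le_iff₀ hρ2]; linarith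
  have c2 : 1 / σ ≤ 6 / 5 * (1 / ρ) := by
    rw [mul_one_div, div_le_div_iff₀ hσ hρ]; linarith
  have c3 : 6 * (4 * d + 2 * N) / σ ≤ 36 * d * (1 / ρ) := by
    calc 6 * (4 * d + 2 * N) / σ = 6 * (4 * d + 2 * N) * (1 / σ) := by ring
      _ ≤ 6 * (5 * d) * (6 / 5 * (1 / ρ)) := by gcongr; linarith
      _ = _ := by ring
  have c4 : 1 ≤ 1 / ρ := by rw [le_div_iff₀ hρ]; linarith
  have c5 : 7 / 10 * (1 / ρ) ≤ 3 / 8 / ρ * (2 - 2 * N) := by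
    calc 7 / 10 * (1 / ρ) ≤ 3 / 8 * (2 - 2 * N) * (1 / ρ) := by gcongr; linarith
      _ = _ := by ring
  have c6 : 1000 * d * (2 * N / ρ ^ 2 - 3 / 8 / ρ * (2 - 2 * N)) ≤
      1000 * d * (2 / 100 * (1 / ρ) - 7 / 10 * (1 / ρ)) := by
    gcongr; linarith
  have c7 : 1 ≤ d * (1 / ρ) := by nlinarith only [hd1, c4]
  nlinarith only [c6, c7, c3, hlow]

end DoublingCore

section DoublingGlobal

variable {d : ℕ} {ℓ : Fin d} {u : EuclideanSpace ℝ (Fin d) → ℝ} {x x' : EuclideanSpace ℝ (Fin d)}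

/-- Bounded functions on a punctured half ball which almost solve a Neumann problem. -/
structure NearNeumann (ℓ : Fin d) (u : EuclideanSpace ℝ (Fin d) → ℝ) : Prop where
  smooth : ∀ x, 0 ≤ x ℓ → x ≠ 0 → ‖x‖ ≤ 1 / 2 → ContDiffAt ℝ 2 u x
  bound : ∀ x, 0 ≤ x ℓ → x ≠ 0 → ‖x‖ ≤ 1 / 2 → |u x| ≤ 1
  grad : ∀ x, 0 ≤ x ℓ → x ≠ 0 → ‖x‖ ≤ 1 / 2 → ‖fderiv ℝ u x‖ * ‖x‖ ≤ 1
  pde : ∀ x, 0 ≤ x ℓ → x ≠ 0 → ‖x‖ ≤ 1 / 2 → ∃ p γ : EuclideanSpace ℝ (Fin d), ‖p‖ = 1 ∧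
    ‖γ‖ ≤ 1 / 100 * ‖x‖ ^ 2 ∧
    |∑ k, fderiv ℝ (fderiv ℝ u) x (EuclideanSpace.single k 1 + γ k • p)
      (EuclideanSpace.single k 1 + γ k • p)| ≤ 1
  bdry : ∀ x, x ℓ = 0 → x ≠ 0 → ‖x‖ ≤ 1 / 2 → 0 ≤ pd ℓ u x ∧ pd ℓ u x ≤ 1 / 4 * ‖x‖

lemma HasJet.nonpos_of_le_right {f : ℝ → ℝ} {a b c : ℝ} (h : HasJet f a b c)
    (hf : ∀ᶠ t in 𝓝[>] (0 : ℝ), f t ≤ f 0) : b ≤ 0 := by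
  obtain ⟨-, f', h1, h2, -⟩ := h
  have hd : HasDerivAt f b 0 := h2 ▸ h1.self_of_nhds
  have hs : Tendsto (fun t => t⁻¹ • (f (0 + t) - f 0)) (𝓝[>] 0) (𝓝 b) :=
    hd.tendsto_slope_zero_right
  refine le_of_tendsto hs ?_
  filter_upwards [hf, self_mem_nhdsWithin] with t ht h0
  have h0 : (0 : ℝ) < t := h0
  rw [zero_add, smul_eq_mul]
  exact mul_nonpos_of_nonneg_of_nonpos (by positivity) (by linarith)

lemma doublePen_lower (hx : ‖x‖ ≤ 1 / 2) (hx' : ‖x'‖ ≤ 1 / 2) :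
    500 * d * ‖x - x'‖ + (‖x‖ ^ 2 + ‖x'‖ ^ 2) ^ (3 / 4 : ℝ) ≤ doublePen ℓ x x' := by
  set r := ‖x - x'‖ with hr
  set Q := ‖x‖ ^ 2 + ‖x'‖ ^ 2 with hQ
  have hr0 : 0 ≤ r := norm_nonneg _
  have hQ0 : 0 ≤ Q := by positivity
  have hr1 : r ≤ 1 := (norm_sub_le _ _).trans (by linarith)
  have e1 : (r ^ 2) ^ (1 / 2 : ℝ) = r := by
    rw [← rpow_natCast, ← rpow_mul hr0]; norm_num
  have e2 : (r ^ 2) ^ (3 / 4 : ℝ) ≤ r := by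
    rw [← rpow_natCast, ← rpow_mul hr0]
    conv_rhs => rw [← rpow_one r]
    exact rpow_le_rpow_of_exponent_ge' hr0 hr1 zero_le_one (by norm_num)
  have e3 : x ℓ + x' ℓ ≤ 2 * Q ^ (1 / 2 : ℝ) := by
    rw [← sqrt_eq_rpow]
    have a1 : x ℓ ≤ √Q := le_sqrt_of_sq_le (by linarith [sq_coord_le x ℓ, sq_nonneg ‖x'‖])
    have a2 : x' ℓ ≤ √Q := le_sqrt_of_sq_le (by linarith [sq_coord_le x' ℓ, sq_nonneg ‖x‖])
    linarith
  have e4 : Q ^ (1 / 2 : ℝ) * Q ^ (1 / 4 : ℝ) = Q ^ (3 / 4 : ℝ) := by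
    rw [← rpow_add' hQ0 (by norm_num)]; norm_num
  have e5 : (x ℓ + x' ℓ) * Q ^ (1 / 4 : ℝ) ≤ 2 * Q ^ (3 / 4 : ℝ) := by
    rw [← e4, ← mul_assoc]; gcongr
  rw [doublePen, ← hr, ← hQ, e1]
  have e6 : 500 * d * r ≤ 1000 * d * (r - 1 / 2 * (r ^ 2) ^ (3 / 4 : ℝ)) := by
    calc 500 * d * r = 1000 * d * (r - 1 / 2 * r) := by ring
      _ ≤ _ := by gcongr
  linarith

lemma doublePen_upper (h0 : 0 ≤ x ℓ) (h0' : 0 ≤ x' ℓ) (hx : ‖x‖ ≤ 1 / 2) (hx' : ‖x'‖ ≤ 1 / 2) :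
    doublePen ℓ x x' ≤ (1000 * d + 2) * (‖x‖ + ‖x'‖) := by
  have hr := norm_sub_le x x'
  rw [doublePen]
  set r := ‖x - x'‖
  set Q := ‖x‖ ^ 2 + ‖x'‖ ^ 2 with hQ
  have hr0 : 0 ≤ r := norm_nonneg _
  have hQ0 : 0 ≤ Q := by positivity
  have e1 : (r ^ 2) ^ (1 / 2 : ℝ) = r := by
    rw [← rpow_natCast, ← rpow_mul hr0]; norm_num
  have e2 : 0 ≤ (r ^ 2) ^ (3 / 4 : ℝ) := by positivity
  have hQ1 : Q ≤ 1 := by nlinarith only [hx, hx', norm_nonneg x, norm_nonneg x', hQ]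
  have e3 : Q ^ (3 / 4 : ℝ) ≤ ‖x‖ + ‖x'‖ := by
    calc Q ^ (3 / 4 : ℝ) ≤ Q ^ (1 / 2 : ℝ) :=
          rpow_le_rpow_of_exponent_ge' hQ0 hQ1 (by norm_num) (by norm_num)
      _ = √Q := (sqrt_eq_rpow Q).symm
      _ ≤ ‖x‖ + ‖x'‖ := by
        refine sqrt_le_iff.2 ⟨by positivity, ?_⟩
        nlinarith only [hQ, mul_nonneg (norm_nonneg x) (norm_nonneg x')]
  have e4 : 0 ≤ (x ℓ + x' ℓ) * Q ^ (1 / 4 : ℝ) := by positivity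
  have e5 : 1000 * d * (r - 1 / 2 * (r ^ 2) ^ (3 / 4 : ℝ)) ≤ 1000 * d * (‖x‖ + ‖x'‖) := by
    gcongr; linarith
  rw [e1]
  linarith

lemma NearNeumann.abs_sub_le (hu : NearNeumann ℓ u) (h0 : 0 ≤ x ℓ) (h0' : 0 ≤ x' ℓ)
    (hx : ‖x‖ ≤ 1 / 2) (hx' : ‖x'‖ ≤ 1 / 2) {b : EuclideanSpace ℝ (Fin d)} {n : ℝ} (hn : 0 < n)
    (hb : n ≤ ‖b‖) (h1 : ‖x - b‖ ≤ n / 2) (h1' : ‖x' - b‖ ≤ n / 2) :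
    |u x - u x'| ≤ 2 / n * ‖x - x'‖ := by
  set S : Set (EuclideanSpace ℝ (Fin d)) :=
    {z | 0 ≤ z ℓ} ∩ (Metric.closedBall 0 (1 / 2) ∩ Metric.closedBall b (n / 2)) with hS
  have hc : Convex ℝ S := by
    refine Convex.inter ?_ ((convex_closedBall _ _).inter (convex_closedBall _ _))
    exact convex_halfSpace_ge (𝕜 := ℝ) ⟨fun _ _ => rfl, fun _ _ => rfl⟩ 0
  have hz : ∀ z ∈ S, n / 2 ≤ ‖z‖ ∧ 0 ≤ z ℓ ∧ ‖z‖ ≤ 1 / 2 := fun z hz => by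
    obtain ⟨a1, a2, a3⟩ := hz
    rw [mem_closedBall_iff_norm] at a2 a3
    rw [sub_zero] at a2
    refine ⟨?_, a1, a2⟩
    have := norm_sub_norm_le b z
    rw [norm_sub_rev] at this
    linarith
  have hm : ∀ z, 0 ≤ z ℓ → ‖z‖ ≤ 1 / 2 → ‖z - b‖ ≤ n / 2 → z ∈ S := fun z a1 a2 a3 =>
    ⟨a1, by rwa [mem_closedBall_iff_norm, sub_zero], by rwa [mem_closedBall_iff_norm]⟩
  have hne : ∀ z ∈ S, z ≠ 0 := fun z h => norm_pos_iff.1 (by linarith [(hz z h).1])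
  have := hc.norm_image_sub_le_of_norm_fderiv_le (𝕜 := ℝ) (f := u) (C := 2 / n)
    (fun z h => (hu.smooth z (hz z h).2.1 (hne z h) (hz z h).2.2).differentiableAt (by norm_num))
    (fun z h => by
      have a1 := hu.grad z (hz z h).2.1 (hne z h) (hz z h).2.2
      have a2 : ‖fderiv ℝ u z‖ * (n / 2) ≤ 1 :=
        le_trans (by gcongr; exact (hz z h).1) a1
      rw [le_div_iff₀ hn]
      linarith) (hm x' h0' hx' h1') (hm x h0 hx h1)
  exact this

lemma NearNeumann.not_max (hd : 3 ≤ d) (hu : NearNeumann ℓ u) {ε δ : ℝ} (hε : 0 < ε) (hδ : 0 < δ)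
    (h0 : 0 ≤ x ℓ) (h0' : 0 ≤ x' ℓ) (hxδ : δ < ‖x‖) (hxδ' : δ < ‖x'‖)
    (hx : ‖x‖ ≤ 1 / 2) (hx' : ‖x'‖ ≤ 1 / 2)
    (hpos : 0 < u x - ε * radBar x - (u x' + ε * radBar x') - doublePen ℓ x x')
    (hmax : ∀ w w' : EuclideanSpace ℝ (Fin d), 0 ≤ w ℓ → δ ≤ ‖w‖ → ‖w‖ ≤ 1 / 2 →
      0 ≤ w' ℓ → δ ≤ ‖w'‖ → ‖w'‖ ≤ 1 / 2 →
      u w - ε * radBar w - (u w' + ε * radBar w') - doublePen ℓ w w' ≤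
      u x - ε * radBar x - (u x' + ε * radBar x') - doublePen ℓ x x') : False := by
  have hd3 : (3 : ℝ) ≤ d := by exact_mod_cast hd
  have hne : x ≠ 0 := norm_pos_iff.1 (hδ.trans hxδ)
  have hne' : x' ≠ 0 := norm_pos_iff.1 (hδ.trans hxδ')
  have hr0 : 0 ≤ ‖x - x'‖ := norm_nonneg _
  have hbar0 : ∀ z : EuclideanSpace ℝ (Fin d), 0 ≤ ε * radBar z := fun z => by
    rw [radBar]; positivity
  have hlow := doublePen_lower (ℓ := ℓ) hx hx'
  have hdiff : 500 * d * ‖x - x'‖ + (‖x‖ ^ 2 + ‖x'‖ ^ 2) ^ (3 / 4 : ℝ) < u x - u x' := by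
    linarith [hbar0 x, hbar0 x']
  set Q := ‖x‖ ^ 2 + ‖x'‖ ^ 2 with hQ
  have hQ0 : 0 < Q := by have := hδ.trans hxδ; positivity
  have hQ1 : Q ≤ 1 := by nlinarith only [hx, hx', norm_nonneg x, norm_nonneg x', hQ]
  have hQp : 0 < Q ^ (3 / 4 : ℝ) := by positivity
  obtain ⟨b, hb1, hb1', hb2, hb3, hb4⟩ : ∃ b : EuclideanSpace ℝ (Fin d), ‖x‖ ≤ ‖b‖ ∧ ‖x'‖ ≤ ‖b‖ ∧
      ‖b‖ ≤ 1 / 2 ∧ ‖x - b‖ ≤ ‖x - x'‖ ∧ ‖x' - b‖ ≤ ‖x - x'‖ := by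
    rcases le_total ‖x‖ ‖x'‖ with h | h
    · exact ⟨x', h, le_rfl, hx', le_rfl, by simp⟩
    · exact ⟨x, le_rfl, h, hx, by simp, (norm_sub_rev _ _).le⟩
  have hbn : 0 < ‖b‖ := (hδ.trans hxδ).trans_le hb1
  have hclose : ‖x - x'‖ ≤ ‖b‖ / 2 → u x - u x' ≤ 2 / ‖b‖ * ‖x - x'‖ := fun h =>
    (le_abs_self _).trans (hu.abs_sub_le h0 h0' hx hx' hbn le_rfl (hb3.trans h) (hb4.trans h))
  have hrpos : 0 < ‖x - x'‖ := by
    rcases hr0.eq_or_lt with h | h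
    · have := hclose (by rw [← h]; positivity)
      rw [← h] at this hdiff
      linarith
    · exact h
  have hsmall : ‖x - x'‖ < 1 / 750 := by
    have a1 := (abs_le.1 (hu.bound x h0 hne hx)).2
    have a2 := (abs_le.1 (hu.bound x' h0' hne' hx')).1
    have a3 : 500 * 3 * ‖x - x'‖ ≤ 500 * d * ‖x - x'‖ := by gcongr
    linarith
  have hbs : ‖b‖ < 1 / 4 := by
    by_contra! h
    have a1 := hclose (by linarith)
    have a2 : 2 / ‖b‖ ≤ 8 := by rw [div_le_iff₀ hbn]; linarith
    have a3 : 2 / ‖b‖ * ‖x - x'‖ ≤ 8 * ‖x - x'‖ := by gcongr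
    have a4 : 500 * 3 * ‖x - x'‖ ≤ 500 * d * ‖x - x'‖ := by gcongr
    linarith
  set ρ := √‖x - x'‖ with hρ
  have hρ0 : 0 < ρ := sqrt_pos.2 hrpos
  have hD : ‖x - x'‖ = ρ ^ 2 := (sq_sqrt hr0).symm
  have hρ1 : ρ ≤ 1 := sqrt_le_one.2 (by linarith)
  set σ := Q ^ (1 / 4 : ℝ) with hσ
  have hσ0 : 0 < σ := by positivity
  have hσ1 : σ ≤ 1 := rpow_le_one hQ0.le hQ1 (by norm_num)
  have hσ4 : Q = σ ^ 4 := by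
    rw [hσ, ← rpow_natCast, ← rpow_mul hQ0.le]; norm_num
  have hσ3 : Q ^ (3 / 4 : ℝ) = σ ^ 3 := by
    rw [hσ, ← rpow_natCast, ← rpow_mul hQ0.le]; norm_num
  have hbσ : σ ^ 2 ≤ 2 * ‖b‖ := by
    have : (σ ^ 2) ^ 2 ≤ (2 * ‖b‖) ^ 2 := by
      have a1 : ‖x‖ ^ 2 ≤ ‖b‖ ^ 2 := by gcongr
      have a2 : ‖x'‖ ^ 2 ≤ ‖b‖ ^ 2 := by gcongr
      have a3 : (σ ^ 2) ^ 2 = Q := by rw [hσ4]; ring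
      rw [a3]
      nlinarith only [a1, a2, hQ, sq_nonneg ‖b‖]
    exact abs_le_of_sq_le_sq' this (by positivity) |>.2
  have hρσ : σ ^ 5 ≤ 100 * ρ ^ 2 := by
    rw [← hD]
    have e1 : σ ^ 5 = σ ^ 3 * σ ^ 2 := by ring
    have e2 : σ ^ 3 ≤ 1 := pow_le_one₀ hσ0.le hσ1
    by_cases h : ‖x - x'‖ ≤ ‖b‖ / 2
    · have a1 := hclose h
      rw [hσ3] at hdiff
      have a2 : σ ^ 3 ≤ 2 / ‖b‖ * ‖x - x'‖ := by
        have : 0 ≤ 500 * d * ‖x - x'‖ := by positivity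
        linarith
      calc σ ^ 5 = σ ^ 3 * σ ^ 2 := e1
        _ ≤ (2 / ‖b‖ * ‖x - x'‖) * (2 * ‖b‖) := by gcongr
        _ = 4 * ‖x - x'‖ := by field_simp; ring
        _ ≤ _ := by linarith
    · push Not at h
      calc σ ^ 5 = σ ^ 3 * σ ^ 2 := e1
        _ ≤ 1 * (2 * ‖b‖) := by gcongr
        _ ≤ _ := by linarith
  have hU : ∀ c : ℝ, ContDiffAt ℝ 2 (fun z => u z + c * radBar z) x := fun c =>
    (hu.smooth x h0 hne hx).add (contDiffAt_const.mul (contDiffAt_radBar hne))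
  have hV : ∀ c : ℝ, ContDiffAt ℝ 2 (fun z => u z + c * radBar z) x' := fun c =>
    (hu.smooth x' h0' hne' hx').add (contDiffAt_const.mul (contDiffAt_radBar hne'))
  have hJ : ∀ ξ ζ : EuclideanSpace ℝ (Fin d), ∃ c, HasJet (fun t : ℝ =>
      u (x + t • ξ) - ε * radBar (x + t • ξ) - (u (x' + t • ζ) + ε * radBar (x' + t • ζ)) -
        doublePen ℓ (x + t • ξ) (x' + t • ζ))
      (u x - ε * radBar x - (u x' + ε * radBar x') - doublePen ℓ x x')
      (fderiv ℝ u x ξ - ε * (-(1 / 4) * (‖x‖ ^ 2) ^ (-(1 / 4) - 1 : ℝ) * (2 * inner ℝ x ξ)) -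
        (fderiv ℝ u x' ζ +
          ε * (-(1 / 4) * (‖x'‖ ^ 2) ^ (-(1 / 4) - 1 : ℝ) * (2 * inner ℝ x' ζ))) -
        (1000 * d * ((1 / 2 / ρ ^ 2 - 3 / 8 / ρ) * (2 * inner ℝ (x - x') (ξ - ζ))) +
        (3 / 2 / σ * (2 * (inner ℝ x ξ + inner ℝ x' ζ)) - 1 / 2 * ((ξ ℓ + ζ ℓ) * σ +
          (x ℓ + x' ℓ) * (1 / 4 / σ ^ 3 * (2 * (inner ℝ x ξ + inner ℝ x' ζ))))))) c := by
    intro ξ ζ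
    obtain ⟨S, hS, -⟩ := jet_doublePen (ℓ := ℓ) hρ0 hσ0 hD hσ4 h0 h0' ξ ζ
    exact ⟨_, (((HasJet.of_contDiffAt (hu.smooth x h0 hne hx) ξ).sub
      ((jet_radBar hne ξ).const_mul ε)).sub
      ((HasJet.of_contDiffAt (hu.smooth x' h0' hne' hx') ζ).add
      ((jet_radBar hne' ζ).const_mul ε))).sub hS⟩
  have htend : ∀ y ξ : EuclideanSpace ℝ (Fin d),
      Tendsto (fun t : ℝ => y + t • ξ) (𝓝 0) (𝓝 y) := fun y ξ => by
    have : Continuous fun t : ℝ => y + t • ξ := by fun_prop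
    simpa using this.tendsto 0
  have hnear : ∀ y ξ : EuclideanSpace ℝ (Fin d), δ < ‖y‖ → ‖y‖ < 1 / 2 →
      ∀ᶠ t : ℝ in 𝓝 0, δ ≤ ‖y + t • ξ‖ ∧ ‖y + t • ξ‖ ≤ 1 / 2 := fun y ξ h1 h2 => by
    have := (htend y ξ).norm
    filter_upwards [this.eventually (lt_mem_nhds h1), this.eventually (gt_mem_nhds h2)]
      with t a1 a2 using ⟨a1.le, a2.le⟩
  have hxs : ‖x‖ < 1 / 2 := by linarith
  have hxs' : ‖x'‖ < 1 / 2 := by linarith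
  have hcoef : 0 ≤ 1 / 2 / ρ ^ 2 - 3 / 8 / ρ := by
    have : 1 / 2 / ρ ^ 2 - 3 / 8 / ρ = (1 / 2 - 3 / 8 * ρ) / ρ ^ 2 := by field_simp
    rw [this]
    refine div_nonneg ?_ (by positivity)
    linarith
  have hz0 : ∀ z : EuclideanSpace ℝ (Fin d), inner ℝ z (EuclideanSpace.single ℓ (1 : ℝ)) = z ℓ :=
    fun z => by rw [EuclideanSpace.inner_single_right]; simp
  rcases h0.eq_or_lt with hx0 | hx0
  · obtain ⟨c, hc⟩ := hJ (EuclideanSpace.single ℓ 1) 0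
    have h := hc.nonpos_of_le_right (by
      have := (hnear x (EuclideanSpace.single ℓ 1) hxδ hxs).filter_mono (nhdsWithin_le_nhds (s := Ioi 0))
      filter_upwards [this, self_mem_nhdsWithin] with t ht ht0
      have ht0 : 0 < t := ht0
      have := hmax (x + t • EuclideanSpace.single ℓ 1) x' (by simp [← hx0, ht0.le])
        ht.1 ht.2 h0' hxδ'.le hx'
      simpa using this)
    have hb := (hu.bdry x hx0.symm hne hx).1
    rw [pd] at hb
    simp only [hz0, ← hx0, sub_zero, map_zero, inner_zero_right, PiLp.zero_apply,
      PiLp.sub_apply, mul_zero, add_zero, zero_sub] at h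
    simp only [PiLp.single_apply, if_true, one_mul, mul_neg] at h
    have : 0 ≤ 1000 * d * ((1 / 2 / ρ ^ 2 - 3 / 8 / ρ) * (2 * x' ℓ)) := by positivity
    linarith
  rcases h0'.eq_or_lt with hx0' | hx0'
  · obtain ⟨c, hc⟩ := hJ 0 (EuclideanSpace.single ℓ 1)
    have h := hc.nonpos_of_le_right (by
      have := (hnear x' (EuclideanSpace.single ℓ 1) hxδ' hxs').filter_mono (nhdsWithin_le_nhds (s := Ioi 0))
      filter_upwards [this, self_mem_nhdsWithin] with t ht ht0
      have ht0 : 0 < t := ht0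
      have := hmax x (x' + t • EuclideanSpace.single ℓ 1) h0 hxδ.le hx (by simp [← hx0', ht0.le])
        ht.1 ht.2
      simpa using this)
    have hb := (hu.bdry x' hx0'.symm hne' hx').2
    rw [pd] at hb
    simp only [hz0, ← hx0', sub_zero, map_zero, inner_zero_right, PiLp.zero_apply,
      PiLp.sub_apply, mul_zero, add_zero, zero_sub, inner_neg_right] at h
    simp only [PiLp.single_apply, if_true, one_mul, zero_add, mul_neg] at h
    have a1 : 0 ≤ 1000 * d * ((1 / 2 / ρ ^ 2 - 3 / 8 / ρ) * (2 * x ℓ)) := by positivity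
    have a2 : ‖x'‖ ≤ σ := by
      have : ‖x'‖ ^ 2 ≤ (σ ^ 2) ^ 2 := by
        rw [← pow_mul, ← hσ4, hQ]; linarith [sq_nonneg ‖x‖]
      have : ‖x'‖ ≤ σ ^ 2 := abs_le_of_sq_le_sq' this (by positivity) |>.2
      nlinarith only [this, hσ0, hσ1]
    linarith
  obtain ⟨p, γ, hp, hγ, hpde⟩ := hu.pde x h0 hne hx
  obtain ⟨p', γ', hp', hγ', hpde'⟩ := hu.pde x' h0' hne' hx'
  have hγs : ‖γ‖ ≤ 1 / 100 := hγ.trans (by nlinarith only [hx, norm_nonneg x])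
  have hγs' : ‖γ'‖ ≤ 1 / 100 := hγ'.trans (by nlinarith only [hx', norm_nonneg x'])
  have hsec : ∀ (c : ℝ) (z ξ : EuclideanSpace ℝ (Fin d)), 0 ≤ z ℓ → z ≠ 0 → ‖z‖ ≤ 1 / 2 →
      ContDiffAt ℝ 2 (fun z => u z + c * radBar z) z →
      fderiv ℝ (fderiv ℝ fun z => u z + c * radBar z) z ξ ξ = fderiv ℝ (fderiv ℝ u) z ξ ξ +
        c * ((‖z‖ ^ 2) ^ (-(1 / 4) - 2 : ℝ) *
        (5 / 4 * inner ℝ z ξ ^ 2 - 1 / 2 * (‖z‖ ^ 2 * ‖ξ‖ ^ 2))) := fun c z ξ a1 a2 a3 a4 =>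
    ((HasJet.of_contDiffAt a4 ξ).unique ((HasJet.of_contDiffAt (hu.smooth z a1 a2 a3) ξ).add
      ((jet_radBar a2 ξ).const_mul c))).2
  refine not_isLocalMax_doubling (by omega) (hU (-ε)) (hV ε) hp hp' hγ hγ' ?_ ?_ hρ0 hσ0 hρ1 hσ1
    hD hσ4 hρσ h0 h0' ?_
  · have a1 := sum_radBar_nonpos (x := x) hd hp hγs
    simp only [hsec _ _ _ h0 hne hx (hU (-ε)), Finset.sum_add_distrib, ← Finset.mul_sum] at a1 ⊢
    have a2 := (abs_le.1 hpde).1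
    nlinarith only [a1, a2, hε]
  · have a1 := sum_radBar_nonpos (x := x') hd hp' hγs'
    simp only [hsec _ _ _ h0' hne' hx' (hV ε), Finset.sum_add_distrib, ← Finset.mul_sum] at a1 ⊢
    have a2 := (abs_le.1 hpde').2
    nlinarith only [a1, a2, hε]
  · intro ξ ζ
    have b1 : ∀ (y η : EuclideanSpace ℝ (Fin d)), 0 < y ℓ → ∀ᶠ t : ℝ in 𝓝 0, 0 ≤ (y + t • η) ℓ := by
      intro y η hy
      have hcont : Continuous fun t : ℝ => (y + t • η) ℓ := by fun_prop
      have : Tendsto (fun t : ℝ => (y + t • η) ℓ) (𝓝 0) (𝓝 (y ℓ)) := by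
        simpa using hcont.tendsto 0
      filter_upwards [this.eventually (lt_mem_nhds hy)] with t ht using ht.le
    filter_upwards [b1 x ξ hx0, b1 x' ζ hx0', hnear x ξ hxδ hxs, hnear x' ζ hxδ' hxs']
      with t a1 a2 a3 a4
    have := hmax _ _ a1 a3.1 a3.2 a2 a4.1 a4.2
    simp only [zero_smul, add_zero]
    linarith

/-- The penalized difference is nonpositive. -/
lemma NearNeumann.doubling (hd : 3 ≤ d) (hu : NearNeumann ℓ u) {ε : ℝ} (hε : 0 < ε)
    (h0 : 0 ≤ x ℓ) (h0' : 0 ≤ x' ℓ) (hne : x ≠ 0) (hne' : x' ≠ 0)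
    (hx : ‖x‖ ≤ 1 / 2) (hx' : ‖x'‖ ≤ 1 / 2) :
    u x - u x' - ε * (radBar x + radBar x') ≤ doublePen ℓ x x' := by
  by_contra! hcon
  set Φ : EuclideanSpace ℝ (Fin d) × EuclideanSpace ℝ (Fin d) → ℝ := fun z =>
    u z.1 - ε * radBar z.1 - (u z.2 + ε * radBar z.2) - doublePen ℓ z.1 z.2 with hΦ
  set δ : ℝ := (ε / 3) ^ 2 with hδ
  have hδ0 : 0 < δ := by positivity
  have hbar : ∀ z : EuclideanSpace ℝ (Fin d), z ≠ 0 → ‖z‖ ≤ δ → 3 ≤ ε * radBar z := by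
    intro z hz hzδ
    have hz0 : 0 < ‖z‖ := norm_pos_iff.2 hz
    have a1 : (δ ^ 2) ^ (-(1 / 4) : ℝ) ≤ radBar z :=
      rpow_le_rpow_of_nonpos (by positivity) (by gcongr) (by norm_num)
    have a2 : (δ ^ 2) ^ (-(1 / 4) : ℝ) = 3 / ε := by
      rw [hδ, ← pow_mul, ← rpow_natCast, ← rpow_mul (by positivity)]
      norm_num
      rw [rpow_neg_one, inv_div]
    calc 3 = ε * (3 / ε) := by field_simp
      _ ≤ _ := by rw [← a2]; gcongr
  have hbar0 : ∀ z : EuclideanSpace ℝ (Fin d), 0 ≤ radBar z := fun z => by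
    rw [radBar]; positivity
  have hfar : ∀ z z' : EuclideanSpace ℝ (Fin d), 0 ≤ z ℓ → 0 ≤ z' ℓ → z ≠ 0 → z' ≠ 0 →
      ‖z‖ ≤ 1 / 2 → ‖z'‖ ≤ 1 / 2 → 0 < Φ (z, z') → δ < ‖z‖ ∧ δ < ‖z'‖ := by
    intro z z' a1 a2 a3 a4 a5 a6 a7
    have b1 := abs_le.1 (hu.bound z a1 a3 a5)
    have b2 := abs_le.1 (hu.bound z' a2 a4 a6)
    have b3 := doublePen_lower (ℓ := ℓ) a5 a6
    have b4 : 0 ≤ 500 * d * ‖z - z'‖ + (‖z‖ ^ 2 + ‖z'‖ ^ 2) ^ (3 / 4 : ℝ) := by positivity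
    have b5 := mul_nonneg hε.le (hbar0 z)
    have b6 := mul_nonneg hε.le (hbar0 z')
    simp only [hΦ] at a7
    constructor
    · by_contra! h
      linarith [hbar z a3 h]
    · by_contra! h
      linarith [hbar z' a4 h]
  have hpos : 0 < Φ (x, x') := by simp only [hΦ]; linarith
  set K : Set (EuclideanSpace ℝ (Fin d)) := {z | 0 ≤ z ℓ ∧ δ ≤ ‖z‖ ∧ ‖z‖ ≤ 1 / 2} with hK
  have hKc : IsCompact (K ×ˢ K) := (isCompact_half_annulus δ (1 / 2)).prod
    (isCompact_half_annulus δ (1 / 2))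
  have hKne : ∀ z ∈ K, z ≠ 0 := fun z hz => norm_pos_iff.1 (hδ0.trans_le hz.2.1)
  have hΦc : ContinuousOn Φ (K ×ˢ K) := by
    have c1 : ∀ z ∈ K, ContinuousAt u z := fun z hz =>
      (hu.smooth z hz.1 (hKne z hz) hz.2.2).continuousAt
    have c2 : ∀ z ∈ K, ContinuousAt radBar z := fun z hz =>
      (contDiffAt_radBar (hKne z hz)).continuousAt
    have c3 : Continuous fun z : EuclideanSpace ℝ (Fin d) × EuclideanSpace ℝ (Fin d) =>
        doublePen ℓ z.1 z.2 := by
      have l1 : Continuous fun z : EuclideanSpace ℝ (Fin d) × EuclideanSpace ℝ (Fin d) =>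
        z.1 ℓ + z.2 ℓ := by fun_prop
      have l2 : ∀ p : ℝ, 0 ≤ p →
          Continuous fun z : EuclideanSpace ℝ (Fin d) × EuclideanSpace ℝ (Fin d) =>
          (‖z.1 - z.2‖ ^ 2) ^ p := fun p hp =>
        Continuous.rpow_const (by fun_prop) fun _ => Or.inr hp
      have l3 : ∀ p : ℝ, 0 ≤ p →
          Continuous fun z : EuclideanSpace ℝ (Fin d) × EuclideanSpace ℝ (Fin d) =>
          (‖z.1‖ ^ 2 + ‖z.2‖ ^ 2) ^ p := fun p hp =>
        Continuous.rpow_const (by fun_prop) fun _ => Or.inr hp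
      exact ((((l2 (1 / 2) (by norm_num)).sub ((l2 (3 / 4) (by norm_num)).const_mul _)).const_mul
        _).add ((l3 (3 / 4) (by norm_num)).const_mul _)).sub
        ((l1.mul (l3 (1 / 4) (by norm_num))).const_mul _)
    intro z hz
    have f1 := (c1 z.1 hz.1).comp (f := Prod.fst) (x := z) continuous_fst.continuousAt
    have f2 := (c1 z.2 hz.2).comp (f := Prod.snd) (x := z) continuous_snd.continuousAt
    have f3 := (c2 z.1 hz.1).comp (f := Prod.fst) (x := z) continuous_fst.continuousAt
    have f4 := (c2 z.2 hz.2).comp (f := Prod.snd) (x := z) continuous_snd.continuousAt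
    exact (((f1.sub (f3.const_mul ε)).sub (f2.add (f4.const_mul ε))).sub
      c3.continuousAt).continuousWithinAt
  obtain ⟨f1, f2⟩ := hfar x x' h0 h0' hne hne' hx hx' hpos
  obtain ⟨⟨z, z'⟩, ⟨hz, hz'⟩, hzmax⟩ := hKc.exists_isMaxOn
    ⟨(x, x'), ⟨h0, f1.le, hx⟩, ⟨h0', f2.le, hx'⟩⟩ hΦc
  have hzpos : 0 < Φ (z, z') := hpos.trans_le (hzmax (show (x, x') ∈ K ×ˢ K from
    ⟨⟨h0, f1.le, hx⟩, ⟨h0', f2.le, hx'⟩⟩))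
  have hzmax' : ∀ w w', w ∈ K → w' ∈ K → Φ (w, w') ≤ Φ (z, z') := fun w w' hw hw' =>
    hzmax (show (w, w') ∈ K ×ˢ K from ⟨hw, hw'⟩)
  obtain ⟨g1, g2⟩ := hfar z z' hz.1 hz'.1 (hKne z hz) (hKne z' hz') hz.2.2 hz'.2.2 hzpos
  exact hu.not_max hd hε hδ0 hz.1 hz'.1 g1 g2 hz.2.2 hz'.2.2 hzpos
    fun w w' a1 a2 a3 a4 a5 a6 => hzmax' w w' ⟨a1, a2, a3⟩ ⟨a4, a5, a6⟩

end DoublingGlobal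

section KelvinTransform

variable {d : ℕ} {ℓ : Fin d} {u v : EuclideanSpace ℝ (Fin d) → ℝ} {x : EuclideanSpace ℝ (Fin d)}

lemma NearNeumann.exists_limit (hd : 3 ≤ d) (hu : NearNeumann ℓ u) :
    ∃ k : ℝ, |k| ≤ 1 ∧ ∀ x : EuclideanSpace ℝ (Fin d), 0 ≤ x ℓ → x ≠ 0 → ‖x‖ ≤ 1 / 2 →
      |u x - k| ≤ (1000 * d + 2) * ‖x‖ := by
  have hmain : ∀ x x' : EuclideanSpace ℝ (Fin d), 0 ≤ x ℓ → 0 ≤ x' ℓ → x ≠ 0 → x' ≠ 0 →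
      ‖x‖ ≤ 1 / 2 → ‖x'‖ ≤ 1 / 2 → u x - u x' ≤ (1000 * d + 2) * (‖x‖ + ‖x'‖) := by
    intro x x' h0 h0' hne hne' hx hx'
    refine le_trans ?_ (doublePen_upper h0 h0' hx hx')
    have ht : Tendsto (fun ε : ℝ => u x - u x' - ε * (radBar x + radBar x')) (𝓝[>] 0)
        (𝓝 (u x - u x')) := by
      have hc : Continuous fun ε : ℝ => u x - u x' - ε * (radBar x + radBar x') := by fun_prop
      simpa using (hc.tendsto 0).mono_left (nhdsWithin_le_nhds (s := Ioi 0))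
    refine le_of_tendsto ht ?_
    filter_upwards [self_mem_nhdsWithin] with ε hε
    exact hu.doubling hd hε h0 h0' hne hne' hx hx'
  set z : ℕ → EuclideanSpace ℝ (Fin d) := fun n =>
    EuclideanSpace.single ℓ (1 / 2 * (1 / ((n : ℝ) + 1))) with hz
  have hzn : ∀ n, ‖z n‖ = 1 / 2 * (1 / ((n : ℝ) + 1)) := fun n => by
    rw [hz, PiLp.norm_single, Real.norm_eq_abs, abs_of_pos (by positivity)]
  have hz0 : ∀ n, 0 ≤ z n ℓ := fun n => by
    simp only [hz, PiLp.single_apply, if_true]; positivity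
  have hzne : ∀ n, z n ≠ 0 := fun n => norm_pos_iff.1 (by rw [hzn]; positivity)
  have hz1 : ∀ n, ‖z n‖ ≤ 1 / 2 := fun n => by
    have : 1 / ((n : ℝ) + 1) ≤ 1 := by
      rw [div_le_one (by positivity)]; linarith [n.cast_nonneg (α := ℝ)]
    rw [hzn]; linarith
  have hzt : Tendsto (fun n => ‖z n‖) atTop (𝓝 0) := by
    simp only [hzn]
    have := (tendsto_one_div_add_atTop_nhds_zero_nat (𝕜 := ℝ)).const_mul (1 / 2 : ℝ)
    rwa [mul_zero] at this
  obtain ⟨k, hk, φ, hφ, hφt⟩ := (isCompact_Icc (a := (-1 : ℝ)) (b := 1)).tendsto_subseq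
    (x := fun n => u (z n)) fun n => abs_le.1 (hu.bound _ (hz0 n) (hzne n) (hz1 n))
  refine ⟨k, abs_le.2 hk, fun x h0 hne hx => ?_⟩
  have hφz : Tendsto (fun n => (1000 * d + 2) * (‖x‖ + ‖z (φ n)‖)) atTop
      (𝓝 ((1000 * d + 2) * ‖x‖)) := by
    simpa using ((hzt.comp hφ.tendsto_atTop).const_add ‖x‖).const_mul (1000 * (d : ℝ) + 2)
  refine le_of_tendsto_of_tendsto ((tendsto_const_nhds.sub hφt).abs) hφz ?_
  refine Eventually.of_forall fun n => abs_le.2 ⟨?_, ?_⟩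
  · have := hmain (z (φ n)) x (hz0 _) h0 (hzne _) hne (hz1 _) hx
    simp only [Function.comp]
    linarith
  · exact hmain x (z (φ n)) h0 (hz0 _) hne (hzne _) hx (hz1 _)

lemma HasJet.comp_curve {E : Type*} [NormedAddCommGroup E] [NormedSpace ℝ E] {F : E → ℝ}
    {c c' : ℝ → E} {y b e : E} (hF : ContDiffAt ℝ 2 F y) (hy : c 0 = y)
    (hc : ∀ᶠ t in 𝓝 (0 : ℝ), HasDerivAt c (c' t) t) (hb : c' 0 = b) (he : HasDerivAt c' e 0) :
    HasJet (fun t => F (c t)) (F y) (fderiv ℝ F y b)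
      (fderiv ℝ (fderiv ℝ F) y b b + fderiv ℝ F y e) := by
  subst hy hb
  have hc0 := hc.self_of_nhds
  refine ⟨rfl, fun t => fderiv ℝ F (c t) (c' t), ?_, rfl, ?_⟩
  · have h1 : ∀ᶠ z in 𝓝 (c 0), ContDiffAt ℝ 2 F z := hF.eventually (by simp)
    filter_upwards [hc0.continuousAt.eventually h1, hc] with t ht hct
    exact (ht.differentiableAt (by norm_num)).hasFDerivAt.comp_hasDerivAt t hct
  · have h1 : DifferentiableAt ℝ (fderiv ℝ F) (c 0) :=
      (hF.fderiv_right (m := 1) (by norm_num)).differentiableAt (by norm_num)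
    exact (h1.hasFDerivAt.comp_hasDerivAt (0 : ℝ) hc0).clm_apply he

/-- Inversion in the unit sphere. -/
def invPt (x : EuclideanSpace ℝ (Fin d)) : EuclideanSpace ℝ (Fin d) := (‖x‖ ^ 2)⁻¹ • x

/-- Kelvin transform, up to normalization. -/
def kelvin (a s : ℝ) (v : EuclideanSpace ℝ (Fin d) → ℝ) (x : EuclideanSpace ℝ (Fin d)) : ℝ :=
  (‖x‖ ^ 2) ^ (-a) * (v (invPt x) - s)

lemma norm_invPt (hx : x ≠ 0) : ‖invPt x‖ = ‖x‖⁻¹ := by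
  have := norm_pos_iff.2 hx
  rw [invPt, norm_smul, norm_inv, norm_pow, norm_norm]
  field_simp

lemma invPt_invPt (hx : x ≠ 0) : invPt (invPt x) = x := by
  have := norm_pos_iff.2 hx
  rw [invPt, norm_invPt hx, invPt, smul_smul]
  have : (‖x‖⁻¹ ^ 2)⁻¹ * (‖x‖ ^ 2)⁻¹ = 1 := by field_simp
  rw [this, one_smul]

lemma contDiffAt_invPt (hx : x ≠ 0) : ContDiffAt ℝ 2 (invPt (d := d)) x := by
  have hq : ‖x‖ ^ 2 ≠ 0 := by have := norm_pos_iff.2 hx; positivity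
  exact ((contDiff_norm_sq ℝ).contDiffAt.inv hq).smul contDiffAt_id

lemma contDiffAt_kelvin (a s : ℝ) (hx : x ≠ 0) (hv : ContDiffAt ℝ 2 v (invPt x)) :
    ContDiffAt ℝ 2 (kelvin a s v) x := by
  have hq : ‖x‖ ^ 2 ≠ 0 := by have := norm_pos_iff.2 hx; positivity
  exact ((contDiff_norm_sq ℝ).contDiffAt.rpow_const_of_ne hq).mul
    ((hv.comp x (contDiffAt_invPt hx)).sub contDiffAt_const)

lemma jet_kelvin (a s : ℝ) (hx : x ≠ 0) (hv : ContDiffAt ℝ 2 v (invPt x))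
    (η : EuclideanSpace ℝ (Fin d)) {q α P : ℝ} (hq : ‖x‖ ^ 2 = q) (hα : inner ℝ x η = α)
    (hP : P = q ^ (-a - 2)) {b : EuclideanSpace ℝ (Fin d)}
    (hb : b = q⁻¹ • (η - (2 * α / q) • x)) :
    HasJet (fun t : ℝ => kelvin a s v (x + t • η)) (P * q ^ 2 * (v (invPt x) - s))
      (P * q * (-(2 * a * α) * (v (invPt x) - s) + q * fderiv ℝ v (invPt x) b))
      (P * ((4 * a * (a + 1) * α ^ 2 - 2 * a * q * ‖η‖ ^ 2) * (v (invPt x) - s) -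
        (4 * a + 4) * α * fderiv ℝ v (invPt x) η +
        ((8 * a + 8) * α ^ 2 / q - 2 * ‖η‖ ^ 2) * fderiv ℝ v (invPt x) x +
        q ^ 2 * fderiv ℝ (fderiv ℝ v) (invPt x) b b)) := by
  have hq0 : 0 < q := by have := norm_pos_iff.2 hx; rw [← hq]; positivity
  have jq : HasJet (fun t : ℝ => ‖x + t • η‖ ^ 2) q (2 * α) (2 * ‖η‖ ^ 2) :=
    (jet_norm_sq x η).congr_val hq (by rw [hα]) rfl
  have jg := jq.rpow hq0 (-1)
  have e1 : q ^ (-1 - 1 : ℝ) = q⁻¹ ^ 2 := by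
    rw [show (-1 - 1 : ℝ) = -(2 : ℕ) by norm_num, rpow_neg hq0.le, rpow_natCast, inv_pow]
  have e2 : q ^ (-1 - 2 : ℝ) = q⁻¹ ^ 3 := by
    rw [show (-1 - 2 : ℝ) = -(3 : ℕ) by norm_num, rpow_neg hq0.le, rpow_natCast, inv_pow]
  rw [e1, e2, rpow_neg_one] at jg
  obtain ⟨g0, g', g1, g2, g3⟩ := jg
  have hl : ∀ t : ℝ, HasDerivAt (fun t : ℝ => x + t • η) η t := fun t => by
    simpa using ((hasDerivAt_id t).smul_const η).const_add x
  have hg0 := g1.self_of_nhds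
  have jc := HasJet.comp_curve (F := v) (y := invPt x) (b := b)
    (c := fun t : ℝ => ((‖x + t • η‖ ^ 2) ^ (-1 : ℝ)) • (x + t • η))
    (c' := fun t : ℝ => ((‖x + t • η‖ ^ 2) ^ (-1 : ℝ)) • η + g' t • (x + t • η)) hv
    (by simp [invPt, rpow_neg_one])
    (by filter_upwards [g1] with t ht using ht.smul (hl t))
    (by
      simp only [g2, hb, zero_smul, add_zero, smul_sub, smul_smul]
      rw [sub_eq_add_neg, ← neg_smul, hq, rpow_neg_one]
      congr 2
      field_simp)
    ((hg0.smul_const η).add (g3.smul (hl 0)))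
  have hf : (fun t : ℝ => kelvin a s v (x + t • η)) = fun t : ℝ => (‖x + t • η‖ ^ 2) ^ (-a) *
      (v (((‖x + t • η‖ ^ 2) ^ (-1 : ℝ)) • (x + t • η)) - s) := by
    ext t; rw [kelvin, invPt, rpow_neg_one]
  rw [hf]
  have p1 : q ^ (-a) = P * q ^ 2 := by
    rw [hP, ← rpow_natCast, ← rpow_add hq0]; norm_num
  have p2 : q ^ (-a - 1) = P * q := by
    rw [hP, ← rpow_add_one hq0.ne']; congr 1; ring
  have J := (jq.rpow hq0 (-a)).mul (jc.sub (HasJet.const s))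
  rw [p1, p2, ← hP] at J
  refine J.congr_val (by ring) (by ring) ?_
  simp only [g2, zero_smul, add_zero, map_add, map_smul, smul_eq_mul]
  have hDb : fderiv ℝ v (invPt x) b =
      q⁻¹ * (fderiv ℝ v (invPt x) η - 2 * α / q * fderiv ℝ v (invPt x) x) := by
    rw [hb]; simp only [map_smul, map_sub, smul_eq_mul]
  rw [hDb]
  field_simp
  ring

end KelvinTransform

section KelvinEquation

variable {d : ℕ} {ℓ : Fin d} {v : EuclideanSpace ℝ (Fin d) → ℝ} {x : EuclideanSpace ℝ (Fin d)}

lemma reflect_perturbed {e : EuclideanSpace ℝ (Fin d)} (he : ‖e‖ = 1)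
    {c γ p : EuclideanSpace ℝ (Fin d)} (hγ : γ = c - (2 * inner ℝ e c) • e)
    (hp : p = EuclideanSpace.single ℓ 1 - (2 * e ℓ) • e) (k : Fin d) :
    (EuclideanSpace.single k 1 + γ k • p) -
        (2 * inner ℝ e (EuclideanSpace.single k 1 + γ k • p)) • e =
      (EuclideanSpace.single k 1 - (2 * e k) • e) +
        (inner ℝ c (EuclideanSpace.single k 1 - (2 * e k) • e)) • EuclideanSpace.single ℓ 1 := by
  have h1 : inner ℝ e p = - e ℓ := by
    rw [hp, inner_sub_right, inner_smul_right, real_inner_self_eq_norm_sq, he,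
      EuclideanSpace.inner_single_right]
    simp
    ring
  have h2 : inner ℝ c (EuclideanSpace.single k 1 - (2 * e k) • e) = γ k := by
    rw [hγ, inner_sub_right, inner_smul_right, EuclideanSpace.inner_single_right,
      real_inner_comm]
    simp
    ring
  rw [inner_perturbed, h1, h2]
  conv_lhs => enter [1, 2]; rw [hp]
  module

lemma norm_reflect {e : EuclideanSpace ℝ (Fin d)} (he : ‖e‖ = 1) (c : EuclideanSpace ℝ (Fin d)) :
    ‖c - (2 * inner ℝ e c) • e‖ = ‖c‖ := by
  have : ‖c - (2 * inner ℝ e c) • e‖ ^ 2 = ‖c‖ ^ 2 := by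
    rw [norm_sub_sq_real, inner_smul_right, norm_smul, he, Real.norm_eq_abs, mul_one, sq_abs,
      real_inner_comm]
    ring
  exact (pow_left_inj₀ (norm_nonneg _) (norm_nonneg _) two_ne_zero).1 this

lemma fderiv_fderiv_dirVec {F : EuclideanSpace ℝ (Fin d) → ℝ} {y : EuclideanSpace ℝ (Fin d)}
    (h : ContDiffAt ℝ 2 F y) (c : ℝ) (k : Fin d) :
    fderiv ℝ (fderiv ℝ F) y (EuclideanSpace.single k 1 + c • EuclideanSpace.single ℓ 1)
      (EuclideanSpace.single k 1 + c • EuclideanSpace.single ℓ 1) = secDir ℓ c k F y :=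
  ((HasJet.of_contDiffAt h (dirVec ℓ c k)).unique (jet_dirVec h c k)).2

lemma sum_fderiv_reflected {y : EuclideanSpace ℝ (Fin d)} (hv : ContDiffAt ℝ 2 v y)
    {c : EuclideanSpace ℝ (Fin d)} (hc : ∑ k, secDir ℓ (c k) k v y = 0)
    {e : EuclideanSpace ℝ (Fin d)} (he : ‖e‖ = 1) {γ p : EuclideanSpace ℝ (Fin d)}
    (hγ : γ = c - (2 * inner ℝ e c) • e) (hp : p = EuclideanSpace.single ℓ 1 - (2 * e ℓ) • e) :
    ∑ k, fderiv ℝ (fderiv ℝ v) y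
      ((EuclideanSpace.single k 1 + γ k • p) -
        (2 * inner ℝ e (EuclideanSpace.single k 1 + γ k • p)) • e)
      ((EuclideanSpace.single k 1 + γ k • p) -
        (2 * inner ℝ e (EuclideanSpace.single k 1 + γ k • p)) • e) = 0 := by
  set T : EuclideanSpace ℝ (Fin d) →L[ℝ] EuclideanSpace ℝ (Fin d) :=
    ContinuousLinearMap.id ℝ _ + (innerSL ℝ c).smulRight (EuclideanSpace.single ℓ 1) with hT
  have hTa : ∀ z, T z = z + (inner ℝ c z) • EuclideanSpace.single ℓ 1 := fun z => by
    simp [hT]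
  have := sum_reflect ((fderiv ℝ (fderiv ℝ v) y).bilinearComp T T) he
  simp only [ContinuousLinearMap.bilinearComp_apply, hTa,
    EuclideanSpace.inner_single_right, conj_trivial, one_mul, fderiv_fderiv_dirVec hv, hc] at this
  simp only [reflect_perturbed he hγ hp]
  exact this

lemma kelvin_sum_bound (hd : 3 ≤ d) {γ p : EuclideanSpace ℝ (Fin d)} (hp : ‖p‖ = 1)
    (hγ : ‖γ‖ ≤ 1) (hx : x ≠ 0) {a : ℝ} (ha : (d : ℝ) = 2 * a + 2)
    (L : EuclideanSpace ℝ (Fin d) →L[ℝ] ℝ) (w : ℝ) :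
    |∑ k, ((4 * a * (a + 1) * inner ℝ x (EuclideanSpace.single k 1 + γ k • p) ^ 2 -
        2 * a * ‖x‖ ^ 2 *
          ‖(EuclideanSpace.single k 1 + γ k • p : EuclideanSpace ℝ (Fin d))‖ ^ 2) * w -
        (4 * a + 4) * inner ℝ x (EuclideanSpace.single k 1 + γ k • p) *
          L (EuclideanSpace.single k 1 + γ k • p) +
        ((8 * a + 8) * inner ℝ x (EuclideanSpace.single k 1 + γ k • p) ^ 2 / ‖x‖ ^ 2 -
          2 * ‖(EuclideanSpace.single k 1 + γ k • p : EuclideanSpace ℝ (Fin d))‖ ^ 2) * L x)| ≤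
      7 * d ^ 2 * ‖γ‖ * (‖x‖ ^ 2 * |w| + ‖x‖ * ‖L‖) := by
  have hn : 0 < ‖x‖ := norm_pos_iff.2 hx
  have hd3 : (3 : ℝ) ≤ d := by exact_mod_cast hd
  have hLx : ∑ k, x k * L (EuclideanSpace.single k 1) = L x := by
    conv_rhs => rw [eq_sum_single x]
    simp
  have hLγ : ∑ k, γ k * L (EuclideanSpace.single k 1) = L γ := by
    conv_rhs => rw [eq_sum_single γ]
    simp
  set g := ‖γ‖ with hg
  have hg0 : 0 ≤ g := norm_nonneg _
  set X := inner ℝ x γ with hX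
  set Y := inner ℝ x p with hY
  have hS1 : ∑ k, inner ℝ x (EuclideanSpace.single k 1 + γ k • p) ^ 2 =
      ‖x‖ ^ 2 + (2 * (X * Y) + g ^ 2 * Y ^ 2) := by
    rw [sum_inner_perturbed_sq, add_assoc]
  have hS2 := sum_norm_perturbed_sq γ hp
  have hS3 : ∑ k, inner ℝ x (EuclideanSpace.single k 1 + γ k • p) *
      L (EuclideanSpace.single k 1 + γ k • p) = L x + (X * L p + Y * L γ + g ^ 2 * (Y * L p)) := by
    have : ∀ k, inner ℝ x (EuclideanSpace.single k 1 + γ k • p) *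
        L (EuclideanSpace.single k 1 + γ k • p) =
        x k * L (EuclideanSpace.single k 1) + L p * (x k * γ k) +
        Y * (γ k * L (EuclideanSpace.single k 1)) + Y * L p * γ k ^ 2 := fun k => by
      rw [inner_perturbed, map_add, map_smul, smul_eq_mul]; ring
    simp only [this, Finset.sum_add_distrib, ← Finset.mul_sum, hLx, hLγ, sum_sq_coord,
      sum_mul_coord]
    ring
  have hX1 : |X| ≤ ‖x‖ * g := abs_real_inner_le_norm x γ
  have hY1 : |Y| ≤ ‖x‖ := by simpa [hp] using abs_real_inner_le_norm x p
  have hp1 : |L p| ≤ ‖L‖ := by simpa [hp] using L.le_opNorm p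
  have hx1 : |L x| ≤ ‖L‖ * ‖x‖ := L.le_opNorm x
  have hγ1 : |L γ| ≤ ‖L‖ * g := L.le_opNorm γ
  have hi : |inner ℝ γ p| ≤ g := by simpa [hp] using abs_real_inner_le_norm γ p
  have hgg : g ^ 2 ≤ g := by nlinarith only [hg0, hγ]
  set θ := 2 * (X * Y) + g ^ 2 * Y ^ 2 with hθ
  set χ := X * L p + Y * L γ + g ^ 2 * (Y * L p) with hχ
  set ψ := 2 * inner ℝ γ p + g ^ 2 with hψ
  have hθ1 : |θ| ≤ 3 * g * ‖x‖ ^ 2 := by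
    have a1 : |X * Y| ≤ (‖x‖ * g) * ‖x‖ := by rw [abs_mul]; gcongr
    have a2 : g ^ 2 * Y ^ 2 ≤ g * ‖x‖ ^ 2 := by rw [← sq_abs Y]; gcongr
    have a3 : 0 ≤ g ^ 2 * Y ^ 2 := by positivity
    rw [abs_le] at a1 ⊢
    constructor <;> linarith
  have hψ1 : |ψ| ≤ 3 * g := by
    have := sq_nonneg g
    rw [abs_le] at hi ⊢
    constructor <;> linarith
  have hχ1 : |χ| ≤ 3 * g * (‖x‖ * ‖L‖) := by
    have a1 : |X * L p| ≤ (‖x‖ * g) * ‖L‖ := by rw [abs_mul]; gcongr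
    have a2 : |Y * L γ| ≤ ‖x‖ * (‖L‖ * g) := by rw [abs_mul]; gcongr
    have a3 : |g ^ 2 * (Y * L p)| ≤ g * (‖x‖ * ‖L‖) := by
      rw [abs_mul, abs_mul, abs_of_nonneg (sq_nonneg g)]; gcongr
    rw [abs_le] at a1 a2 a3 ⊢
    constructor <;> linarith
  have hsum : ∑ k, ((4 * a * (a + 1) * inner ℝ x (EuclideanSpace.single k 1 + γ k • p) ^ 2 -
        2 * a * ‖x‖ ^ 2 *
          ‖(EuclideanSpace.single k 1 + γ k • p : EuclideanSpace ℝ (Fin d))‖ ^ 2) * w -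
        (4 * a + 4) * inner ℝ x (EuclideanSpace.single k 1 + γ k • p) *
          L (EuclideanSpace.single k 1 + γ k • p) +
        ((8 * a + 8) * inner ℝ x (EuclideanSpace.single k 1 + γ k • p) ^ 2 / ‖x‖ ^ 2 -
          2 * ‖(EuclideanSpace.single k 1 + γ k • p : EuclideanSpace ℝ (Fin d))‖ ^ 2) * L x) =
      4 * a * (a + 1) * w * θ - 2 * a * ‖x‖ ^ 2 * w * ψ - (4 * a + 4) * χ +
        (8 * a + 8) * L x / ‖x‖ ^ 2 * θ - 2 * L x * ψ := by
    have : ∀ k, ((4 * a * (a + 1) * inner ℝ x (EuclideanSpace.single k 1 + γ k • p) ^ 2 -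
        2 * a * ‖x‖ ^ 2 *
          ‖(EuclideanSpace.single k 1 + γ k • p : EuclideanSpace ℝ (Fin d))‖ ^ 2) * w -
        (4 * a + 4) * inner ℝ x (EuclideanSpace.single k 1 + γ k • p) *
          L (EuclideanSpace.single k 1 + γ k • p) +
        ((8 * a + 8) * inner ℝ x (EuclideanSpace.single k 1 + γ k • p) ^ 2 / ‖x‖ ^ 2 -
          2 * ‖(EuclideanSpace.single k 1 + γ k • p : EuclideanSpace ℝ (Fin d))‖ ^ 2) * L x) =
        (4 * a * (a + 1) * w + (8 * a + 8) * L x / ‖x‖ ^ 2) *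
          inner ℝ x (EuclideanSpace.single k 1 + γ k • p) ^ 2 -
        (2 * a * ‖x‖ ^ 2 * w + 2 * L x) *
          ‖(EuclideanSpace.single k 1 + γ k • p : EuclideanSpace ℝ (Fin d))‖ ^ 2 -
        (4 * a + 4) * (inner ℝ x (EuclideanSpace.single k 1 + γ k • p) *
          L (EuclideanSpace.single k 1 + γ k • p)) := fun k => by ring
    simp only [this, Finset.sum_sub_distrib, ← Finset.mul_sum, hS1, hS2,
      hS3]
    rw [ha, hψ]
    field_simp
    ring
  rw [hsum]
  have ha0 : 1 / 2 ≤ a := by linarith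
  have t1 : |4 * a * (a + 1) * w * θ| ≤ 4 * a * (a + 1) * |w| * (3 * g * ‖x‖ ^ 2) := by
    rw [abs_mul, abs_mul, abs_of_nonneg (by positivity : 0 ≤ 4 * a * (a + 1))]; gcongr
  have t2 : |2 * a * ‖x‖ ^ 2 * w * ψ| ≤ 2 * a * ‖x‖ ^ 2 * |w| * (3 * g) := by
    rw [abs_mul, abs_mul, abs_of_nonneg (by positivity : 0 ≤ 2 * a * ‖x‖ ^ 2)]; gcongr
  have t3 : |(4 * a + 4) * χ| ≤ (4 * a + 4) * (3 * g * (‖x‖ * ‖L‖)) := by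
    rw [abs_mul, abs_of_nonneg (by positivity : 0 ≤ 4 * a + 4)]; gcongr
  have t4 : |(8 * a + 8) * L x / ‖x‖ ^ 2 * θ| ≤ (8 * a + 8) * (3 * g * (‖x‖ * ‖L‖)) := by
    rw [abs_mul, abs_div, abs_mul, abs_of_nonneg (by positivity : 0 ≤ 8 * a + 8),
      abs_of_nonneg (sq_nonneg ‖x‖)]
    calc _ ≤ (8 * a + 8) * (‖L‖ * ‖x‖) / ‖x‖ ^ 2 * (3 * g * ‖x‖ ^ 2) := by gcongr
      _ = _ := by field_simp
  have t5 : |2 * L x * ψ| ≤ 2 * (‖L‖ * ‖x‖) * (3 * g) := by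
    rw [abs_mul, abs_mul, abs_two]; gcongr
  have t6 : (12 * (a * (a + 1)) + 6 * a) * (g * (‖x‖ ^ 2 * |w|)) ≤
      7 * d ^ 2 * (g * (‖x‖ ^ 2 * |w|)) := by
    gcongr
    rw [ha]; nlinarith only [ha0]
  have t7 : (36 * (a + 1) + 6) * (g * (‖x‖ * ‖L‖)) ≤ 7 * d ^ 2 * (g * (‖x‖ * ‖L‖)) := by
    gcongr
    rw [ha]; nlinarith only [ha0]
  rw [abs_le] at t1 t2 t3 t4 t5 ⊢
  constructor <;> linarith

end KelvinEquation

section KelvinSolution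

variable {d : ℕ} {ℓ : Fin d} {v : EuclideanSpace ℝ (Fin d) → ℝ} {x : EuclideanSpace ℝ (Fin d)}

lemma inv_rpow_sub_natCast {n : ℝ} (hn : 0 < n) {e i j : ℕ} (h : i + e = j) :
    (n⁻¹) ^ ((i : ℝ) - j) = n ^ e := by
  rw [← h, Nat.cast_add, sub_add_cancel_left, rpow_neg (by positivity), inv_rpow hn.le, inv_inv,
    rpow_natCast]

lemma smul_reflect_direction (hx : x ≠ 0) {q : ℝ} (hq : ‖x‖ ^ 2 = q)
    (ξ : EuclideanSpace ℝ (Fin d)) :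
    q⁻¹ • (ξ - (2 * inner ℝ x ξ / q) • x) =
      q⁻¹ • (ξ - (2 * inner ℝ (‖x‖⁻¹ • x) ξ) • (‖x‖⁻¹ • x)) := by
  have hn := norm_pos_iff.2 hx
  congr 2
  rw [smul_smul, real_inner_smul_left, ← hq]
  congr 1
  field_simp

/-- Decay hypotheses at infinity under which the Kelvin transform is controlled near the origin. -/
structure DecaySol (ℓ : Fin d) (η B s : ℝ) (v : EuclideanSpace ℝ (Fin d) → ℝ) : Prop where
  sol : SmallSol ℓ η v
  le_half : η ≤ 1 / 2
  pos : 0 < B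
  le : 600 * d ^ 3 * B ≤ 1
  val : ∀ y, 0 ≤ y ℓ → 2 ≤ ‖y‖ → |v y - s| ≤ B * ‖y‖ ^ ((2 : ℝ) - d)
  grad : ∀ y, 0 ≤ y ℓ → 2 ≤ ‖y‖ → ‖fderiv ℝ v y‖ ≤ B * ‖y‖ ^ (1 - (d : ℝ))

variable {η B s : ℝ}

lemma DecaySol.at_invPt (h : DecaySol ℓ η B s v) {e : ℕ} (he : 2 + e = d) (h0 : 0 ≤ x ℓ)
    (hx : x ≠ 0) (hx1 : ‖x‖ ≤ 1 / 2) :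
    0 ≤ invPt x ℓ ∧ 2 ≤ ‖invPt x‖ ∧ ContDiffAt ℝ 2 v (invPt x) ∧
      |v (invPt x) - s| ≤ B * ‖x‖ ^ e ∧ ‖fderiv ℝ v (invPt x)‖ ≤ B * ‖x‖ ^ (e + 1) := by
  have hn := norm_pos_iff.2 hx
  have a0 : 0 ≤ invPt x ℓ := by
    rw [invPt, PiLp.smul_apply, smul_eq_mul]; positivity
  have a1 : 2 ≤ ‖invPt x‖ := by
    rw [norm_invPt hx, le_inv_comm₀ (by norm_num) hn]
    linarith
  refine ⟨a0, a1, (h.sol.contDiffAt a0 (by linarith)).of_le (by norm_cast), ?_, ?_⟩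
  · have := h.val _ a0 a1
    rw [norm_invPt hx] at this
    rwa [← inv_rpow_sub_natCast hn he, Nat.cast_ofNat]
  · have := h.grad _ a0 a1
    rw [norm_invPt hx] at this
    rwa [← inv_rpow_sub_natCast hn (show 1 + (e + 1) = d by omega), Nat.cast_one]

lemma rpow_norm_sq_mul (hx : x ≠ 0) {e : ℕ} {a : ℝ} (ha : (e : ℝ) = 2 * a) :
    (‖x‖ ^ 2) ^ (-a - 2) * ‖x‖ ^ (e + 4) = 1 := by
  have hn := norm_pos_iff.2 hx
  rw [← rpow_natCast ‖x‖ 2, ← rpow_mul hn.le, ← rpow_natCast ‖x‖ (e + 4), ← rpow_add hn]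
  push_cast
  rw [ha, show (2 : ℝ) * (-a - 2) + (2 * a + 4) = 0 by ring, rpow_zero]

lemma DecaySol.fderiv_kelvin_bound (h : DecaySol ℓ η B s v) {e : ℕ} (he : 2 + e = d)
    {a : ℝ} (ha : (e : ℝ) = 2 * a) (h0 : 0 ≤ x ℓ) (hx : x ≠ 0) (hx1 : ‖x‖ ≤ 1 / 2) :
    ‖fderiv ℝ (kelvin a s v) x‖ * ‖x‖ ≤ (e + 1) * B := by
  have hn := norm_pos_iff.2 hx
  obtain ⟨-, -, a2, a3, a4⟩ := h.at_invPt he h0 hx hx1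
  have hP := rpow_norm_sq_mul hx ha
  set P := (‖x‖ ^ 2) ^ (-a - 2) with hPd
  have hP0 : 0 ≤ P := by positivity
  have hB := h.pos
  set w := v (invPt x) - s with hw
  set L := fderiv ℝ v (invPt x) with hL
  have key : ‖fderiv ℝ (kelvin a s v) x‖ ≤ (e + 1) * B * ‖x‖⁻¹ := by
    refine ContinuousLinearMap.opNorm_le_bound _ (by positivity) fun ξ => ?_
    have j := jet_kelvin a s hx a2 ξ (q := ‖x‖ ^ 2) rfl rfl rfl rfl
    rw [((HasJet.of_contDiffAt (contDiffAt_kelvin a s hx a2) ξ).unique j).1, smul_reflect_direction hx rfl, ← hPd, ← hw, ← hL,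
      Real.norm_eq_abs, abs_mul, abs_of_nonneg (by positivity : 0 ≤ P * ‖x‖ ^ 2)]
    have b1 : |L ((‖x‖ ^ 2)⁻¹ • (ξ - (2 * inner ℝ (‖x‖⁻¹ • x) ξ) • (‖x‖⁻¹ • x)))| ≤
        B * ‖x‖ ^ (e + 1) * ((‖x‖ ^ 2)⁻¹ * ‖ξ‖) := by
      refine (L.le_opNorm _).trans ?_
      rw [norm_smul, norm_reflect (by rw [norm_smul, norm_inv, norm_norm, inv_mul_cancel₀ hn.ne']),
        Real.norm_eq_abs, abs_of_pos (by positivity)]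
      gcongr
    have b2 : |-(2 * a * inner ℝ x ξ) * w| ≤ e * (‖x‖ * ‖ξ‖) * (B * ‖x‖ ^ e) := by
      rw [abs_mul, abs_neg, abs_mul, ← ha, abs_of_nonneg (by positivity : (0 : ℝ) ≤ e)]
      have := abs_real_inner_le_norm x ξ
      gcongr
    have b3 : |-(2 * a * inner ℝ x ξ) * w + ‖x‖ ^ 2 *
        L ((‖x‖ ^ 2)⁻¹ • (ξ - (2 * inner ℝ (‖x‖⁻¹ • x) ξ) • (‖x‖⁻¹ • x)))| ≤
        e * (‖x‖ * ‖ξ‖) * (B * ‖x‖ ^ e) +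
          ‖x‖ ^ 2 * (B * ‖x‖ ^ (e + 1) * ((‖x‖ ^ 2)⁻¹ * ‖ξ‖)) := by
      refine (abs_add_le _ _).trans (add_le_add b2 ?_)
      rw [abs_mul, abs_of_nonneg (by positivity : 0 ≤ ‖x‖ ^ 2)]
      gcongr
    refine (mul_le_mul_of_nonneg_left b3 (by positivity)).trans (le_of_eq ?_)
    have hP' : P = (‖x‖ ^ (e + 4))⁻¹ := eq_inv_of_mul_eq_one_left hP
    rw [hP']
    field_simp
    ring
  calc _ ≤ (e + 1) * B * ‖x‖⁻¹ * ‖x‖ := by gcongr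
    _ = (e + 1) * B := by field_simp

lemma DecaySol.pde_kelvin (hd : 3 ≤ d) (h : DecaySol ℓ η B s v) {e : ℕ} (he : 2 + e = d)
    {a : ℝ} (ha : (e : ℝ) = 2 * a) (h0 : 0 ≤ x ℓ) (hx : x ≠ 0) (hx1 : ‖x‖ ≤ 1 / 2) :
    ∃ p γ : EuclideanSpace ℝ (Fin d), ‖p‖ = 1 ∧ ‖γ‖ ≤ 1 / 100 * ‖x‖ ^ 2 ∧
    |∑ k, fderiv ℝ (fderiv ℝ (kelvin a s v)) x (EuclideanSpace.single k 1 + γ k • p)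
      (EuclideanSpace.single k 1 + γ k • p)| ≤ B := by
  have hn := norm_pos_iff.2 hx
  obtain ⟨a0, a1, a2, a3, a4⟩ := h.at_invPt he h0 hx hx1
  have hP := rpow_norm_sq_mul hx ha
  set P := (‖x‖ ^ 2) ^ (-a - 2) with hPd
  have hP0 : 0 ≤ P := by positivity
  have hB := h.pos
  have hd1 : (3 : ℝ) ≤ d := by exact_mod_cast hd
  have hed : (e : ℝ) = d - 2 := by rw [← he]; push_cast; ring
  have he1 : 1 ≤ e := by omega
  set L := fderiv ℝ v (invPt x) with hL
  set c : EuclideanSpace ℝ (Fin d) := WithLp.toLp 2 fun k => dirCoef ℓ v k (invPt x) with hc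
  set ν : EuclideanSpace ℝ (Fin d) := ‖x‖⁻¹ • x with hν
  have hν1 : ‖ν‖ = 1 := by rw [hν, norm_smul, norm_inv, norm_norm, inv_mul_cancel₀ hn.ne']
  set γ : EuclideanSpace ℝ (Fin d) := c - (2 * inner ℝ ν c) • ν with hγ
  set p : EuclideanSpace ℝ (Fin d) := EuclideanSpace.single ℓ 1 - (2 * ν ℓ) • ν with hp
  have hp1 : ‖p‖ = 1 := by
    have := norm_reflect hν1 (EuclideanSpace.single ℓ (1 : ℝ))
    rw [EuclideanSpace.inner_single_right, PiLp.norm_single, norm_one] at this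
    simpa only [conj_trivial, one_mul, ← hp] using this
  have hcn : ‖c‖ ≤ 2 * d * (B * ‖x‖ ^ (e + 1)) := by
    have e1 : c = ∑ k, EuclideanSpace.single k (c k) := by
      ext i; simp
    rw [e1]
    refine (norm_sum_le _ _).trans ?_
    calc ∑ k, ‖EuclideanSpace.single k (c k)‖ ≤ ∑ k : Fin d, 2 * (B * ‖x‖ ^ (e + 1)) := by
          refine Finset.sum_le_sum fun k _ => ?_
          rw [PiLp.norm_single, Real.norm_eq_abs]
          have := abs_dirCoef_le (ℓ := ℓ) h.le_half (h.sol.small _ a0 (by linarith)) k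
          have e2 : c k = dirCoef ℓ v k (invPt x) := rfl
          rw [e2]
          linarith
      _ = _ := by simp; ring
  have hγn : ‖γ‖ ≤ 2 * d * (B * ‖x‖ ^ (e + 1)) := by rw [hγ, norm_reflect hν1]; exact hcn
  have hxe : ‖x‖ ^ (e + 1) ≤ ‖x‖ ^ 2 := pow_le_pow_of_le_one hn.le (by linarith) (by omega)
  have hdB : 600 * d ^ 2 * (d * B) ≤ 1 := by have := h.le; linarith only [this]
  have hdB' : d * B ≤ 1 / 600 := by
    have : 600 * 1 * (d * B) ≤ 600 * d ^ 2 * (d * B) := by gcongr; nlinarith only [hd1]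
    linarith
  have hγ2 : ‖γ‖ ≤ 1 / 100 * ‖x‖ ^ 2 := by
    calc ‖γ‖ ≤ 2 * d * (B * ‖x‖ ^ (e + 1)) := hγn
      _ ≤ 2 * d * (B * ‖x‖ ^ 2) := by gcongr
      _ = 2 * (d * B) * ‖x‖ ^ 2 := by ring
      _ ≤ 1 / 100 * ‖x‖ ^ 2 := by gcongr; linarith
  have hx2 : ‖x‖ ^ 2 ≤ 1 := pow_le_one₀ hn.le (by linarith)
  refine ⟨p, γ, hp1, hγ2, ?_⟩
  have hpde := sum_fderiv_reflected a2 (c := c) (h.sol.pde _ a0 (by linarith)) hν1 hγ hp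
  have hsum : ∑ k, fderiv ℝ (fderiv ℝ (kelvin a s v)) x (EuclideanSpace.single k 1 + γ k • p)
      (EuclideanSpace.single k 1 + γ k • p) =
      P * ∑ k, ((4 * a * (a + 1) * inner ℝ x (EuclideanSpace.single k 1 + γ k • p) ^ 2 -
        2 * a * ‖x‖ ^ 2 *
          ‖(EuclideanSpace.single k 1 + γ k • p : EuclideanSpace ℝ (Fin d))‖ ^ 2) *
            (v (invPt x) - s) -
        (4 * a + 4) * inner ℝ x (EuclideanSpace.single k 1 + γ k • p) *
          L (EuclideanSpace.single k 1 + γ k • p) +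
        ((8 * a + 8) * inner ℝ x (EuclideanSpace.single k 1 + γ k • p) ^ 2 / ‖x‖ ^ 2 -
          2 * ‖(EuclideanSpace.single k 1 + γ k • p : EuclideanSpace ℝ (Fin d))‖ ^ 2) * L x) := by
    rw [Finset.mul_sum, ← sub_eq_zero, ← Finset.sum_sub_distrib,
      ← mul_zero (P * (‖x‖ ^ 2)⁻¹ ^ 2 * (‖x‖ ^ 2) ^ 2), ← hpde, Finset.mul_sum]
    refine Finset.sum_congr rfl fun k _ => ?_
    have j := jet_kelvin a s hx a2 (EuclideanSpace.single k 1 + γ k • p) (q := ‖x‖ ^ 2)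
      rfl rfl rfl rfl
    rw [((HasJet.of_contDiffAt (contDiffAt_kelvin a s hx a2) _).unique j).2,
      smul_reflect_direction hx rfl, ← hPd, ← hL, ← hν, map_smul, map_smul,
      _root_.smul_apply, smul_eq_mul, smul_eq_mul]
    ring
  rw [hsum, abs_mul, abs_of_nonneg hP0]
  have hb := kelvin_sum_bound hd hp1 (by linarith : ‖γ‖ ≤ 1) hx
    (by rw [← ha, hed]; ring : (d : ℝ) = 2 * a + 2) L (v (invPt x) - s)
  calc _ ≤ P * (7 * d ^ 2 * ‖γ‖ * (‖x‖ ^ 2 * |v (invPt x) - s| + ‖x‖ * ‖L‖)) := by gcongr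
    _ ≤ P * (7 * d ^ 2 * (2 * d * (B * ‖x‖ ^ (e + 1))) *
        (‖x‖ ^ 2 * (B * ‖x‖ ^ e) + ‖x‖ * (B * ‖x‖ ^ (e + 1)))) := by gcongr
    _ = P * ‖x‖ ^ (e + 4) * (28 * d ^ 2 * (d * B)) * (‖x‖ ^ (e - 1) * B) := by
        obtain ⟨e', rfl⟩ : ∃ e', e = e' + 1 := ⟨e - 1, by omega⟩
        rw [Nat.add_sub_cancel]
        ring
    _ ≤ 1 * 1 * (1 * B) := by
        rw [hP]
        have : ‖x‖ ^ (e - 1) ≤ 1 := pow_le_one₀ hn.le (by linarith)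
        gcongr
        have : 0 ≤ d ^ 2 * (d * B) := by positivity
        linarith
    _ = B := by ring

lemma DecaySol.pd_kelvin (h : DecaySol ℓ η B s v) {e : ℕ} (he : 2 + e = d)
    {a : ℝ} (ha : (e : ℝ) = 2 * a) (h0 : x ℓ = 0) (hx : x ≠ 0) (hx1 : ‖x‖ ≤ 1 / 2) (he1 : 1 ≤ e) :
    0 ≤ pd ℓ (kelvin a s v) x ∧ pd ℓ (kelvin a s v) x ≤ d * B ^ 2 * ‖x‖ := by
  have hn := norm_pos_iff.2 hx
  obtain ⟨a0, a1, a2, a3, a4⟩ := h.at_invPt he h0.ge hx hx1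
  have hP := rpow_norm_sq_mul hx ha
  set P := (‖x‖ ^ 2) ^ (-a - 2) with hPd
  have hP0 : 0 ≤ P := by positivity
  have hB := h.pos
  have y0 : invPt x ℓ = 0 := by rw [invPt, PiLp.smul_apply, h0, smul_zero]
  have b1 := h.sol.bdry _ y0 (by linarith)
  have b2 := h.sol.bdry_nonneg _ y0 (by linarith)
  have b3 : pd ℓ v (invPt x) ≤ d * (B * ‖x‖ ^ (e + 1)) ^ 2 := by
    have : ∑ j, pd j v (invPt x) ^ 2 ≤ ∑ j : Fin d, (B * ‖x‖ ^ (e + 1)) ^ 2 :=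
      Finset.sum_le_sum fun j _ => sq_le_sq' (abs_le.1 ((abs_pd_le j).trans a4)).1
        (abs_le.1 ((abs_pd_le j).trans a4)).2
    rw [Finset.sum_const, Finset.card_univ, Fintype.card_fin, nsmul_eq_mul] at this
    unfold bdryFun at b1
    have h0 : 0 ≤ d * (B * ‖x‖ ^ (e + 1)) ^ 2 := by positivity
    have h1 := sq_nonneg (pd ℓ v (invPt x))
    linarith only [b1, this, h0, h1]
  have hin : inner ℝ x (EuclideanSpace.single ℓ (1 : ℝ)) = 0 := by
    rw [EuclideanSpace.inner_single_right, h0]; simp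
  have j := jet_kelvin a s hx a2 (EuclideanSpace.single ℓ 1) (q := ‖x‖ ^ 2) rfl hin rfl rfl
  have hpd : pd ℓ (kelvin a s v) x = P * ‖x‖ ^ 2 * pd ℓ v (invPt x) := by
    have := ((HasJet.of_contDiffAt (contDiffAt_kelvin a s hx a2) _).unique j).1
    rw [show pd ℓ (kelvin a s v) x = fderiv ℝ (kelvin a s v) x (EuclideanSpace.single ℓ 1) from rfl,
      this, ← hPd, mul_zero, mul_zero, zero_div, zero_smul, sub_zero, neg_zero, zero_mul, zero_add,
      map_smul, smul_eq_mul, mul_inv_cancel_left₀ (by positivity)]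
    rfl
  rw [hpd]
  refine ⟨by positivity, ?_⟩
  calc P * ‖x‖ ^ 2 * pd ℓ v (invPt x) ≤ P * ‖x‖ ^ 2 * (d * (B * ‖x‖ ^ (e + 1)) ^ 2) := by gcongr
    _ = P * ‖x‖ ^ (e + 4) * (d * B ^ 2 * ‖x‖ ^ e) := by ring
    _ ≤ d * B ^ 2 * ‖x‖ := by
      rw [hP, one_mul]
      gcongr
      calc ‖x‖ ^ e ≤ ‖x‖ ^ 1 := pow_le_pow_of_le_one hn.le (by linarith) he1
        _ = ‖x‖ := pow_one _

lemma kelvin_eq_rpow (hx : x ≠ 0) {e : ℕ} {a : ℝ} (ha : (e : ℝ) = 2 * a) :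
    kelvin a s v x = (v (invPt x) - s) / ‖x‖ ^ e := by
  have hn := norm_pos_iff.2 hx
  rw [kelvin, ← rpow_natCast ‖x‖ 2, ← rpow_mul hn.le, Nat.cast_ofNat,
    show 2 * -a = -(e : ℝ) by rw [ha]; ring, rpow_neg hn.le, rpow_natCast, div_eq_inv_mul]

lemma DecaySol.nearNeumann (hd : 3 ≤ d) (h : DecaySol ℓ η B s v) {e : ℕ} (he : 2 + e = d)
    {a : ℝ} (ha : (e : ℝ) = 2 * a) :
    NearNeumann ℓ (fun x => (2 * d * B)⁻¹ * kelvin a s v x) := by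
  have hB := h.pos
  have hd1 : (3 : ℝ) ≤ d := by exact_mod_cast hd
  have hed : (e : ℝ) = d - 2 := by rw [← he]; push_cast; ring
  have hA : 0 < 2 * d * B := by positivity
  have hsm : ∀ x, 0 ≤ x ℓ → x ≠ 0 → ‖x‖ ≤ 1 / 2 → ContDiffAt ℝ 2 (kelvin a s v) x :=
    fun x h0 hx hx1 => contDiffAt_kelvin a s hx (h.at_invPt he h0 hx hx1).2.2.1
  have hfd : ∀ x, 0 ≤ x ℓ → x ≠ 0 → ‖x‖ ≤ 1 / 2 →
      fderiv ℝ (fun x => (2 * d * B)⁻¹ * kelvin a s v x) x =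
        (2 * d * B)⁻¹ • fderiv ℝ (kelvin a s v) x := fun x h0 hx hx1 =>
    fderiv_const_mul ((hsm x h0 hx hx1).differentiableAt (by simp)) _
  refine ⟨fun x h0 hx hx1 => contDiffAt_const.mul (hsm x h0 hx hx1), fun x h0 hx hx1 => ?_,
    fun x h0 hx hx1 => ?_, fun x h0 hx hx1 => ?_, fun x h0 hx hx1 => ?_⟩
  · have hn := norm_pos_iff.2 hx
    rw [kelvin_eq_rpow hx ha, abs_mul, abs_of_pos (inv_pos.2 hA), inv_mul_le_iff₀ hA, abs_div,
      abs_of_pos (by positivity : 0 < ‖x‖ ^ e), div_le_iff₀ (by positivity)]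
    have := (h.at_invPt he h0 hx hx1).2.2.2.1
    refine this.trans ?_
    gcongr
    nlinarith only [hd1, hB]
  · rw [hfd x h0 hx hx1, norm_smul, norm_inv, Real.norm_eq_abs, abs_of_pos hA, mul_assoc,
      inv_mul_le_iff₀ hA]
    refine (h.fderiv_kelvin_bound he ha h0 hx hx1).trans ?_
    rw [hed]
    nlinarith only [hd1, hB]
  · obtain ⟨p, γ, hp, hγ, hs⟩ := h.pde_kelvin hd he ha h0 hx hx1
    refine ⟨p, γ, hp, hγ, ?_⟩
    have : ∀ ξ, fderiv ℝ (fderiv ℝ fun x => (2 * d * B)⁻¹ * kelvin a s v x) x ξ ξ =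
        (2 * d * B)⁻¹ * fderiv ℝ (fderiv ℝ (kelvin a s v)) x ξ ξ := fun ξ =>
      ((HasJet.of_contDiffAt (contDiffAt_const.mul (hsm x h0 hx hx1)) ξ).unique
        ((HasJet.of_contDiffAt (hsm x h0 hx hx1) ξ).const_mul _)).2
    simp only [this]
    rw [← Finset.mul_sum, abs_mul, abs_of_pos (inv_pos.2 hA), inv_mul_le_iff₀ hA]
    refine hs.trans ?_
    nlinarith only [hd1, hB]
  · obtain ⟨b1, b2⟩ := h.pd_kelvin he ha h0 hx hx1 (by omega)
    have hpd : pd ℓ (fun x => (2 * d * B)⁻¹ * kelvin a s v x) x =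
        (2 * d * B)⁻¹ * pd ℓ (kelvin a s v) x := by
      unfold pd
      rw [hfd x h0.ge hx hx1]
      rfl
    rw [hpd]
    refine ⟨by positivity, ?_⟩
    rw [inv_mul_le_iff₀ hA]
    refine b2.trans ?_
    have hB1 : B ≤ 1 / 2 := by
      have h1 := h.le
      have : 600 * (1 : ℝ) ^ 3 * B ≤ 600 * (d : ℝ) ^ 3 * B := by gcongr; linarith
      linarith
    calc d * B ^ 2 * ‖x‖ = d * B * ‖x‖ * B := by ring
      _ ≤ d * B * ‖x‖ * (1 / 2) := by gcongr
      _ = _ := by ring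

/-- Expansion at infinity to first order. -/
lemma DecaySol.expansion (hd : 3 ≤ d) (h : DecaySol ℓ η B s v) :
    ∃ k : ℝ, |k| ≤ 2 * d * B ∧ ∀ y, 0 ≤ y ℓ → 2 ≤ ‖y‖ →
      |v y - s - k * ‖y‖ ^ ((2 : ℝ) - d)| ≤
        2 * d * B * (1000 * d + 2) * ‖y‖ ^ (1 - (d : ℝ)) := by
  obtain ⟨e, he⟩ : ∃ e, 2 + e = d := ⟨d - 2, by omega⟩
  have ha : (e : ℝ) = 2 * ((e : ℝ) / 2) := by ring
  obtain ⟨k, hk, hk'⟩ := (h.nearNeumann hd he ha).exists_limit hd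
  have hB := h.pos
  have hd1 : (3 : ℝ) ≤ d := by exact_mod_cast hd
  have hA : 0 < 2 * d * B := by positivity
  refine ⟨2 * d * B * k, ?_, fun y h0 hy => ?_⟩
  · rw [abs_mul, abs_of_pos hA]
    nlinarith only [hA, hk]
  have hn : 0 < ‖y‖ := by linarith
  have hy0 : y ≠ 0 := norm_pos_iff.1 hn
  have hx0 : invPt y ≠ 0 := norm_pos_iff.1 (by rw [norm_invPt hy0]; positivity)
  have := hk' (invPt y) (by rw [invPt, PiLp.smul_apply, smul_eq_mul]; positivity) hx0
    (by rw [norm_invPt hy0, inv_le_comm₀ hn (by norm_num)]; linarith)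
  rw [kelvin_eq_rpow hx0 ha, invPt_invPt hy0, norm_invPt hy0] at this
  have e1 := inv_rpow_sub_natCast (inv_pos.2 hn) he
  have e2 := inv_rpow_sub_natCast (inv_pos.2 hn) (show 1 + (e + 1) = d by omega)
  rw [inv_inv, Nat.cast_ofNat] at e1
  rw [inv_inv, Nat.cast_one] at e2
  rw [e1, e2]
  set ρ := ‖y‖⁻¹ with hρ
  have hρ0 : 0 < ρ := inv_pos.2 hn
  have e3 : v y - s - 2 * d * B * k * ρ ^ e =
      2 * d * B * ρ ^ e * ((2 * d * B)⁻¹ * ((v y - s) / ρ ^ e) - k) := by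
    field_simp
  rw [e3, abs_mul, abs_of_pos (by positivity)]
  calc _ ≤ 2 * d * B * ρ ^ e * ((1000 * d + 2) * ρ) := by gcongr
    _ = _ := by ring

end KelvinSolution

section UpperSphere

variable {d : ℕ}

/-- The open upper half of the unit sphere. -/
def openUpSphere (ℓ : Fin d) : Set (EuclideanSpace ℝ (Fin d)) := {y | ‖y‖ = 1 ∧ 0 < y ℓ}

/-- Inverse stereographic projection from `-e_ℓ`. -/
def invStereo (ℓ : Fin d) (z : {i : Fin d // i ≠ ℓ} → ℝ) : EuclideanSpace ℝ (Fin d) :=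
  WithLp.toLp 2 fun i => if h : i = ℓ then (1 - ∑ j, z j ^ 2) / (1 + ∑ j, z j ^ 2)
    else 2 * z ⟨i, h⟩ / (1 + ∑ j, z j ^ 2)

lemma contDiff_invStereo (ℓ : Fin d) : ContDiff ℝ 1 (invStereo ℓ) := by
  rw [contDiff_euclidean]
  intro i
  have h0 : ∀ z : {i : Fin d // i ≠ ℓ} → ℝ, 1 + ∑ j, z j ^ 2 ≠ 0 := fun z => by positivity
  by_cases h : i = ℓ
  · simp only [invStereo, h, dite_true]
    exact ContDiff.div (by fun_prop) (by fun_prop) h0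
  · simp only [invStereo, h, dite_false]
    exact ContDiff.div (by fun_prop) (by fun_prop) h0

lemma norm_sq_eq_add_sum (ℓ : Fin d) (x : EuclideanSpace ℝ (Fin d)) :
    ‖x‖ ^ 2 = x ℓ ^ 2 + ∑ j : {i : Fin d // i ≠ ℓ}, x j ^ 2 := by
  rw [← sum_sq_coord, ← Finset.add_sum_erase _ (fun i => x i ^ 2) (Finset.mem_univ ℓ)]
  congr 1
  exact Finset.sum_subtype _ (by simp) _

lemma openUpSphere_subset_image (ℓ : Fin d) :
    openUpSphere ℓ ⊆ invStereo ℓ '' Metric.closedBall 0 1 := by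
  rintro x ⟨hx, h0⟩
  have h1 := norm_sq_eq_add_sum ℓ x
  rw [hx, one_pow] at h1
  have hp : 0 < 1 + x ℓ := by linarith
  have hQ : ∑ j : {i : Fin d // i ≠ ℓ}, (x j / (1 + x ℓ)) ^ 2 = (1 - x ℓ) / (1 + x ℓ) := by
    simp only [div_pow]
    rw [← Finset.sum_div]
    field_simp
    linarith
  refine ⟨fun j => x j / (1 + x ℓ), ?_, ?_⟩
  · rw [mem_closedBall_zero_iff, pi_norm_le_iff_of_nonneg zero_le_one]
    intro j
    have := PiLp.norm_apply_le x j
    rw [norm_div, Real.norm_eq_abs (1 + x ℓ), abs_of_pos hp, div_le_one hp]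
    linarith
  · ext i
    simp only [invStereo, hQ]
    split_ifs with h
    · subst h
      field_simp
      ring
    · field_simp
      ring

lemma card_ne_cast (ℓ : Fin d) : ((Fintype.card {i : Fin d // i ≠ ℓ} : ℕ) : ℝ) = (d : ℝ) - 1 := by
  have hd : 1 ≤ d := by have := ℓ.2; omega
  rw [Fintype.card_subtype_compl, Fintype.card_fin, Fintype.card_subtype_eq, Nat.cast_sub hd,
    Nat.cast_one]

lemma hausdorff_openUpSphere_ne_top (ℓ : Fin d) : μH[(d : ℝ) - 1] (openUpSphere ℓ) ≠ ⊤ := by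
  obtain ⟨K, hK⟩ := (contDiff_invStereo ℓ).locallyLipschitz.locallyLipschitzOn
    (s := Metric.closedBall 0 1) |>.exists_lipschitzOnWith_of_compact
    (isCompact_closedBall 0 1)
  have hd : (0 : ℝ) ≤ (d : ℝ) - 1 := by rw [← card_ne_cast ℓ]; positivity
  have h1 := hK.hausdorffMeasure_image_le hd
  have h2 : μH[(d : ℝ) - 1] (Metric.closedBall (0 : {i : Fin d // i ≠ ℓ} → ℝ) 1) ≠ ⊤ := by
    rw [← card_ne_cast ℓ, hausdorffMeasure_pi_real]
    exact (isCompact_closedBall _ _).measure_ne_top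
  exact ne_top_of_le_ne_top (ENNReal.mul_ne_top (ENNReal.rpow_ne_top_of_nonneg hd ENNReal.coe_ne_top) h2)
    ((measure_mono (openUpSphere_subset_image ℓ)).trans h1)

lemma hausdorff_openUpSphere_ne_zero (ℓ : Fin d) : μH[(d : ℝ) - 1] (openUpSphere ℓ) ≠ 0 := by
  have hd : (0 : ℝ) ≤ (d : ℝ) - 1 := by rw [← card_ne_cast ℓ]; positivity
  set pr : EuclideanSpace ℝ (Fin d) → ({i : Fin d // i ≠ ℓ} → ℝ) := fun x j => x j with h_pr
  have hL : LipschitzWith 1 pr := LipschitzWith.of_dist_le_mul fun x y => by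
    rw [NNReal.coe_one, one_mul, dist_pi_le_iff dist_nonneg]
    intro j
    rw [dist_eq_norm, dist_eq_norm]
    exact PiLp.norm_apply_le (x - y) j
  have h1 := hL.hausdorffMeasure_image_le hd (openUpSphere ℓ)
  set U : Set ({i : Fin d // i ≠ ℓ} → ℝ) := {z | ∑ j, z j ^ 2 < 1} with hU
  have hUo : IsOpen U := isOpen_lt (by fun_prop) continuous_const
  have hsub : U ⊆ pr '' openUpSphere ℓ := by
    intro z hz
    have hz : ∑ j, z j ^ 2 < 1 := hz
    set x : EuclideanSpace ℝ (Fin d) := WithLp.toLp 2 fun i => if h : i = ℓ then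
      √(1 - ∑ j, z j ^ 2) else z ⟨i, h⟩ with hx
    have e1 : x ℓ = √(1 - ∑ j, z j ^ 2) := by simp [hx]
    have e2 : ∀ j : {i : Fin d // i ≠ ℓ}, x j = z j := fun j => by simp [hx, j.2]
    refine ⟨x, ⟨?_, ?_⟩, funext e2⟩
    · have := norm_sq_eq_add_sum ℓ x
      simp only [e1, e2] at this
      rw [sq_sqrt (by linarith), sub_add_cancel] at this
      exact (pow_eq_one_iff_of_nonneg (norm_nonneg x) two_ne_zero).1 this
    · rw [e1]
      exact sqrt_pos.2 (by linarith)
  have h2 : 0 < μH[(d : ℝ) - 1] U := by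
    rw [← card_ne_cast ℓ, hausdorffMeasure_pi_real]
    exact hUo.measure_pos _ ⟨0, by simp [hU]⟩
  intro h
  rw [h, mul_zero] at h1
  exact absurd ((measure_mono hsub).trans h1) (not_le.2 h2)

lemma abs_average_sub_le (ℓ : Fin d) {v : EuclideanSpace ℝ (Fin d) → ℝ} {s M : ℝ}
    (hv : ContinuousOn v (openUpSphere ℓ)) (hM : ∀ y ∈ openUpSphere ℓ, |v y - s| ≤ M) :
    |(⨍ y in openUpSphere ℓ, v y ∂(μH[(d : ℝ) - 1])) - s| ≤ M := by
  have hmeas : MeasurableSet (openUpSphere ℓ) := by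
    have h1 : MeasurableSet {y : EuclideanSpace ℝ (Fin d) | ‖y‖ = 1} :=
      (isClosed_eq continuous_norm continuous_const).measurableSet
    have h2 : MeasurableSet {y : EuclideanSpace ℝ (Fin d) | 0 < y ℓ} :=
      (isOpen_lt continuous_const (by fun_prop)).measurableSet
    exact h1.inter h2
  have hae : ∀ᵐ y ∂(μH[(d : ℝ) - 1]).restrict (openUpSphere ℓ), v y ∈ Metric.closedBall s M :=
    (ae_restrict_iff' hmeas).2 (Eventually.of_forall fun y hy => by
      rw [Metric.mem_closedBall, Real.dist_eq]; exact hM y hy)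
  have h_int : IntegrableOn v (openUpSphere ℓ) (μH[(d : ℝ) - 1]) := by
    have : IsFiniteMeasure ((μH[(d : ℝ) - 1]).restrict (openUpSphere ℓ)) :=
      ⟨by rw [Measure.restrict_apply_univ]; exact (hausdorff_openUpSphere_ne_top ℓ).lt_top⟩
    refine Integrable.of_bound (hv.aestronglyMeasurable hmeas) (|s| + M) ?_
    filter_upwards [hae] with y hy
    rw [Metric.mem_closedBall, Real.dist_eq] at hy
    have := abs_sub_abs_le_abs_sub (v y) s
    rw [Real.norm_eq_abs]
    linarith
  have := (convex_closedBall s M).set_average_mem Metric.isClosed_closedBall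
    (hausdorff_openUpSphere_ne_zero ℓ) (hausdorff_openUpSphere_ne_top ℓ) hae h_int
  rwa [Metric.mem_closedBall, Real.dist_eq] at this

end UpperSphere

section MainExpansion

variable {d : ℕ} {ℓ : Fin d} {η : ℝ} {v : EuclideanSpace ℝ (Fin d) → ℝ}

lemma SmallSol.osc_half_annulus (hv : SmallSol ℓ η v) (h0 : 0 ≤ η) {m : ℝ}
    (hm : m = sSup (v '' {y | 0 ≤ y ℓ ∧ 1 ≤ ‖y‖ ∧ ‖y‖ ≤ 2}) -
      sInf (v '' {y | 0 ≤ y ℓ ∧ 1 ≤ ‖y‖ ∧ ‖y‖ ≤ 2})) :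
    (∀ x z, 0 ≤ x ℓ → 1 ≤ ‖x‖ → ‖x‖ ≤ 2 → 0 ≤ z ℓ → 1 ≤ ‖z‖ → ‖z‖ ≤ 2 → v x - v z ≤ m) ∧
      m ≤ 8 * η := by
  set K : Set (EuclideanSpace ℝ (Fin d)) := {y | 0 ≤ y ℓ ∧ 1 ≤ ‖y‖ ∧ ‖y‖ ≤ 2} with hK
  have hc : ContinuousOn v K := fun x hx =>
    (hv.contDiffAt hx.1 hx.2.1).continuousAt.continuousWithinAt
  have hcomp : IsCompact (v '' K) := (isCompact_half_annulus 1 2).image_of_continuousOn hc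
  refine ⟨fun x z x0 x1 x2 z0 z1 z2 => ?_, ?_⟩
  · have h1 := le_csSup hcomp.bddAbove ⟨x, ⟨x0, x1, x2⟩, rfl⟩
    have h2 := csInf_le hcomp.bddBelow ⟨z, ⟨z0, z1, z2⟩, rfl⟩
    linarith
  · have hne : (v '' K).Nonempty := by
      refine ⟨_, EuclideanSpace.single ℓ 1, ⟨?_, ?_, ?_⟩, rfl⟩ <;> simp
    obtain ⟨x, hx, hx'⟩ := hcomp.sSup_mem hne
    obtain ⟨z, hz, hz'⟩ := hcomp.sInf_mem hne
    rw [hm, ← hx', ← hz']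
    have h1 := (abs_le.1 (hv.abs_sub_le hz.1 hz.2.1 hx.1 hx.2.1)).2
    have h2 : ‖x - z‖ ≤ 4 := (norm_sub_le _ _).trans (by linarith [hx.2.2, hz.2.2])
    nlinarith only [h0, h1, h2]

lemma SmallSol.expansion (hd : 3 ≤ d) (h0 : 0 ≤ η) (hη : 1000000000 * (d : ℝ) ^ 5 * 4 ^ d * η ≤ 1)
    (hv : SmallSol ℓ η v)
    (hb : (∃ M, ∀ x, 0 ≤ x ℓ → 1 ≤ ‖x‖ → v x ≤ M) ∨ ∃ M, ∀ x, 0 ≤ x ℓ → 1 ≤ ‖x‖ → M ≤ v x) {m : ℝ}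
    (hm : ∀ x z, 0 ≤ x ℓ → 1 ≤ ‖x‖ → ‖x‖ ≤ 2 → 0 ≤ z ℓ → 1 ≤ ‖z‖ → ‖z‖ ≤ 2 → v x - v z ≤ m)
    (hm8 : m ≤ 8 * η) :
    ∃ s k, (∀ x, 0 ≤ x ℓ → ‖x‖ = 1 → |v x - s| ≤ 4 * m) ∧
      |k| ≤ 2 * d * (4000 * d * 4 ^ d * m) ∧
      ∀ y, 0 ≤ y ℓ → 1 ≤ ‖y‖ → |v y - s - k * ‖y‖ ^ ((2 : ℝ) - d)| ≤
        2 ^ d * (2 * d * (4000 * d * 4 ^ d) * (1000 * d + 2)) * ‖y‖ ^ (1 - (d : ℝ)) * m := by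
  have hd1 : (3 : ℝ) ≤ d := by exact_mod_cast hd
  have h4 : (1 : ℝ) ≤ 4 ^ d := one_le_pow₀ (by norm_num)
  have h24 : (2 : ℝ) ^ d ≤ 4 ^ d := pow_le_pow_left₀ (by norm_num) (by norm_num) _
  have hη1 : 1000000000 * (d : ℝ) ^ 5 * η ≤ 1 := by
    refine le_trans ?_ hη
    have : 0 ≤ 1000000000 * (d : ℝ) ^ 5 * η := by positivity
    nlinarith only [this, h4]
  obtain ⟨s, hs1, hs2, hs3⟩ := hv.exists_decay hd h0 hη1 hb hm hm8
  have hm0 : 0 ≤ m := by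
    have h1 : ‖(EuclideanSpace.single ℓ 1 : EuclideanSpace ℝ (Fin d))‖ = 1 := by simp
    have h2 : 0 ≤ (EuclideanSpace.single ℓ 1 : EuclideanSpace ℝ (Fin d)) ℓ := by simp
    have := hm _ _ h2 h1.ge (by linarith) h2 h1.ge (by linarith)
    linarith
  rcases hm0.eq_or_lt with rfl | hm0
  · refine ⟨s, 0, hs1, by simp, fun y y0 y1 => ?_⟩
    have := hs2 y y0 y1
    simpa using this
  set B := 4000 * d * 4 ^ d * m with hB
  have hB0 : 0 < B := by positivity
  have hval : ∀ x, 0 ≤ x ℓ → 1 ≤ ‖x‖ → |v x - s| ≤ B * ‖x‖ ^ ((2 : ℝ) - d) := by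
    intro x x0 x1
    refine (hs2 x x0 x1).trans ?_
    gcongr
    rw [hB]
    have h1 : (2 : ℝ) ^ d * (4 * m) ≤ 4 ^ d * (4 * m) := by gcongr
    have h2 : 4 ^ d * (4 * m) * 1 ≤ 4 ^ d * (4 * m) * (1000 * d) := by gcongr; linarith
    linarith
  have hdec : DecaySol ℓ η B s v := by
    refine ⟨hv, ?_, hB0, ?_, fun y y0 y2 => hval y y0 (by linarith), fun y y0 y2 => ?_⟩
    · have h1 : (1 : ℝ) ≤ d ^ 5 := one_le_pow₀ (by linarith)
      have : 1000000000 * 1 * η ≤ 1000000000 * (d : ℝ) ^ 5 * η := by gcongr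
      linarith
    · calc 600 * d ^ 3 * B ≤ 600 * d ^ 3 * (4000 * d * 4 ^ d * (8 * η)) := by rw [hB]; gcongr
        _ = 19200000 * (d : ℝ) ^ 4 * 4 ^ d * η := by ring
        _ ≤ 1000000000 * (d : ℝ) ^ 5 * 4 ^ d * η := by
          gcongr
          · norm_num
          · linarith
          · norm_num
        _ ≤ 1 := hη
    · refine (hs3 y y0 y2).trans (le_of_eq ?_)
      rw [hB]; ring
  obtain ⟨k, hk, hk'⟩ := hdec.expansion hd
  refine ⟨s, k, hs1, hk, fun y y0 y1 => ?_⟩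
  have hn : 0 < ‖y‖ := by linarith
  have h2d : (1 : ℝ) ≤ 2 ^ d := one_le_pow₀ (by norm_num)
  have hrw : 2 ^ d * (2 * d * (4000 * d * 4 ^ d) * (1000 * d + 2)) * ‖y‖ ^ (1 - (d : ℝ)) * m =
      2 * d * B * (1000 * d + 2) * (2 ^ d * ‖y‖ ^ (1 - (d : ℝ))) := by rw [hB]; ring
  rw [hrw]
  rcases le_total 2 ‖y‖ with y2 | y2
  · refine (hk' y y0 y2).trans ?_
    gcongr
    exact le_mul_of_one_le_left (by positivity) h2d
  · have e1 : ‖y‖ ^ ((2 : ℝ) - d) ≤ 1 := rpow_le_one_of_one_le_of_nonpos y1 (by linarith)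
    have e2 : 1 ≤ 2 ^ d * ‖y‖ ^ (1 - (d : ℝ)) := by
      calc (1 : ℝ) ≤ 2 := by norm_num
        _ = 2 ^ d * (2 : ℝ) ^ (1 - (d : ℝ)) := by
          rw [← rpow_natCast, ← rpow_add (by norm_num)]; norm_num
        _ ≤ _ := by
          gcongr 2 ^ d * ?_
          exact rpow_le_rpow_of_nonpos hn y2 (by linarith)
    have e3 : |v y - s - k * ‖y‖ ^ ((2 : ℝ) - d)| ≤ B * 1 + 2 * d * B * 1 := by
      refine (abs_sub _ _).trans (add_le_add ((hval y y0 y1).trans (by gcongr)) ?_)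
      rw [abs_mul, abs_of_pos (rpow_pos_of_pos hn _)]
      gcongr
    calc _ ≤ B * 1 + 2 * d * B * 1 := e3
      _ ≤ 2 * d * B * (1000 * d + 2) * 1 := by
        have : 1 ≤ (d : ℝ) * d := by nlinarith only [hd1]
        nlinarith only [this, hB0, mul_le_mul_of_nonneg_left this hB0.le, hd1]
      _ ≤ _ := by gcongr

end MainExpansion

/-- Precise asymptotics at infinity, `d ≥ 3`: expansion `v(y) = s + k|y|^{2-d} + O(|y|^{1-d})`. -/
theorem stmt11 (d : ℕ) (hd : 3 ≤ d) :
    ∃ η₀ : ℝ, 0 < η₀ ∧ η₀ < 1 / 2 ∧ ∃ C : ℝ, 1 ≤ C ∧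
      ∀ v : EuclideanSpace ℝ (Fin d) → ℝ,
        IsHodSol d (by omega) v (extDom d (by omega)) →
        ((∃ M : ℝ, ∀ y ∈ extDom d (by omega), v y ≤ M) ∨
         (∃ m : ℝ, ∀ y ∈ extDom d (by omega), m ≤ v y)) →
        (∀ y ∈ extDom d (by omega), ‖fderiv ℝ v y‖ ≤ η₀) →
        ∀ m : ℝ,
          m = sSup (v '' halfAnn d (by omega) 2) - sInf (v '' halfAnn d (by omega) 2) →
          ∃ s k : ℝ,
            (∀ y ∈ extDom d (by omega),
              |v y - s - k * ‖y‖ ^ ((2 : ℝ) - d)| ≤ C * ‖y‖ ^ (1 - (d : ℝ)) * m) ∧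
            |k| ≤ C * m ∧
            |s| ≤ |⨍ y in {y : EuclideanSpace ℝ (Fin d) |
                      ‖y‖ = 1 ∧ 0 < y (lastIdx d (by omega))}, v y ∂(μH[(d : ℝ) - 1])| +
                  C * m := by
  have hd1 : (3 : ℝ) ≤ d := by exact_mod_cast hd
  have h4 : (1 : ℝ) ≤ 4 ^ d := one_le_pow₀ (by norm_num)
  have h2 : (1 : ℝ) ≤ 2 ^ d := one_le_pow₀ (by norm_num)
  have h5 : (1 : ℝ) ≤ (d : ℝ) ^ 5 := one_le_pow₀ (by linarith)
  have hX : 1 ≤ (d : ℝ) ^ 5 * 4 ^ d := one_le_mul_of_one_le_of_one_le h5 h4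
  have hη : 1000000000 * (d : ℝ) ^ 5 * 4 ^ d * (1 / (1000000000 * ((d : ℝ) ^ 5 * 4 ^ d))) ≤ 1 := by
    refine le_of_eq ?_
    field_simp
  have hη0 : 0 < 1 / (1000000000 * ((d : ℝ) ^ 5 * 4 ^ d)) := by positivity
  have hηh : 1 / (1000000000 * ((d : ℝ) ^ 5 * 4 ^ d)) < 1 / 2 :=
    one_div_lt_one_div_of_lt (by norm_num) (by linarith)
  have hQ1 : (1 : ℝ) ≤ 4000 * d * 4 ^ d := by nlinarith only [h4, hd1]
  have hQ2 : 2 * d * (4000 * d * 4 ^ d) ≤ 2 * d * (4000 * d * 4 ^ d) * (1000 * (d : ℝ) + 2) :=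
    le_mul_of_one_le_right (by positivity) (by linarith)
  have hQ3 : 2 * d * (4000 * d * 4 ^ d) * (1000 * d + 2) ≤
      2 ^ d * (2 * d * (4000 * d * 4 ^ d) * (1000 * (d : ℝ) + 2)) :=
    le_mul_of_one_le_left (by positivity) h2
  have hQ4 : 4 ≤ 2 * d * (4000 * (d : ℝ) * 4 ^ d) := by nlinarith only [hQ1, hd1]
  refine ⟨_, hη0, hηh, 2 ^ d * (2 * d * (4000 * d * 4 ^ d) * (1000 * d + 2)), by linarith,
    fun v hv hb hg m hm => ?_⟩
  have hv' := hv.smallSol (by omega) hηh.le hg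
  obtain ⟨hm', hm8⟩ := hv'.osc_half_annulus hη0.le hm
  have hb' : (∃ M, ∀ x, 0 ≤ x (lastIdx d (by omega)) → 1 ≤ ‖x‖ → v x ≤ M) ∨
      ∃ M, ∀ x, 0 ≤ x (lastIdx d (by omega)) → 1 ≤ ‖x‖ → M ≤ v x :=
    hb.imp (fun ⟨M, h⟩ => ⟨M, fun x h0 h1 => h x ⟨h0, h1⟩⟩)
      (fun ⟨M, h⟩ => ⟨M, fun x h0 h1 => h x ⟨h0, h1⟩⟩)
  obtain ⟨s, k, h_s, hk, hvk⟩ := hv'.expansion hd hη0.le hη hb' hm' hm8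
  have hav := abs_average_sub_le (lastIdx d (by omega)) (v := v) (s := s) (M := 4 * m)
    (fun y hy => (hv'.contDiffAt hy.2.le hy.1.ge).continuousAt.continuousWithinAt)
    fun y hy => h_s y hy.2.le hy.1
  have hm0 : 0 ≤ m := by linarith [abs_nonneg k, (abs_nonneg _).trans hav]
  refine ⟨s, k, fun y hy => hvk y hy.1 hy.2, ?_, ?_⟩
  · refine hk.trans ?_
    rw [← mul_assoc]
    exact mul_le_mul_of_nonneg_right (by linarith) hm0
  · have e1 := abs_sub_abs_le_abs_sub s (⨍ y in openUpSphere (lastIdx d (by omega)),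
      v y ∂(μH[(d : ℝ) - 1]))
    rw [abs_sub_comm] at e1
    have e2 : 4 * m ≤ 2 ^ d * (2 * d * (4000 * d * 4 ^ d) * (1000 * d + 2)) * m :=
      mul_le_mul_of_nonneg_right (by linarith) hm0
    have e3 := e1.trans hav
    unfold openUpSphere at e3
    linarith
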